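/- Let k and s be integers with k ≥ 1000 and 2k² ≤ s ≤ (k²/2)(1/2 + log(3k/8)). Then for every real P ≥ 1, J_{s,k}(P) ≤ k^{2.055k³ − 5.91k² + 3s} · 1.06^{sk + 2s²/k − 9.7278k³} · P^{2s − k(k+1)/2 + Δ_s}, where Δ_s = (3/8) · k² · exp(1/2 − 2s/k² + 1.7/k). -/

import Mathlib

/-- `Jv s k P` is Vinogradov's integral `J_{s,k}(P)`: the number of `2s`-tuples of integers
`(x₁,…,x_s,y₁,…,y_s)` with `1 ≤ xᵢ, yᵢ ≤ P` satisfying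
`∑ᵢ (xᵢ^j − yᵢ^j) = 0` for every `1 ≤ j ≤ k`. -/
noncomputable def Jv (s k : ℕ) (P : ℝ) : ℕ :=
  Nat.card {xy : (Fin s → ℤ) × (Fin s → ℤ) //
    (∀ i, 1 ≤ xy.1 i ∧ (xy.1 i : ℝ) ≤ P ∧ 1 ≤ xy.2 i ∧ (xy.2 i : ℝ) ≤ P) ∧
    ∀ j, 1 ≤ j → j ≤ k → (∑ i, (xy.1 i ^ j - xy.2 i ^ j)) = 0}

open Finset in
/-- The number of pairs `(t, t')` in `T × T` with `V t = V t'`. -/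
def pairCount {τ A : Type*} [DecidableEq A] (T : Finset τ) (V : τ → A) : ℕ :=
  #{t ∈ T ×ˢ T | V t.1 = V t.2}

/-- Sum of the values of `u` along a tuple. -/
def tupleSum {A β : Type*} [AddCommMonoid A] {n : ℕ} (u : β → A) (y : Fin n → β) : A :=
  ∑ i, u (y i)

/-- The number of solutions of
`∑ᵢ v (zᵢ) + ∑ᵢ u (yᵢ) = ∑ᵢ v (z'ᵢ) + ∑ᵢ u (y'ᵢ)` with `z, z' ∈ Z` and all `yᵢ, y'ᵢ ∈ Y`. -/
def mixedCount {A β γ : Type*} [DecidableEq A] [AddCommMonoid A] {k : ℕ}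
    (Z : Finset (Fin k → β)) (v : β → A) (s : ℕ) (Y : Finset γ) (u : γ → A) : ℕ :=
  pairCount (Z ×ˢ Fintype.piFinset fun _ : Fin s => Y) fun t => tupleSum v t.1 + tupleSum u t.2

/-- The set of `n`-tuples with entries in `Y`. -/
abbrev tuples {γ : Type*} (n : ℕ) (Y : Finset γ) : Finset (Fin n → γ) :=
  Fintype.piFinset fun _ : Fin n => Y

namespace FiniteFourier

open Finset

variable {G : Type*} [AddCommGroup G] [Finite G]

/-- The exponential sum of the phases `V` over `T`. -/
noncomputable def expSum {τ G : Type*} [AddCommGroup G] (ψ : AddChar G ℂ) (T : Finset τ)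
    (V : τ → G) : ℂ :=
  ∑ t ∈ T, ψ (V t)

theorem sum_norm_expSum_sq [DecidableEq G] {τ : Type*} (T : Finset τ) (V : τ → G) :
    ∑ ψ : AddChar G ℂ, ‖expSum ψ T V‖ ^ 2 = Nat.card G * (pairCount T V : ℝ) := by
  classical
  have := Fintype.ofFinite G
  have h : ∀ ψ : AddChar G ℂ, ((‖expSum ψ T V‖ ^ 2 : ℝ) : ℂ)
      = ∑ t ∈ T ×ˢ T, ψ (V t.1 - V t.2) := by
    intro ψ
    rw [← Complex.normSq_eq_norm_sq, ← Complex.mul_conj, expSum, map_sum, sum_mul_sum,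
      sum_product]
    refine sum_congr rfl fun x _ => sum_congr rfl fun y _ => ?_
    rw [AddChar.map_sub_eq_div, div_eq_mul_inv, ← AddChar.map_neg_eq_inv, AddChar.map_neg_eq_conj]
  have h2 : ((∑ ψ : AddChar G ℂ, ‖expSum ψ T V‖ ^ 2 : ℝ) : ℂ)
      = ((Nat.card G * (pairCount T V : ℝ) : ℝ) : ℂ) := by
    rw [Complex.ofReal_sum]
    simp_rw [h]
    rw [sum_comm]
    simp_rw [AddChar.sum_apply_eq_ite, sub_eq_zero]
    rw [← sum_filter, sum_const, pairCount]
    simp [mul_comm]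
  exact_mod_cast h2

omit [Finite G] in
theorem apply_sum {ι : Type*} (ψ : AddChar G ℂ) (S : Finset ι) (f : ι → G) :
    ψ (∑ i ∈ S, f i) = ∏ i ∈ S, ψ (f i) := by
  classical
  induction S using Finset.induction_on with
  | empty => simp
  | insert a S ha ih => rw [sum_insert ha, prod_insert ha, AddChar.map_add_eq_mul, ih]

omit [Finite G] in
theorem expSum_prod {τ σ : Type*} (ψ : AddChar G ℂ) (Z : Finset τ) (W : Finset σ)
    (a : τ → G) (b : σ → G) :
    expSum ψ (Z ×ˢ W) (fun t => a t.1 + b t.2) = expSum ψ Z a * expSum ψ W b := by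
  simp only [expSum, AddChar.map_add_eq_mul]
  rw [sum_mul_sum, sum_product]

omit [Finite G] in
theorem expSum_tupleSum {γ : Type*} (ψ : AddChar G ℂ) (Y : Finset γ) (u : γ → G) (n : ℕ) :
    expSum ψ (tuples n Y) (tupleSum u) = expSum ψ Y u ^ n := by
  simp only [expSum, tupleSum, apply_sum]
  rw [sum_pow']

theorem sum_norm_mul_pow [DecidableEq G] {β γ : Type*} {k : ℕ} (Z : Finset (Fin k → β))
    (v : β → G) (s : ℕ) (Y : Finset γ) (u : γ → G) :
    ∑ ψ : AddChar G ℂ, ‖expSum ψ Z (tupleSum v)‖ ^ 2 * ‖expSum ψ Y u‖ ^ (2 * s)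
      = Nat.card G * (mixedCount Z v s Y u : ℝ) := by
  rw [mixedCount, ← sum_norm_expSum_sq]
  refine sum_congr rfl fun ψ _ => ?_
  rw [expSum_prod, expSum_tupleSum, norm_mul, norm_pow, mul_pow, ← pow_mul, mul_comm s]

theorem sum_norm_pow_mul_pow [DecidableEq G] {β γ : Type*} (k : ℕ) (I : Finset β)
    (v : β → G) (s : ℕ) (Y : Finset γ) (u : γ → G) :
    ∑ ψ : AddChar G ℂ, ‖expSum ψ I v‖ ^ (2 * k) * ‖expSum ψ Y u‖ ^ (2 * s)
      = Nat.card G * (mixedCount (tuples k I) v s Y u : ℝ) := by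
  rw [← sum_norm_mul_pow]
  refine sum_congr rfl fun ψ _ => ?_
  rw [expSum_tupleSum, norm_pow, ← pow_mul, mul_comm k]

theorem sum_norm_pow [DecidableEq G] {γ : Type*} (s : ℕ) (Y : Finset γ) (u : γ → G) :
    ∑ ψ : AddChar G ℂ, ‖expSum ψ Y u‖ ^ (2 * s)
      = Nat.card G * (pairCount (tuples s Y) (tupleSum u) : ℝ) := by
  rw [← sum_norm_expSum_sq]
  refine sum_congr rfl fun ψ _ => ?_
  rw [expSum_tupleSum, norm_pow, ← pow_mul, mul_comm s]

/-- Hölder's inequality over the fibres of a map with at most `p` values. -/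
theorem mixedCount_le_sum_fiber [DecidableEq G] {β γ : Type*} {k : ℕ} (Z : Finset (Fin k → β))
    (v : β → G) (s : ℕ) (hs : 1 ≤ s) (Y : Finset γ) (u : γ → G) (p : ℕ) (f : γ → ℕ)
    (hf : ∀ y ∈ Y, f y < p) :
    (mixedCount Z v s Y u : ℝ)
      ≤ (p : ℝ) ^ (2 * s - 1) * ∑ η ∈ range p, (mixedCount Z v s {y ∈ Y | f y = η} u : ℝ) := by
  have := Fintype.ofFinite G
  have hG : (0 : ℝ) < Nat.card G := by exact_mod_cast Nat.card_pos
  refine le_of_mul_le_mul_left ?_ hG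
  rw [← sum_norm_mul_pow, mul_left_comm, mul_sum]
  simp_rw [← sum_norm_mul_pow]
  rw [sum_comm, mul_sum]
  refine sum_le_sum fun ψ _ => ?_
  rw [← mul_sum, mul_left_comm]
  refine mul_le_mul_of_nonneg_left ?_ (by positivity)
  have h1 : expSum ψ Y u = ∑ η ∈ range p, expSum ψ {y ∈ Y | f y = η} u := by
    unfold expSum
    rw [sum_fiberwise_of_maps_to]
    intro y hy
    exact mem_range.2 (hf y hy)
  have h2 : ‖expSum ψ Y u‖ ≤ ∑ η ∈ range p, ‖expSum ψ {y ∈ Y | f y = η} u‖ := by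
    rw [h1]; exact norm_sum_le _ _
  obtain ⟨m, hm⟩ : ∃ m, 2 * s = m + 1 := ⟨2 * s - 1, by omega⟩
  rw [hm, Nat.add_sub_cancel]
  rcases Nat.eq_zero_or_pos p with rfl | hp
  · simp at h2
    simp [h2]
  · have h3 := pow_sum_div_card_le_sum_pow (s := range p)
      (f := fun η => ‖expSum ψ {y ∈ Y | f y = η} u‖) (fun _ _ => norm_nonneg _) m
    rw [card_range, div_le_iff₀' (by positivity)] at h3
    exact (pow_le_pow_left₀ (norm_nonneg _) h2 _).trans h3

theorem card_cross_le [DecidableEq G] {τ : Type*} (S T : Finset τ) (V : τ → G) :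
    Nat.card G * (#{t ∈ S ×ˢ T | V t.1 = V t.2} : ℝ)
      ≤ ∑ ψ : AddChar G ℂ, ‖expSum ψ S V‖ * ‖expSum ψ T V‖ := by
  classical
  have := Fintype.ofFinite G
  have h2 : ∑ ψ : AddChar G ℂ, expSum ψ S V * (starRingEnd ℂ) (expSum ψ T V)
      = ((Nat.card G * (#{t ∈ S ×ˢ T | V t.1 = V t.2} : ℝ) : ℝ) : ℂ) := by
    have h : ∀ ψ : AddChar G ℂ, expSum ψ S V * (starRingEnd ℂ) (expSum ψ T V)
        = ∑ t ∈ S ×ˢ T, ψ (V t.1 - V t.2) := by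
      intro ψ
      rw [expSum, expSum, map_sum, sum_mul_sum, sum_product]
      refine sum_congr rfl fun x _ => sum_congr rfl fun y _ => ?_
      rw [AddChar.map_sub_eq_div, div_eq_mul_inv, ← AddChar.map_neg_eq_inv,
        AddChar.map_neg_eq_conj]
    simp_rw [h]
    rw [sum_comm]
    simp_rw [AddChar.sum_apply_eq_ite, sub_eq_zero]
    rw [← sum_filter, sum_const]
    simp [mul_comm]
  have h3 := norm_sum_le univ
    fun ψ : AddChar G ℂ => expSum ψ S V * (starRingEnd ℂ) (expSum ψ T V)
  rw [h2, Complex.norm_real, Real.norm_of_nonneg (by positivity)] at h3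
  refine h3.trans (le_of_eq (sum_congr rfl fun ψ _ => ?_))
  rw [norm_mul, RCLike.norm_conj]

omit [Finite G] in
theorem expSum_piFinset {β : Type*} {k : ℕ} (ψ : AddChar G ℂ) (I : Fin k → Finset β)
    (v : β → G) :
    expSum ψ (Fintype.piFinset I) (tupleSum v) = ∏ i, expSum ψ (I i) v := by
  simp only [expSum, tupleSum, apply_sum]
  rw [prod_univ_sum]

theorem norm_expSum_coincide_le {β : Type*} [DecidableEq β] {k : ℕ} (ψ : AddChar G ℂ)
    (I : Finset β) (v : β → G) {a b : Fin k} (hab : a ≠ b) :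
    ‖expSum ψ {z ∈ tuples k I | z a = z b} (tupleSum v)‖ ≤ #I * ‖expSum ψ I v‖ ^ (k - 2) := by
  have h1 : expSum ψ {z ∈ tuples k I | z a = z b} (tupleSum v)
      = ∑ c ∈ I, expSum ψ (Fintype.piFinset fun i => if i = a ∨ i = b then {c} else I)
          (tupleSum v) := by
    unfold expSum
    rw [← sum_fiberwise_of_maps_to (s := {z ∈ tuples k I | z a = z b}) (t := I)
      (g := fun z => z a)]
    · refine sum_congr rfl fun c hc => sum_congr ?_ fun _ _ => rfl
      ext z
      simp only [mem_filter, Fintype.mem_piFinset]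
      constructor
      · rintro ⟨⟨h1, h2⟩, h3⟩ i
        split_ifs with h
        · rcases h with rfl | rfl
          · simp [h3]
          · simp [← h2, h3]
        · exact h1 i
      · intro h
        have ha := h a
        have hb := h b
        simp only [true_or, or_true, if_true, mem_singleton] at ha hb
        refine ⟨⟨fun i => ?_, ha.trans hb.symm⟩, ha⟩
        have hi := h i
        split_ifs at hi with h'
        · rw [mem_singleton] at hi
          rwa [hi]
        · exact hi
    · intro z hz
      simp only [mem_filter, Fintype.mem_piFinset] at hz
      exact hz.1 a
  rw [h1]
  refine (norm_sum_le _ _).trans ?_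
  rw [← nsmul_eq_mul]
  refine sum_le_card_nsmul _ _ _ fun c _ => le_of_eq ?_
  rw [expSum_piFinset, norm_prod]
  have h2 : ∀ i, ‖expSum ψ (if i = a ∨ i = b then {c} else I) v‖
      = if i ∈ ({a, b} : Finset (Fin k)) then 1 else ‖expSum ψ I v‖ := by
    intro i
    simp only [mem_insert, mem_singleton]
    split_ifs
    · simp [expSum, AddChar.norm_apply]
    · rfl
  rw [prod_congr rfl fun i _ => h2 i, prod_ite, prod_const_one, one_mul, prod_const]
  congr 1
  rw [filter_not, card_sdiff_of_subset (filter_subset _ _)]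
  simp [filter_or, Finset.filter_eq', card_pair hab]
  
/-- Solutions with a coincidence among the first `k` variables contribute little. -/
theorem mixedCount_le_injective [DecidableEq G] {β γ : Type*} [DecidableEq β] {k : ℕ}
    (hk : 2 ≤ k) (I : Finset β) (v : β → G) (s : ℕ) (Y : Finset γ) (u : γ → G) :
    (mixedCount (tuples k I) v s Y u : ℝ)
      ≤ 2 * mixedCount {z ∈ tuples k I | Function.Injective z} v s Y u
        + (4 * k ^ 2 * #I) ^ k * pairCount (tuples s Y) (tupleSum u) := by
  classical
  rcases I.eq_empty_or_nonempty with rfl | hI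
  · have : tuples k (∅ : Finset β) = ∅ := by
      refine eq_empty_of_forall_notMem fun z hz => ?_
      simpa using Fintype.mem_piFinset.1 hz ⟨0, by omega⟩
    rw [this]
    simp [mixedCount, pairCount]
    positivity
  have := Fintype.ofFinite G
  have hG : (0 : ℝ) < Nat.card G := by exact_mod_cast Nat.card_pos
  set B : ℝ := 4 * k ^ 2 * #I with hB
  have hIc : (0 : ℝ) < #I := by exact_mod_cast hI.card_pos
  have hBpos : 0 < B := by positivity
  set Z := tuples k I
  set X := tuples s Y
  set V : (Fin k → β) × (Fin s → γ) → G := fun t => tupleSum v t.1 + tupleSum u t.2 with hV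
  set K : ℝ := (mixedCount Z v s Y u : ℝ) with hK
  set J : ℝ := (pairCount X (tupleSum u) : ℝ) with hJ
  have hcross : ∀ a b : Fin k, a ≠ b →
      (#{t ∈ ({z ∈ Z | z a = z b} ×ˢ X) ×ˢ (Z ×ˢ X) | V t.1 = V t.2} : ℝ)
        ≤ #I * (B ^ (k - 1) * J + K / B) := by
    intro a b hab
    refine le_of_mul_le_mul_left ?_ hG
    refine (card_cross_le _ _ V).trans ?_
    have hpt : ∀ ψ : AddChar G ℂ,
        ‖expSum ψ ({z ∈ Z | z a = z b} ×ˢ X) V‖ * ‖expSum ψ (Z ×ˢ X) V‖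
          ≤ #I * (B ^ (k - 1) * ‖expSum ψ Y u‖ ^ (2 * s)
            + (‖expSum ψ I v‖ ^ (2 * k) * ‖expSum ψ Y u‖ ^ (2 * s)) / B) := by
      intro ψ
      rw [hV, expSum_prod, expSum_prod, expSum_tupleSum, expSum_tupleSum, norm_mul, norm_mul,
        norm_pow, norm_pow]
      have h1 := norm_expSum_coincide_le ψ I v hab
      set F := ‖expSum ψ I v‖ with hF
      have hF0 : 0 ≤ F := norm_nonneg _
      set f := ‖expSum ψ Y u‖
      have hf0 : 0 ≤ f := norm_nonneg _
      have h2 : F ^ (2 * (k - 1)) ≤ B ^ (k - 1) + F ^ (2 * k) / B := by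
        rcases le_total (F ^ 2) B with h | h
        · have := pow_le_pow_left₀ (by positivity) h (k - 1)
          rw [pow_mul]
          have : 0 ≤ F ^ (2 * k) / B := by positivity
          linarith
        · have h3 : F ^ (2 * (k - 1)) ≤ F ^ (2 * k) / B := by
            rw [le_div_iff₀ hBpos]
            have : F ^ (2 * k) = F ^ (2 * (k - 1)) * F ^ 2 := by
              rw [← pow_add]; congr 1; omega
            rw [this]
            exact mul_le_mul_of_nonneg_left h (by positivity)
          have : 0 ≤ B ^ (k - 1) := by positivity
          linarith
      calc ‖expSum ψ {z ∈ Z | z a = z b} (tupleSum v)‖ * f ^ s * (F ^ k * f ^ s)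
          ≤ (#I * F ^ (k - 2)) * f ^ s * (F ^ k * f ^ s) := by gcongr
        _ = #I * F ^ (2 * (k - 1)) * f ^ (2 * s) := by
            have : F ^ (2 * (k - 1)) = F ^ (k - 2) * F ^ k := by
              rw [← pow_add]; congr 1; omega
            rw [this]; ring
        _ ≤ #I * (B ^ (k - 1) + F ^ (2 * k) / B) * f ^ (2 * s) := by gcongr
        _ = _ := by ring
    refine (sum_le_sum fun ψ _ => hpt ψ).trans (le_of_eq ?_)
    rw [← mul_sum, sum_add_distrib, ← mul_sum, ← sum_div, sum_norm_pow, sum_norm_pow_mul_pow]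
    ring
  have hcount : (mixedCount Z v s Y u)
      ≤ mixedCount {z ∈ Z | Function.Injective z} v s Y u
        + ∑ ab ∈ (univ : Finset (Fin k)).offDiag,
            #{t ∈ ({z ∈ Z | z ab.1 = z ab.2} ×ˢ X) ×ˢ (Z ×ˢ X) | V t.1 = V t.2}
        + ∑ ab ∈ (univ : Finset (Fin k)).offDiag,
            #{t ∈ ({z ∈ Z | z ab.1 = z ab.2} ×ˢ X) ×ˢ (Z ×ˢ X) | V t.1 = V t.2} := by
    have hsub : {t ∈ (Z ×ˢ X) ×ˢ (Z ×ˢ X) | V t.1 = V t.2} ⊆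
        ({t ∈ ({z ∈ Z | Function.Injective z} ×ˢ X) ×ˢ ({z ∈ Z | Function.Injective z} ×ˢ X) |
          V t.1 = V t.2} ∪
        (univ : Finset (Fin k)).offDiag.biUnion fun ab =>
          {t ∈ ({z ∈ Z | z ab.1 = z ab.2} ×ˢ X) ×ˢ (Z ×ˢ X) | V t.1 = V t.2}) ∪
        (univ : Finset (Fin k)).offDiag.biUnion fun ab =>
          ({t ∈ ({z ∈ Z | z ab.1 = z ab.2} ×ˢ X) ×ˢ (Z ×ˢ X) | V t.1 = V t.2}).map
            (Equiv.prodComm _ _).toEmbedding := by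
      rintro ⟨t, t'⟩ ht
      simp only [mem_filter, mem_product] at ht
      obtain ⟨⟨⟨h1, h2⟩, h3, h4⟩, h5⟩ := ht
      by_cases hi : Function.Injective t.1
      · by_cases hi' : Function.Injective t'.1
        · refine mem_union_left _ (mem_union_left _ ?_)
          exact mem_filter.2 ⟨mem_product.2 ⟨mem_product.2 ⟨mem_filter.2 ⟨h1, hi⟩, h2⟩,
            mem_product.2 ⟨mem_filter.2 ⟨h3, hi'⟩, h4⟩⟩, h5⟩
        · refine mem_union_right _ ?_
          rw [Function.not_injective_iff] at hi'
          obtain ⟨a, b, hab, hne⟩ := hi'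
          refine mem_biUnion.2 ⟨(a, b), by simp [hne], ?_⟩
          refine mem_map.2 ⟨(t', t), ?_, rfl⟩
          exact mem_filter.2 ⟨mem_product.2 ⟨mem_product.2 ⟨mem_filter.2 ⟨h3, hab⟩, h4⟩,
            mem_product.2 ⟨h1, h2⟩⟩, h5.symm⟩
      · refine mem_union_left _ (mem_union_right _ ?_)
        rw [Function.not_injective_iff] at hi
        obtain ⟨a, b, hab, hne⟩ := hi
        refine mem_biUnion.2 ⟨(a, b), by simp [hne], ?_⟩
        exact mem_filter.2 ⟨mem_product.2 ⟨mem_product.2 ⟨mem_filter.2 ⟨h1, hab⟩, h2⟩,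
          mem_product.2 ⟨h3, h4⟩⟩, h5⟩
    have := card_le_card hsub
    refine this.trans ((card_union_le _ _).trans (add_le_add ((card_union_le _ _).trans
      (add_le_add le_rfl card_biUnion_le)) (card_biUnion_le.trans ?_)))
    simp only [card_map]
    exact le_rfl
  have hsum : (∑ ab ∈ (univ : Finset (Fin k)).offDiag,
      #{t ∈ ({z ∈ Z | z ab.1 = z ab.2} ×ˢ X) ×ˢ (Z ×ˢ X) | V t.1 = V t.2} : ℝ)
        ≤ k ^ 2 * (#I * (B ^ (k - 1) * J + K / B)) := by
    refine (sum_le_card_nsmul _ _ _ fun ab hab => hcross ab.1 ab.2 (by simpa using hab)).trans ?_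
    rw [nsmul_eq_mul]
    refine mul_le_mul_of_nonneg_right ?_ (by positivity)
    rw [offDiag_card, card_univ, Fintype.card_fin]
    have : k * k - k ≤ k ^ 2 := by rw [pow_two]; omega
    exact_mod_cast this
  have hcount' : K ≤ mixedCount {z ∈ Z | Function.Injective z} v s Y u
      + k ^ 2 * (#I * (B ^ (k - 1) * J + K / B)) + k ^ 2 * (#I * (B ^ (k - 1) * J + K / B)) := by
    have h : K ≤ ((mixedCount {z ∈ Z | Function.Injective z} v s Y u
        + ∑ ab ∈ (univ : Finset (Fin k)).offDiag,
            #{t ∈ ({z ∈ Z | z ab.1 = z ab.2} ×ˢ X) ×ˢ (Z ×ˢ X) | V t.1 = V t.2}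
        + ∑ ab ∈ (univ : Finset (Fin k)).offDiag,
            #{t ∈ ({z ∈ Z | z ab.1 = z ab.2} ×ˢ X) ×ˢ (Z ×ˢ X) | V t.1 = V t.2} : ℕ) : ℝ) := by
      rw [hK]; exact_mod_cast hcount
    push_cast at h
    linarith
  have hsimp : (k : ℝ) ^ 2 * (#I * (B ^ (k - 1) * J + K / B)) = B ^ k * J / 4 + K / 4 := by
    have h1 : (k : ℝ) ^ 2 * #I = B / 4 := by rw [hB]; ring
    have h2 : B ^ k = B ^ (k - 1) * B := by rw [← pow_succ]; congr 1; omega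
    rw [← mul_assoc, h1, h2]
    field_simp
  rw [hsimp] at hcount'
  linarith

omit [AddCommGroup G] [Finite G] in
theorem sum_trichotomy {R : Type*} [AddCommMonoid R] (S : Finset (ℤ × ℤ)) (f : ℤ × ℤ → R) :
    ∑ t ∈ S, f t = ∑ t ∈ S with t.1 = t.2, f t
      + (∑ t ∈ S with t.2 < t.1, f t + ∑ t ∈ S with t.1 < t.2, f t) := by
  rw [sum_filter, sum_filter, sum_filter, ← sum_add_distrib, ← sum_add_distrib]
  refine sum_congr rfl fun t _ => ?_
  rcases lt_trichotomy t.1 t.2 with h | h | h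
  · simp [h, h.ne, h.not_gt]
  · simp [h]
  · simp [h, h.ne', h.not_gt]

theorem sum_norm_expSum_residue (ψ : AddChar G ℂ) (q : ℕ) [NeZero q] (I : Finset ℤ) (v : ℤ → G)
    (H : ℕ) (hH : ∀ z ∈ I, ∀ w ∈ I, z - w < (H + 1) * q) :
    ∑ ρ : ZMod q, ‖expSum ψ {z ∈ I | ((z : ℤ) : ZMod q) = ρ} v‖ ^ 2
      ≤ #I + 2 * ∑ h ∈ Icc 1 H, ‖expSum ψ {z ∈ I | z + (h : ℤ) * q ∈ I}
          (fun z => v (z + (h : ℤ) * q) - v z)‖ := by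
  classical
  have hq : (0 : ℤ) < q := by exact_mod_cast Nat.pos_of_ne_zero (NeZero.ne q)
  have hsq : ∀ ρ : ZMod q, ((‖expSum ψ {z ∈ I | ((z : ℤ) : ZMod q) = ρ} v‖ ^ 2 : ℝ) : ℂ)
      = ∑ t ∈ I ×ˢ I, if ((t.1 : ZMod q) = ρ ∧ (t.2 : ZMod q) = ρ) then ψ (v t.1 - v t.2)
        else 0 := by
    intro ρ
    rw [← sum_filter,
      filter_product (fun a : ℤ => (a : ZMod q) = ρ) (fun a : ℤ => (a : ZMod q) = ρ),
      ← Complex.normSq_eq_norm_sq, ← Complex.mul_conj, expSum,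
      map_sum, sum_mul_sum, sum_product]
    refine sum_congr rfl fun x _ => sum_congr rfl fun y _ => ?_
    rw [AddChar.map_sub_eq_div, div_eq_mul_inv, ← AddChar.map_neg_eq_inv, AddChar.map_neg_eq_conj]
  set S1 : Finset (ℤ × ℤ) := {t ∈ I ×ˢ I | (t.1 : ZMod q) = t.2} with hS1
  have hD : ((∑ ρ : ZMod q, ‖expSum ψ {z ∈ I | ((z : ℤ) : ZMod q) = ρ} v‖ ^ 2 : ℝ) : ℂ)
      = ∑ t ∈ S1, ψ (v t.1 - v t.2) := by
    rw [Complex.ofReal_sum, sum_congr rfl fun ρ _ => hsq ρ, sum_comm, hS1, sum_filter]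
    refine sum_congr rfl fun t _ => ?_
    by_cases h : (t.1 : ZMod q) = t.2
    · rw [if_pos h]
      simp only [h, and_self]
      simp
    · rw [if_neg h]
      refine sum_eq_zero fun ρ _ => ?_
      rw [if_neg]
      rintro ⟨h1, h2⟩
      exact h (h1.trans h2.symm)
  set Sg : ℂ := ∑ t ∈ S1 with t.2 < t.1, ψ (v t.1 - v t.2) with hSg
  have hSl : ∑ t ∈ S1 with t.1 < t.2, ψ (v t.1 - v t.2) = (starRingEnd ℂ) Sg := by
    rw [hSg, map_sum]
    refine sum_nbij' (fun t => (t.2, t.1)) (fun t => (t.2, t.1)) ?_ ?_ ?_ ?_ ?_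
    · intro t ht
      simp only [hS1, mem_filter, mem_product] at ht ⊢
      exact ⟨⟨⟨ht.1.1.2, ht.1.1.1⟩, ht.1.2.symm⟩, ht.2⟩
    · intro t ht
      simp only [hS1, mem_filter, mem_product] at ht ⊢
      exact ⟨⟨⟨ht.1.1.2, ht.1.1.1⟩, ht.1.2.symm⟩, ht.2⟩
    · intro t _; rfl
    · intro t _; rfl
    · intro t _
      rw [← AddChar.map_neg_eq_conj, neg_sub]
  have hS0 : ∑ t ∈ S1 with t.1 = t.2, ψ (v t.1 - v t.2) = #I := by
    have h1 : ∑ t ∈ S1 with t.1 = t.2, ψ (v t.1 - v t.2) = ∑ t ∈ S1 with t.1 = t.2, (1 : ℂ) := by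
      refine sum_congr rfl fun t ht => ?_
      rw [(mem_filter.1 ht).2, sub_self, AddChar.map_zero_eq_one]
    rw [h1, sum_const, nsmul_one]
    congr 1
    refine card_nbij' (fun t => t.1) (fun z => (z, z)) ?_ ?_ ?_ ?_
    · intro t ht
      simp only [hS1, coe_filter, mem_filter, mem_product, Set.mem_ofPred_eq] at ht
      exact ht.1.1.1
    · intro z hz
      simpa [hS1] using hz
    · intro t ht
      simp only [coe_filter, Set.mem_ofPred_eq] at ht
      exact Prod.ext rfl ht.2
    · intro z _; rfl
  have hsplit : ∑ t ∈ S1, ψ (v t.1 - v t.2) = #I + (Sg + (starRingEnd ℂ) Sg) := by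
    rw [← hS0, ← hSl, hSg]
    exact sum_trichotomy S1 _
  have hSgG : Sg = ∑ h ∈ Icc 1 H, expSum ψ {z ∈ I | z + (h : ℤ) * q ∈ I}
      (fun z => v (z + (h : ℤ) * q) - v z) := by
    rw [hSg]
    simp only [expSum]
    rw [sum_sigma']
    symm
    refine sum_bij' (fun x _ => ((x.2 + (x.1 : ℤ) * q, x.2) : ℤ × ℤ))
      (fun t _ => ⟨((t.1 - t.2) / q).toNat, t.2⟩) ?_ ?_ ?_ ?_ ?_
    · rintro ⟨h, z⟩ hx
      simp only [mem_sigma, mem_Icc, mem_filter] at hx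
      simp only [hS1, mem_filter, mem_product]
      refine ⟨⟨⟨hx.2.2, hx.2.1⟩, by simp⟩, ?_⟩
      have : (0 : ℤ) < h * q := mul_pos (by exact_mod_cast hx.1.1) hq
      linarith
    · rintro ⟨a, b⟩ ht
      simp only [hS1, mem_filter, mem_product] at ht
      obtain ⟨⟨⟨ha, hb⟩, hc⟩, hlt⟩ := ht
      rw [ZMod.intCast_eq_intCast_iff_dvd_sub] at hc
      obtain ⟨c, hc⟩ := (dvd_sub_comm.1 hc)
      have hc0 : 0 < c := by
        by_contra! hneg
        have := mul_nonpos_of_nonneg_of_nonpos hq.le hneg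
        linarith
      have hdiv : (a - b) / (q : ℤ) = c := by rw [hc]; exact Int.mul_ediv_cancel_left _ hq.ne'
      have hcH : c < H + 1 := by
        have := hH a ha b hb
        rw [hc, mul_comm] at this
        exact lt_of_mul_lt_mul_right this hq.le
      simp only [mem_sigma, mem_Icc, mem_filter, hdiv]
      have hcn : ((c.toNat : ℕ) : ℤ) = c := Int.toNat_of_nonneg hc0.le
      refine ⟨⟨by omega, by omega⟩, hb, ?_⟩
      rw [hcn, mul_comm c, ← hc]
      simpa using ha
    · rintro ⟨h, z⟩ hx
      simp [Int.mul_ediv_cancel _ hq.ne']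
    · rintro ⟨a, b⟩ ht
      simp only [hS1, mem_filter, mem_product] at ht
      obtain ⟨⟨⟨ha, hb⟩, hc⟩, hlt⟩ := ht
      rw [ZMod.intCast_eq_intCast_iff_dvd_sub] at hc
      obtain ⟨c, hc⟩ := (dvd_sub_comm.1 hc)
      have hc0 : 0 < c := by
        by_contra! hneg
        have := mul_nonpos_of_nonneg_of_nonpos hq.le hneg
        linarith
      have hdiv : (a - b) / (q : ℤ) = c := by rw [hc]; exact Int.mul_ediv_cancel_left _ hq.ne'
      have hcn : ((c.toNat : ℕ) : ℤ) = c := Int.toNat_of_nonneg hc0.le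
      simp only [hdiv, hcn, Prod.mk.injEq, and_true]
      linarith
    · rintro ⟨h, z⟩ hx
      rfl
  have hre_le : ‖((∑ ρ : ZMod q, ‖expSum ψ {z ∈ I | ((z : ℤ) : ZMod q) = ρ} v‖ ^ 2 : ℝ) : ℂ)‖
      ≤ #I + 2 * ‖Sg‖ := by
    rw [hD, hsplit]
    refine (norm_add_le _ _).trans ?_
    have h1 : ‖(#I : ℂ)‖ = #I := by simp
    have h2 := norm_add_le Sg ((starRingEnd ℂ) Sg)
    rw [RCLike.norm_conj] at h2
    rw [h1]
    linarith
  rw [Complex.norm_real, Real.norm_of_nonneg (sum_nonneg fun _ _ => by positivity)] at hre_le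
  refine hre_le.trans ?_
  rw [hSgG]
  gcongr
  exact norm_sum_le _ _

/-- Differencing: congruent pairs of variables are replaced by differences with step a multiple
of `q`. -/
theorem sum_mixedCount_residue_le [DecidableEq G] {γ : Type*} {k : ℕ} (hk : 1 ≤ k)
    (q : ℕ) [NeZero q] (I : Finset ℤ) (v : ℤ → G) (s : ℕ) (Y : Finset γ) (u : γ → G)
    (H : ℕ) (hH : ∀ z ∈ I, ∀ w ∈ I, z - w < (H + 1) * q) :
    ∑ ρ : Fin k → ZMod q,
        (mixedCount {z ∈ tuples k I | ∀ i, ((z i : ℤ) : ZMod q) = ρ i} v s Y u : ℝ)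
      ≤ 2 ^ (k - 1) * ((#I : ℝ) ^ k * pairCount (tuples s Y) (tupleSum u)
        + 2 ^ k * (H : ℝ) ^ (k - 1) * ∑ h ∈ Icc 1 H,
          √((mixedCount (tuples k {z ∈ I | z + (h : ℤ) * q ∈ I})
            (fun z => v (z + (h : ℤ) * q) - v z) s Y u : ℝ)
              * pairCount (tuples s Y) (tupleSum u))) := by
  classical
  have := Fintype.ofFinite G
  have hG : (0 : ℝ) < Nat.card G := by exact_mod_cast Nat.card_pos
  refine le_of_mul_le_mul_left ?_ hG
  rw [mul_sum]
  simp_rw [← sum_norm_mul_pow]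
  rw [sum_comm]
  set f : AddChar G ℂ → ℝ := fun ψ => ‖expSum ψ Y u‖ with hf
  set g : ℕ → AddChar G ℂ → ℝ := fun h ψ => ‖expSum ψ {z ∈ I | z + (h : ℤ) * q ∈ I}
          (fun z => v (z + (h : ℤ) * q) - v z)‖ with hg
  set M : ℕ → ℝ := fun h => (mixedCount (tuples k {z ∈ I | z + (h : ℤ) * q ∈ I})
            (fun z => v (z + (h : ℤ) * q) - v z) s Y u : ℝ) with hM
  set J : ℝ := (pairCount (tuples s Y) (tupleSum u) : ℝ) with hJ
  have hJsum : ∑ ψ, f ψ ^ (2 * s) = Nat.card G * J := sum_norm_pow s Y u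
  have hMsum : ∀ h, ∑ ψ, g h ψ ^ (2 * k) * f ψ ^ (2 * s) = Nat.card G * M h := fun h =>
    sum_norm_pow_mul_pow k _ _ s Y u
  have hpt : ∀ ψ : AddChar G ℂ,
      ∑ ρ : Fin k → ZMod q, ‖expSum ψ {z ∈ tuples k I | ∀ i, ((z i : ℤ) : ZMod q) = ρ i}
        (tupleSum v)‖ ^ 2 * ‖expSum ψ Y u‖ ^ (2 * s)
      ≤ 2 ^ (k - 1) * ((#I : ℝ) ^ k * f ψ ^ (2 * s)
        + 2 ^ k * (H : ℝ) ^ (k - 1) * ∑ h ∈ Icc 1 H, g h ψ ^ k * f ψ ^ (2 * s)) := by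
    intro ψ
    rw [← sum_mul]
    have h1 : ∀ ρ : Fin k → ZMod q, ({z ∈ tuples k I | ∀ i, ((z i : ℤ) : ZMod q) = ρ i})
        = Fintype.piFinset fun i => {z ∈ I | ((z : ℤ) : ZMod q) = ρ i} := by
      intro ρ
      ext z
      simp only [mem_filter, Fintype.mem_piFinset]
      exact forall_and.symm
    have h2 : ∑ ρ : Fin k → ZMod q, ‖expSum ψ {z ∈ tuples k I | ∀ i, ((z i : ℤ) : ZMod q) = ρ i}
        (tupleSum v)‖ ^ 2
          = (∑ ρ : ZMod q, ‖expSum ψ {z ∈ I | ((z : ℤ) : ZMod q) = ρ} v‖ ^ 2) ^ k := by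
      rw [sum_pow', Fintype.piFinset_univ]
      refine sum_congr rfl fun ρ _ => ?_
      rw [h1, expSum_piFinset, norm_prod, prod_pow]
    rw [h2]
    have h3 := sum_norm_expSum_residue ψ q I v H hH
    have hg0 : ∀ h, 0 ≤ g h ψ := fun h => norm_nonneg _
    have hf0 : 0 ≤ f ψ := norm_nonneg _
    have h4 : (∑ h ∈ Icc 1 H, g h ψ) ^ k ≤ (H : ℝ) ^ (k - 1) * ∑ h ∈ Icc 1 H, g h ψ ^ k := by
      obtain ⟨m, rfl⟩ : ∃ m, k = m + 1 := ⟨k - 1, by omega⟩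
      rcases Nat.eq_zero_or_pos H with rfl | hH0
      · simp
      have := pow_sum_div_card_le_sum_pow (s := Icc 1 H) (f := fun h => g h ψ)
        (fun h _ => hg0 h) m
      rwa [Nat.card_Icc, Nat.add_sub_cancel, div_le_iff₀' (by positivity)] at this
    have h5 : (∑ ρ : ZMod q, ‖expSum ψ {z ∈ I | ((z : ℤ) : ZMod q) = ρ} v‖ ^ 2) ^ k
        ≤ 2 ^ (k - 1) * ((#I : ℝ) ^ k + 2 ^ k * ((H : ℝ) ^ (k - 1) * ∑ h ∈ Icc 1 H, g h ψ ^ k)) :=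
      calc _ ≤ ((#I : ℝ) + 2 * ∑ h ∈ Icc 1 H, g h ψ) ^ k :=
            pow_le_pow_left₀ (sum_nonneg fun _ _ => by positivity) h3 _
        _ ≤ 2 ^ (k - 1) * ((#I : ℝ) ^ k + (2 * ∑ h ∈ Icc 1 H, g h ψ) ^ k) :=
            add_pow_le (Nat.cast_nonneg _) (mul_nonneg zero_le_two (sum_nonneg fun h _ => hg0 h)) _
        _ ≤ _ := by rw [mul_pow]; gcongr
    refine (mul_le_mul_of_nonneg_right h5 (by positivity)).trans (le_of_eq ?_)
    rw [← sum_mul]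
    ring
  refine (sum_le_sum fun ψ _ => hpt ψ).trans ?_
  rw [← mul_sum, mul_left_comm]
  refine mul_le_mul_of_nonneg_left ?_ (by positivity : (0 : ℝ) ≤ 2 ^ (k - 1))
  rw [sum_add_distrib, ← mul_sum, ← mul_sum, hJsum, sum_comm]
  have hcs : ∀ h, ∑ ψ, g h ψ ^ k * f ψ ^ (2 * s) ≤ Nat.card G * √(M h * J) := by
    intro h
    have h1 := Real.sum_mul_le_sqrt_mul_sqrt univ (fun ψ => g h ψ ^ k * f ψ ^ s)
      (fun ψ => f ψ ^ s)
    have h2 : ∀ ψ, g h ψ ^ k * f ψ ^ s * f ψ ^ s = g h ψ ^ k * f ψ ^ (2 * s) := fun ψ => by ring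
    have h3 : ∀ ψ, (g h ψ ^ k * f ψ ^ s) ^ 2 = g h ψ ^ (2 * k) * f ψ ^ (2 * s) := fun ψ => by ring
    have h4 : ∀ ψ, (f ψ ^ s) ^ 2 = f ψ ^ (2 * s) := fun ψ => by ring
    simp only [h2, h3, h4, hMsum, hJsum] at h1
    refine h1.trans (le_of_eq ?_)
    rw [Real.sqrt_mul hG.le, Real.sqrt_mul hG.le, Real.sqrt_mul (by positivity : 0 ≤ M h)]
    have := Real.mul_self_sqrt hG.le
    linear_combination (√(M h) * √J) * this
  calc _ ≤ (#I : ℝ) ^ k * (Nat.card G * J)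
        + 2 ^ k * (H : ℝ) ^ (k - 1) * ∑ h ∈ Icc 1 H, Nat.card G * √(M h * J) := by
        gcongr with h _
        exact hcs h
    _ = _ := by rw [← mul_sum]; ring

end FiniteFourier

namespace FiniteFourier

open Finset Filter

/-- Coordinatewise reduction modulo `N`. -/
def reduction (n N : ℕ) : (Fin n → ℤ) →+ (Fin n → ZMod N) where
  toFun a j := (a j : ZMod N)
  map_zero' := by ext; simp
  map_add' a b := by ext; simp

theorem tupleSum_reduction {β : Type*} {n m N : ℕ} (v : β → Fin n → ℤ) (z : Fin m → β) :
    tupleSum (fun b => reduction n N (v b)) z = reduction n N (tupleSum v z) := by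
  simp [tupleSum, map_sum]

theorem eventually_reduction_eq_iff {n : ℕ} (a b : Fin n → ℤ) :
    ∀ᶠ N in atTop, (reduction n N a = reduction n N b ↔ a = b) := by
  by_cases h : a = b
  · simp [h]
  · obtain ⟨j, hj⟩ := Function.ne_iff.1 h
    filter_upwards [eventually_gt_atTop (b j - a j).natAbs] with N hN
    refine ⟨fun h1 => ?_, fun h1 => by rw [h1]⟩
    have h2 : (a j : ZMod N) = b j := congrFun h1 j
    rw [ZMod.intCast_eq_intCast_iff_dvd_sub] at h2
    have h3 := Int.natAbs_dvd_natAbs.2 h2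
    rw [Int.natAbs_natCast] at h3
    have h4 := Nat.eq_zero_of_dvd_of_lt h3 hN
    rw [Int.natAbs_eq_zero, sub_eq_zero] at h4
    exact absurd h4.symm hj

theorem eventually_pairCount_reduction {τ : Type*} {n : ℕ} (T : Finset τ) (V : τ → Fin n → ℤ) :
    ∀ᶠ N in atTop, pairCount T (fun t => reduction n N (V t)) = pairCount T V := by
  have h : ∀ᶠ N in atTop, ∀ t ∈ T ×ˢ T,
      (reduction n N (V t.1) = reduction n N (V t.2) ↔ V t.1 = V t.2) :=
    (eventually_all_finset _).2 fun t _ => eventually_reduction_eq_iff _ _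
  filter_upwards [h] with N hN
  unfold pairCount
  rw [filter_congr hN]

theorem mixedCount_reduction_eq {β γ : Type*} {n k N : ℕ} (Z : Finset (Fin k → β))
    (v : β → Fin n → ℤ) (s : ℕ) (Y : Finset γ) (u : γ → Fin n → ℤ) :
    mixedCount Z (fun b => reduction n N (v b)) s Y (fun c => reduction n N (u c))
      = pairCount (Z ×ˢ tuples s Y)
          (fun t => reduction n N (tupleSum v t.1 + tupleSum u t.2)) := by
  unfold mixedCount
  simp only [tupleSum_reduction, map_add]

theorem eventually_mixedCount_reduction {β γ : Type*} {n k : ℕ} (Z : Finset (Fin k → β))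
    (v : β → Fin n → ℤ) (s : ℕ) (Y : Finset γ) (u : γ → Fin n → ℤ) :
    ∀ᶠ N in atTop,
      mixedCount Z (fun b => reduction n N (v b)) s Y (fun c => reduction n N (u c))
        = mixedCount Z v s Y u := by
  simp only [mixedCount_reduction_eq]
  exact eventually_pairCount_reduction _ _

theorem eventually_tuples_reduction {γ : Type*} {n : ℕ} (s : ℕ) (Y : Finset γ)
    (u : γ → Fin n → ℤ) :
    ∀ᶠ N in atTop, pairCount (tuples s Y) (tupleSum fun c => reduction n N (u c))
        = pairCount (tuples s Y) (tupleSum u) := by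
  have h : ∀ N, (tupleSum fun c => reduction n N (u c) : (Fin s → γ) → _)
      = fun t => reduction n N (tupleSum u t) := fun N => funext fun t => tupleSum_reduction _ _
  simp only [h]
  exact eventually_pairCount_reduction _ _

end FiniteFourier

section IntegerSystems

open Finset Filter FiniteFourier

theorem mixedCount_le_sum_fiber {β γ : Type*} {n k : ℕ} (Z : Finset (Fin k → β))
    (v : β → Fin n → ℤ) (s : ℕ) (hs : 1 ≤ s) (Y : Finset γ) (u : γ → Fin n → ℤ) (p : ℕ)
    (f : γ → ℕ) (hf : ∀ y ∈ Y, f y < p) :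
    (mixedCount Z v s Y u : ℝ)
      ≤ (p : ℝ) ^ (2 * s - 1) * ∑ η ∈ range p, (mixedCount Z v s {y ∈ Y | f y = η} u : ℝ) := by
  have h : ∀ᶠ N in atTop, ∀ η ∈ range p,
      mixedCount Z (fun b => reduction n N (v b)) s {y ∈ Y | f y = η} (fun c => reduction n N (u c))
        = mixedCount Z v s {y ∈ Y | f y = η} u :=
    (eventually_all_finset _).2 fun η _ => eventually_mixedCount_reduction _ _ _ _ _
  obtain ⟨N, hN1, hN2, hN3⟩ :=
    (h.and ((eventually_mixedCount_reduction Z v s Y u).and (eventually_gt_atTop 0))).exists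
  have : NeZero N := ⟨hN3.ne'⟩
  have h1 := FiniteFourier.mixedCount_le_sum_fiber Z (fun b => reduction n N (v b)) s hs Y
    (fun c => reduction n N (u c)) p f hf
  rw [hN2] at h1
  refine h1.trans (le_of_eq ?_)
  congr 1
  exact sum_congr rfl fun η hη => by rw [hN1 η hη]

/-- Solutions with a coincidence among the first `k` variables contribute little. -/
theorem mixedCount_le_injective {β γ : Type*} [DecidableEq β] {n k : ℕ}
    (hk : 2 ≤ k) (I : Finset β) (v : β → Fin n → ℤ) (s : ℕ) (Y : Finset γ)
    (u : γ → Fin n → ℤ) :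
    (mixedCount (tuples k I) v s Y u : ℝ)
      ≤ 2 * mixedCount {z ∈ tuples k I | Function.Injective z} v s Y u
        + (4 * k ^ 2 * #I) ^ k * pairCount (tuples s Y) (tupleSum u) := by
  obtain ⟨N, hN1, hN2, hN3, hN4⟩ :=
    ((eventually_mixedCount_reduction (tuples k I) v s Y u).and
      ((eventually_mixedCount_reduction {z ∈ tuples k I | Function.Injective z} v s Y u).and
        ((eventually_tuples_reduction s Y u).and (eventually_gt_atTop 0)))).exists
  have : NeZero N := ⟨hN4.ne'⟩
  have h1 := FiniteFourier.mixedCount_le_injective hk I (fun b => reduction n N (v b)) s Y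
    (fun c => reduction n N (u c))
  rwa [hN1, hN2, hN3] at h1

/-- Differencing: congruent pairs of variables are replaced by differences with step a multiple
of `q`. -/
theorem sum_mixedCount_residue_le {γ : Type*} {n k : ℕ} (hk : 1 ≤ k)
    (q : ℕ) [NeZero q] (I : Finset ℤ) (v : ℤ → Fin n → ℤ) (s : ℕ) (Y : Finset γ)
    (u : γ → Fin n → ℤ) (H : ℕ) (hH : ∀ z ∈ I, ∀ w ∈ I, z - w < (H + 1) * q) :
    ∑ ρ : Fin k → ZMod q,
        (mixedCount {z ∈ tuples k I | ∀ i, ((z i : ℤ) : ZMod q) = ρ i} v s Y u : ℝ)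
      ≤ 2 ^ (k - 1) * ((#I : ℝ) ^ k * pairCount (tuples s Y) (tupleSum u)
        + 2 ^ k * (H : ℝ) ^ (k - 1) * ∑ h ∈ Icc 1 H,
          √((mixedCount (tuples k {z ∈ I | z + (h : ℤ) * q ∈ I})
            (fun z => v (z + (h : ℤ) * q) - v z) s Y u : ℝ)
              * pairCount (tuples s Y) (tupleSum u))) := by
  have hρ : ∀ᶠ N in atTop, ∀ ρ ∈ (univ : Finset (Fin k → ZMod q)),
      mixedCount {z ∈ tuples k I | ∀ i, ((z i : ℤ) : ZMod q) = ρ i}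
        (fun b => reduction n N (v b)) s Y (fun c => reduction n N (u c))
        = mixedCount {z ∈ tuples k I | ∀ i, ((z i : ℤ) : ZMod q) = ρ i} v s Y u :=
    (eventually_all_finset _).2 fun ρ _ => eventually_mixedCount_reduction _ _ _ _ _
  have hh : ∀ᶠ N in atTop, ∀ h ∈ Icc 1 H,
      mixedCount (tuples k {z ∈ I | z + (h : ℤ) * q ∈ I})
        (fun b => reduction n N (v (b + (h : ℤ) * q) - v b)) s Y (fun c => reduction n N (u c))
        = mixedCount (tuples k {z ∈ I | z + (h : ℤ) * q ∈ I})
            (fun z => v (z + (h : ℤ) * q) - v z) s Y u :=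
    (eventually_all_finset _).2 fun h _ =>
      eventually_mixedCount_reduction (tuples k {z ∈ I | z + (h : ℤ) * q ∈ I})
        (fun z => v (z + (h : ℤ) * q) - v z) s Y u
  obtain ⟨N, hN1, hN2, hN3, hN4⟩ :=
    (hρ.and (hh.and ((eventually_tuples_reduction s Y u).and (eventually_gt_atTop 0)))).exists
  have : NeZero N := ⟨hN4.ne'⟩
  have h1 := FiniteFourier.sum_mixedCount_residue_le hk q I (fun b => reduction n N (v b)) s Y
    (fun c => reduction n N (u c)) H hH
  rw [hN3] at h1
  have e1 : ∑ h ∈ Icc 1 H, √((mixedCount (tuples k {z ∈ I | z + (h : ℤ) * q ∈ I})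
            (fun z => v (z + (h : ℤ) * q) - v z) s Y u : ℝ)
              * pairCount (tuples s Y) (tupleSum u))
      = ∑ h ∈ Icc 1 H, √((mixedCount (tuples k {z ∈ I | z + (h : ℤ) * q ∈ I})
        (fun b => reduction n N (v (b + (h : ℤ) * q)) - reduction n N (v b)) s Y
          (fun c => reduction n N (u c)) : ℝ) * pairCount (tuples s Y) (tupleSum u)) :=
    sum_congr rfl fun h hh => by rw [← hN2 h hh]; simp only [map_sub]
  rw [e1]
  refine le_trans (le_of_eq ?_) h1
  exact sum_congr rfl fun ρ hρ' => by rw [hN1 ρ hρ']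

/-- Cauchy's inequality for solutions whose classes take few values. -/
theorem pairCount_le_mul_sum {τ A κ : Type*} [DecidableEq A] [DecidableEq κ] [Fintype κ]
    (T : Finset τ) (V : τ → A) (c : τ → κ) (B : ℕ)
    (hB : ∀ t₀ ∈ T, #(({t ∈ T | V t = V t₀}).image c) ≤ B) :
    pairCount T V ≤ B * ∑ ρ, pairCount {t ∈ T | c t = ρ} V := by
  have hpc : ∀ S ⊆ T, pairCount S V = ∑ a ∈ T.image V, #{t ∈ S | V t = a} ^ 2 := by
    intro S hS
    unfold pairCount
    rw [card_eq_sum_card_fiberwise (f := fun t => V t.1) (t := T.image V)]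
    · refine sum_congr rfl fun a _ => ?_
      rw [pow_two, ← card_product]
      congr 1
      ext t
      simp only [mem_filter, mem_product]
      constructor
      · rintro ⟨⟨⟨h1, h2⟩, h3⟩, h4⟩
        exact ⟨⟨h1, h4⟩, h2, h3 ▸ h4⟩
      · rintro ⟨⟨h1, h2⟩, h3, h4⟩
        exact ⟨⟨⟨h1, h3⟩, h2.trans h4.symm⟩, h2⟩
    · intro t ht
      have := (mem_product.1 (mem_filter.1 ht).1).1
      exact mem_image_of_mem _ (hS this)
  rw [hpc T Subset.rfl]
  simp_rw [fun ρ => hpc {t ∈ T | c t = ρ} (filter_subset _ _)]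
  rw [sum_comm, mul_sum]
  refine sum_le_sum fun a ha => ?_
  obtain ⟨t₀, ht₀, rfl⟩ := mem_image.1 ha
  set S : Finset τ := {t ∈ T | V t = V t₀} with hS
  have h1 : #S = ∑ ρ ∈ S.image c, #{t ∈ {t ∈ T | c t = ρ} | V t = V t₀} := by
    rw [card_eq_sum_card_image c S]
    refine sum_congr rfl fun ρ _ => ?_
    rw [hS, filter_filter, filter_filter]
    simp only [and_comm]
  have h2 : (∑ ρ ∈ S.image c, #{t ∈ {t ∈ T | c t = ρ} | V t = V t₀}) ^ 2
      ≤ #(S.image c) * ∑ ρ ∈ S.image c, #{t ∈ {t ∈ T | c t = ρ} | V t = V t₀} ^ 2 :=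
    sq_sum_le_card_mul_sum_sq
  rw [h1]
  refine h2.trans (Nat.mul_le_mul (hB t₀ ht₀) ?_)
  exact sum_le_sum_of_subset (subset_univ _)

/-- If every pair of solutions is captured by some member of a family of subsets, then one member
captures a proportion of the solutions. -/
theorem pairCount_le_sum_of_cover {τ A ι : Type*} [DecidableEq A] (T : Finset τ) (V : τ → A)
    (P : Finset ι) (S : ι → Finset τ)
    (h : ∀ t ∈ T, ∀ t' ∈ T, V t = V t' → ∃ p ∈ P, t ∈ S p ∧ t' ∈ S p) :
    pairCount T V ≤ ∑ p ∈ P, pairCount (S p) V := by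
  classical
  unfold pairCount
  refine le_trans (card_le_card ?_) card_biUnion_le
  intro t ht
  simp only [mem_filter, mem_product] at ht
  obtain ⟨p, hp, h1, h2⟩ := h t.1 ht.1.1 t.2 ht.1.2 ht.2
  exact mem_biUnion.2 ⟨p, hp, mem_filter.2 ⟨mem_product.2 ⟨h1, h2⟩, ht.2⟩⟩

theorem pairCount_mono {τ A : Type*} [DecidableEq A] {S T : Finset τ} (h : S ⊆ T) (V : τ → A) :
    pairCount S V ≤ pairCount T V :=
  card_le_card (filter_subset_filter _ (product_subset_product h h))

end IntegerSystems

namespace PowerSums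

open Finset Polynomial

theorem prod_X_sub_C_eq_of_powerSum_eq {R : Type*} [CommRing R] {n : ℕ}
    (hunit : ∀ e, 1 ≤ e → e ≤ n → IsUnit (e : R)) (x y : Fin n → R)
    (h : ∀ e, 1 ≤ e → e ≤ n → ∑ i, x i ^ e = ∑ i, y i ^ e) :
    ∏ i, (X - C (x i)) = ∏ i, (X - C (y i)) := by
  classical
  have hesymm : ∀ e ≤ n, MvPolynomial.aeval x (MvPolynomial.esymm (Fin n) R e)
      = MvPolynomial.aeval y (MvPolynomial.esymm (Fin n) R e) := by
    intro e
    induction e using Nat.strong_induction_on with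
    | _ e ih =>
      intro he
      rcases Nat.eq_zero_or_pos e with rfl | hpos
      · simp
      refine (hunit e hpos he).mul_left_cancel ?_
      have key : ∀ z : Fin n → R, (e : R) * MvPolynomial.aeval z (MvPolynomial.esymm (Fin n) R e)
          = (-1) ^ (e + 1) * ∑ a ∈ antidiagonal e with a.1 < e, (-1) ^ a.1
            * MvPolynomial.aeval z (MvPolynomial.esymm (Fin n) R a.1) * ∑ i, z i ^ a.2 := by
        intro z
        have := congrArg (MvPolynomial.aeval z) (MvPolynomial.mul_esymm_eq_sum (Fin n) R e)
        simpa [MvPolynomial.psum] using this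
      rw [key, key]
      congr 1
      refine sum_congr rfl fun a ha => ?_
      rw [mem_filter, HasAntidiagonal.mem_antidiagonal] at ha
      rw [ih a.1 ha.2 (by omega), h a.2 (by omega) (by omega)]
  have hprod : ∀ z : Fin n → R, ∏ i, (X - C (z i)) = ∑ j ∈ range (n + 1),
      (-1) ^ j * (C (MvPolynomial.aeval z (MvPolynomial.esymm (Fin n) R j)) * X ^ (n - j)) := by
    intro z
    have := Multiset.prod_X_sub_X_eq_sum_esymm (univ.val.map z)
    simp only [Multiset.map_map, Multiset.card_map, card_val, card_univ, Fintype.card_fin] at this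
    simp only [MvPolynomial.aeval_esymm_eq_multiset_esymm]
    exact this
  rw [hprod, hprod]
  refine sum_congr rfl fun j hj => ?_
  rw [hesymm j (by rw [mem_range] at hj; omega)]

theorem mem_range_of_prod_eq {R : Type*} [CommRing R] [IsLocalRing R] {n : ℕ} (x y : Fin n → R)
    (hy : ∀ i j, i ≠ j → IsUnit (y i - y j))
    (h : ∏ i, (X - C (x i)) = ∏ i, (X - C (y i))) (i : Fin n) : ∃ l, x i = y l := by
  have h0 : ∏ l, (x i - y l) = 0 := by
    have := congrArg (eval (x i)) h
    rw [eval_prod, eval_prod, prod_eq_zero (mem_univ i) (by simp)] at this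
    simpa using this.symm
  by_cases hall : ∀ l, IsUnit (x i - y l)
  · have : IsUnit (∏ l, (x i - y l)) :=
      IsUnit.prod_univ_iff.2 hall
    rw [h0] at this
    exact absurd this not_isUnit_zero
  · push Not at hall
    obtain ⟨l, hl⟩ := hall
    have hother : ∀ m ∈ univ.erase l, IsUnit (x i - y m) := by
      intro m hm
      by_contra hm'
      have := IsLocalRing.nonunits_add (a := x i - y m) (b := -(x i - y l)) hm'
        (by rw [mem_nonunits_iff, IsUnit.neg_iff]; exact hl)
      refine this ?_
      have h2 := hy l m (ne_of_mem_erase hm).symm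
      convert h2 using 1
      ring
    rw [← mul_prod_erase _ _ (mem_univ l)] at h0
    have hu : IsUnit (∏ m ∈ univ.erase l, (x i - y m)) := by
      rw [IsUnit.prod_iff]; exact hother
    refine ⟨l, ?_⟩
    have := hu.mul_left_eq_zero.1 h0
    exact sub_eq_zero.1 this

theorem powerSum_eq_of_triangular {R : Type*} [CommRing R] {n : ℕ} (P : ℕ → R[X])
    (hdeg : ∀ e, 1 ≤ e → e ≤ n → (P e).natDegree ≤ e)
    (hlead : ∀ e, 1 ≤ e → e ≤ n → IsUnit ((P e).coeff e)) (x y : Fin n → R)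
    (h : ∀ e, 1 ≤ e → e ≤ n → ∑ i, (P e).eval (x i) = ∑ i, (P e).eval (y i)) :
    ∀ e ≤ n, ∑ i, x i ^ e = ∑ i, y i ^ e := by
  intro e
  induction e using Nat.strong_induction_on with
  | _ e ih =>
    intro he
    rcases Nat.eq_zero_or_pos e with rfl | hpos
    · simp
    have key : ∀ z : Fin n → R, ∑ i, (P e).eval (z i)
        = ∑ m ∈ range e, (P e).coeff m * ∑ i, z i ^ m + (P e).coeff e * ∑ i, z i ^ e := by
      intro z
      rw [← sum_range_succ (fun m => (P e).coeff m * ∑ i, z i ^ m)]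
      simp_rw [mul_sum]
      rw [sum_comm]
      refine sum_congr rfl fun i _ => ?_
      exact eval_eq_sum_range' (Nat.lt_succ_of_le (hdeg e hpos he)) _
    have h1 := h e hpos he
    rw [key, key] at h1
    have h2 : ∑ m ∈ range e, (P e).coeff m * ∑ i, x i ^ m
        = ∑ m ∈ range e, (P e).coeff m * ∑ i, y i ^ m :=
      sum_congr rfl fun m hm => by
        rw [mem_range] at hm
        rw [ih m hm (by omega)]
    rw [h2] at h1
    exact (hlead e hpos he).mul_left_cancel (add_left_cancel h1)

/-- Tuples with prescribed values of a triangular system of power sums, when `d` of the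
coordinates are free. -/
theorem card_le_of_triangular {R : Type*} [CommRing R] [IsLocalRing R] [Fintype R] [DecidableEq R]
    {n d : ℕ} (hunit : ∀ e, 1 ≤ e → e ≤ n → IsUnit (e : R)) (P : ℕ → R[X])
    (hdeg : ∀ e, 1 ≤ e → e ≤ n → (P e).natDegree ≤ e)
    (hlead : ∀ e, 1 ≤ e → e ≤ n → IsUnit ((P e).coeff e)) (T : ℕ → Finset R)
    (S : Finset (Fin (n + d) → R)) (hinj : ∀ z ∈ S, ∀ i j, i ≠ j → IsUnit (z i - z j))
    (hS : ∀ z ∈ S, ∀ e, 1 ≤ e → e ≤ n → ∑ i, (P e).eval (z i) ∈ T e) :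
    #S ≤ n ^ n * (Fintype.card R ^ d * ∏ e ∈ range n, #(T (e + 1))) := by
  classical
  set f : (Fin (n + d) → R) → (Fin d → R) × (Fin n → R) := fun z =>
    (fun i => z (Fin.natAdd n i), fun e => ∑ i, (P (e + 1)).eval (z i)) with hf
  set target : Finset ((Fin d → R) × (Fin n → R)) :=
    univ ×ˢ Fintype.piFinset fun e : Fin n => T (e + 1) with htarget
  have hmaps : ∀ z ∈ S, f z ∈ target := by
    intro z hz
    rw [htarget, mem_product, Fintype.mem_piFinset]
    exact ⟨mem_univ _, fun e => hS z hz _ (by omega) (by omega)⟩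
  have hcard : #target = Fintype.card R ^ d * ∏ e ∈ range n, #(T (e + 1)) := by
    rw [htarget, card_product, Fintype.card_piFinset, card_univ, Fintype.card_fun,
      Fintype.card_fin, ← Fin.prod_univ_eq_prod_range (fun e => #(T (e + 1)))]
  rw [← hcard]
  refine card_le_mul_card_image_of_maps_to hmaps _ fun b _ => ?_
  rcases ({z ∈ S | f z = b}).eq_empty_or_nonempty with hE | ⟨w, hw⟩
  · rw [hE]; simp
  rw [mem_filter] at hw
  have hsub : {z ∈ S | f z = b} ⊆ (univ : Finset (Fin n → Fin n)).image
      fun σ => Fin.append (fun i => w (Fin.castAdd d (σ i))) (fun i => w (Fin.natAdd n i)) := by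
    intro z hz
    rw [mem_filter] at hz
    have hfe : f z = f w := hz.2.trans hw.2.symm
    have h1 : ∀ i, z (Fin.natAdd n i) = w (Fin.natAdd n i) := fun i =>
      congrFun (congrArg Prod.fst hfe) i
    have h2 : ∀ e, 1 ≤ e → e ≤ n → ∑ i, (P e).eval (z (Fin.castAdd d i))
        = ∑ i, (P e).eval (w (Fin.castAdd d i)) := by
      intro e he1 he2
      obtain ⟨e, rfl⟩ : ∃ e', e = e' + 1 := ⟨e - 1, by omega⟩
      have := congrFun (congrArg Prod.snd hfe) ⟨e, by omega⟩
      simp only [hf, Fin.sum_univ_add, h1] at this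
      exact add_right_cancel this
    have h3 := powerSum_eq_of_triangular P hdeg hlead _ _ h2
    have h4 := prod_X_sub_C_eq_of_powerSum_eq hunit _ _ fun e _ he => h3 e he
    have h5 := mem_range_of_prod_eq _ (fun i => w (Fin.castAdd d i))
      (fun i j hij => hinj w hw.1 _ _ (by simpa using hij)) h4
    choose σ hσ using h5
    refine mem_image.2 ⟨σ, mem_univ _, ?_⟩
    funext i
    refine Fin.addCases (fun i => ?_) (fun i => ?_) i
    · rw [Fin.append_left, hσ]
    · rw [Fin.append_right, h1]
  refine (card_le_card hsub).trans (card_image_le.trans ?_)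
  rw [card_univ, Fintype.card_fun, Fintype.card_fin]

theorem isUnit_intCast_zmod_prime_pow {p r : ℕ} (hp : p.Prime) (hr : 1 ≤ r) (z : ℤ) :
    IsUnit (z : ZMod (p ^ r)) ↔ ¬ (p : ℤ) ∣ z := by
  rw [ZMod.coe_int_isUnit_iff_isCoprime, Nat.cast_pow, IsCoprime.pow_left_iff (by omega),
    (Nat.prime_iff_prime_int.1 hp).coprime_iff_not_dvd]

theorem isLocalRing_zmod_prime_pow {p r : ℕ} (hp : p.Prime) (hr : 1 ≤ r) :
    IsLocalRing (ZMod (p ^ r)) := by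
  have : Fact (1 < p ^ r) := ⟨Nat.one_lt_pow (by omega) hp.one_lt⟩
  refine IsLocalRing.of_nonunits_add fun a b ha hb => ?_
  obtain ⟨a, rfl⟩ := ZMod.intCast_surjective a
  obtain ⟨b, rfl⟩ := ZMod.intCast_surjective b
  rw [mem_nonunits_iff, isUnit_intCast_zmod_prime_pow hp hr, not_not] at ha hb
  rw [mem_nonunits_iff, ← Int.cast_add, isUnit_intCast_zmod_prime_pow hp hr, not_not]
  exact dvd_add ha hb

theorem two_mul_sum_sub_le (n c : ℕ) : 2 * ∑ e ∈ range n, (c - (e + 1)) ≤ c * (c - 1) := by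
  induction n generalizing c with
  | zero => simp
  | succ n ih =>
    rcases c with _ | c
    · simp
    rw [sum_range_succ']
    have h1 : ∑ e ∈ range n, (c + 1 - (e + 1 + 1)) = ∑ e ∈ range n, (c - (e + 1)) :=
      sum_congr rfl fun e _ => by omega
    rw [h1]
    have h2 := ih c
    have h3 : c * (c - 1) + 2 * c = (c + 1) * c := by
      rcases c with _ | c
      · simp
      · simp only [Nat.add_sub_cancel]; ring
    simp only [Nat.add_sub_cancel]
    omega

theorem free_add_constrained_exponent_le {n d r : ℕ} (hdr : d ≤ r) :
    r * d + ∑ e ∈ range n, (r - min (d + (e + 1)) r) ≤ r * (r - 1) / 2 + d * (d + 1) / 2 := by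
  have h1 := two_mul_sum_sub_le n (r - d)
  have h2 : ∑ e ∈ range n, (r - min (d + (e + 1)) r) = ∑ e ∈ range n, (r - d - (e + 1)) :=
    sum_congr rfl fun e _ => by omega
  rw [h2]
  have h3 : 2 ∣ r * (r - 1) := (Nat.even_mul_pred_self r).two_dvd
  have h4 : 2 ∣ d * (d + 1) := (Nat.even_mul_succ_self d).two_dvd
  obtain ⟨c, rfl⟩ := Nat.exists_eq_add_of_le hdr
  have h5 : 2 * ((d + c) * d) + c * (c - 1) = (d + c) * (d + c - 1) + d * (d + 1) := by
    rcases c with _ | c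
    · rcases d with _ | d
      · simp
      · simp only [Nat.add_zero, Nat.add_sub_cancel]; ring_nf
    · simp only [← add_assoc, Nat.add_sub_cancel]; ring
  rw [Nat.add_sub_cancel_left] at *
  omega

/-- The iterated forward difference operator with the given list of steps. -/
noncomputable def diff : List ℤ → ℤ[X] →ₗ[ℤ] ℤ[X]
  | [] => LinearMap.id
  | h :: g => (taylor h - LinearMap.id).comp (diff g)

@[simp] theorem diff_nil (f : ℤ[X]) : diff [] f = f := rfl

theorem eval_diff_cons (h : ℤ) (g : List ℤ) (f : ℤ[X]) (z : ℤ) :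
    (diff (h :: g) f).eval z = (diff g f).eval (z + h) - (diff g f).eval z := by
  simp [diff, taylor_eval]

theorem coeff_taylor_sub_self {f : ℤ[X]} {m : ℕ} (hf : f.natDegree ≤ m + 1) (h : ℤ) :
    (taylor h f - f).natDegree ≤ m ∧
      (taylor h f - f).coeff m = (m + 1) * h * f.coeff (m + 1) := by
  have key : ∀ i, m ≤ i → (taylor h f).coeff i = f.coeff i + (i + 1) * f.coeff (i + 1) * h := by
    intro i hi
    rw [taylor_coeff, eval_eq_sum_range' (n := 2)
      (lt_of_le_of_lt (natDegree_hasseDeriv_le f i) (by omega))]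
    simp [sum_range_succ, hasseDeriv_coeff, add_comm 1 i, Nat.choose_succ_self_right, mul_comm]
  constructor
  · rw [natDegree_le_iff_coeff_eq_zero]
    intro i hi
    rw [coeff_sub, key i hi.le, coeff_eq_zero_of_natDegree_lt (n := i + 1) (by omega)]
    ring
  · rw [coeff_sub, key m le_rfl]; ring

theorem coeff_diff {g : List ℤ} {f : ℤ[X]} {m : ℕ} (hf : f.natDegree ≤ m + g.length) :
    (diff g f).natDegree ≤ m ∧
      (diff g f).coeff m = (m + 1).ascFactorial g.length * g.prod * f.coeff (m + g.length) := by
  induction g generalizing m with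
  | nil => simpa using hf
  | cons h g ih =>
    rw [List.length_cons] at hf
    obtain ⟨h1, h2⟩ := ih (m := m + 1) (by omega)
    obtain ⟨h3, h4⟩ := coeff_taylor_sub_self h1 h
    refine ⟨h3, ?_⟩
    have h5 : (diff (h :: g) f).coeff m = (taylor h (diff g f) - diff g f).coeff m := rfl
    rw [h5, h4, h2, List.prod_cons, List.length_cons, Nat.ascFactorial_succ,
      show m + 1 + g.length = m + (g.length + 1) by ring]
    have h7 : (m + 1) * (m + 1 + 1).ascFactorial g.length
        = (m + 1 + g.length) * (m + 1).ascFactorial g.length := Nat.succ_ascFactorial _ _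
    have h8 : ((m : ℤ) + 1) * ((m + 1 + 1).ascFactorial g.length : ℤ)
        = (m + 1 + g.length) * ((m + 1).ascFactorial g.length : ℤ) := by exact_mod_cast h7
    push_cast
    linear_combination (h * g.prod * f.coeff (m + (g.length + 1))) * h8

theorem not_dvd_ascFactorial {p n d : ℕ} (hp : p.Prime) (h : n + d < p) :
    ¬ p ∣ (n + 1).ascFactorial d := by
  intro hd
  have h1 := Nat.factorial_mul_ascFactorial n d
  have h2 : p ∣ (n + d).factorial := by rw [← h1]; exact dvd_mul_of_dvd_right hd _
  rw [hp.dvd_factorial] at h2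
  omega

/-- The residues modulo `p ^ r` of the tuples, with entries distinct modulo `p`, whose values in
the differenced system of powers are prescribed modulo powers of `p`. -/
theorem card_image_residue_le {n d p r : ℕ} (hp : p.Prime) (hr : 1 ≤ r) (g : List ℤ)
    (hd : g.length = d) (hnp : n + d < p) (hdr : d ≤ r)
    (hg : ∀ h ∈ g, ¬ (p : ℤ) ∣ h) (a : ℤ) (β : ℕ → ℤ) (S : Finset (Fin (n + d) → ℤ))
    (hinj : ∀ z ∈ S, ∀ i j, i ≠ j → ¬ (p : ℤ) ∣ z i - z j)
    (hS : ∀ z ∈ S, ∀ j, 1 ≤ j → j ≤ n + d →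
      (p : ℤ) ^ min j r ∣ ∑ i, (diff g ((X - C a) ^ j)).eval (z i) - β j) :
    #(S.image fun z i => ((z i : ℤ) : ZMod (p ^ r)))
      ≤ n ^ n * p ^ (r * (r - 1) / 2 + d * (d + 1) / 2) := by
  have hloc := isLocalRing_zmod_prime_pow hp hr
  have : NeZero (p ^ r) := ⟨(pow_pos hp.pos r).ne'⟩
  set φ := Int.castRingHom (ZMod (p ^ r)) with hφ
  set T : ℕ → Finset (ZMod (p ^ r)) := fun e => (range (p ^ (r - min (d + e) r))).image
    fun t : ℕ => (β (d + e) : ZMod (p ^ r)) + (p : ZMod (p ^ r)) ^ min (d + e) r * t with hT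
  have hcoeff := fun e : ℕ => coeff_diff (g := g) (f := (X - C a) ^ (d + e)) (m := e)
    (by rw [natDegree_pow, natDegree_X_sub_C, hd]; omega)
  have hmain := card_le_of_triangular (R := ZMod (p ^ r)) (n := n) (d := d)
    (fun e he1 he2 => by
      have := (isUnit_intCast_zmod_prime_pow hp hr e).2 (fun h => by
        have := Nat.le_of_dvd (by omega) (Int.natCast_dvd_natCast.1 h)
        omega)
      simpa using this)
    (fun e => (diff g ((X - C a) ^ (d + e))).map φ)
    (fun e _ _ => natDegree_map_le.trans (hcoeff e).1)
    (fun e he1 he2 => by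
      rw [coeff_map, (hcoeff e).2, hd, hφ, eq_intCast, isUnit_intCast_zmod_prime_pow hp hr]
      have hpp := Nat.prime_iff_prime_int.1 hp
      have hmonic : ((X - C a) ^ (d + e) : ℤ[X]).coeff (e + d) = 1 := by
        have := (monic_X_sub_C a).pow (d + e)
        rw [Monic, leadingCoeff, natDegree_pow, natDegree_X_sub_C, mul_one] at this
        rw [add_comm e d, this]
      rw [hmonic, mul_one]
      intro hdvd
      rcases hpp.dvd_or_dvd hdvd with h1 | h1
      · rw [Int.natCast_dvd_natCast] at h1
        exact not_dvd_ascFactorial hp (by omega) h1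
      · rw [hpp.dvd_prod_iff] at h1
        obtain ⟨h, hh, h2⟩ := h1
        exact hg h hh h2)
    T (S.image fun z i => ((z i : ℤ) : ZMod (p ^ r)))
    (by
      intro z hz i j hij
      obtain ⟨z, hzS, rfl⟩ := mem_image.1 hz
      rw [← Int.cast_sub, isUnit_intCast_zmod_prime_pow hp hr]
      exact hinj z hzS i j hij)
    (by
      intro z hz e he1 he2
      obtain ⟨z, hzS, rfl⟩ := mem_image.1 hz
      obtain ⟨y, hy⟩ := hS z hzS (d + e) (by omega) (by omega)
      set N := p ^ (r - min (d + e) r) with hN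
      have hNpos : 0 < N := pow_pos hp.pos _
      have hzero : (p : ZMod (p ^ r)) ^ min (d + e) r * (N : ZMod (p ^ r)) = 0 := by
        rw [hN, ← Nat.cast_pow, ← Nat.cast_mul, ← pow_add, Nat.add_sub_cancel' (min_le_right _ _),
          ZMod.natCast_self]
      have hval : ∑ i, ((diff g ((X - C a) ^ (d + e))).map φ).eval ((z i : ℤ) : ZMod (p ^ r))
          = ((∑ i, (diff g ((X - C a) ^ (d + e))).eval (z i) : ℤ) : ZMod (p ^ r)) := by
        rw [Int.cast_sum]
        refine sum_congr rfl fun i _ => ?_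
        rw [eval_map, ← eq_intCast φ (z i), eval₂_at_apply, eq_intCast φ]
      refine mem_image.2 ⟨(y % N).toNat, ?_, ?_⟩
      · rw [mem_range]
        have := Int.emod_lt_of_pos y (Int.natCast_pos.2 hNpos)
        have := Int.emod_nonneg y (Int.natCast_pos.2 hNpos).ne'
        omega
      · rw [hval, sub_eq_iff_eq_add.1 hy]
        have h1 : (((y % N).toNat : ℕ) : ZMod (p ^ r)) = ((y % N : ℤ) : ZMod (p ^ r)) := by
          rw [← Int.cast_natCast, Int.toNat_of_nonneg
            (Int.emod_nonneg y (Int.natCast_pos.2 hNpos).ne')]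
        rw [h1]
        have h2 : (y : ZMod (p ^ r)) = (N : ZMod (p ^ r)) * ((y / N : ℤ) : ZMod (p ^ r))
            + ((y % N : ℤ) : ZMod (p ^ r)) := by
          rw [← Int.cast_natCast, ← Int.cast_mul, ← Int.cast_add, Int.mul_ediv_add_emod]
        rw [Int.cast_add, Int.cast_mul, h2, mul_add, ← mul_assoc]
        push_cast
        rw [hzero]
        ring)
  refine hmain.trans (Nat.mul_le_mul_left _ ?_)
  have hTcard : ∏ e ∈ range n, #(T (e + 1)) ≤ ∏ e ∈ range n, p ^ (r - min (d + (e + 1)) r) :=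
    prod_le_prod' fun e _ => card_image_le.trans (by rw [card_range])
  rw [prod_pow_eq_pow_sum] at hTcard
  rw [ZMod.card, ← pow_mul]
  calc p ^ (r * d) * ∏ e ∈ range n, #(T (e + 1))
      ≤ p ^ (r * d) * p ^ ∑ e ∈ range n, (r - min (d + (e + 1)) r) :=
        Nat.mul_le_mul_left _ hTcard
    _ = p ^ (r * d + ∑ e ∈ range n, (r - min (d + (e + 1)) r)) := by rw [pow_add]
    _ ≤ _ := Nat.pow_le_pow_right hp.pos (free_add_constrained_exponent_le hdr)

/-- The vector of the differenced powers `x, x ^ 2, …, x ^ k`. -/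
noncomputable def powVec (k : ℕ) (g : List ℤ) (z : ℤ) : Fin k → ℤ :=
  fun j => (diff g (X ^ ((j : ℕ) + 1))).eval z

theorem powVec_cons (k : ℕ) (h : ℤ) (g : List ℤ) (z : ℤ) :
    powVec k (h :: g) z = powVec k g (z + h) - powVec k g z := by
  funext j
  exact eval_diff_cons h g _ z

theorem exists_diff_one_eq_C (g : List ℤ) : ∃ c : ℤ, diff g 1 = C c := by
  induction g with
  | nil => exact ⟨1, by simp⟩
  | cons h g ih =>
    obtain ⟨c, hc⟩ := ih
    refine ⟨0, ?_⟩
    have : diff (h :: g) 1 = taylor h (diff g 1) - diff g 1 := rfl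
    rw [this, hc, taylor_C, sub_self, C_0]

theorem sum_eval_eq_of_tupleSum_eq {m s k : ℕ} {g : List ℤ} {z z' : Fin m → ℤ} {y y' : Fin s → ℤ}
    (h : tupleSum (powVec k g) z + tupleSum (powVec k []) y
      = tupleSum (powVec k g) z' + tupleSum (powVec k []) y')
    {f : ℤ[X]} (hf : f.natDegree ≤ k) :
    ∑ i, (diff g f).eval (z i) + ∑ i, f.eval (y i)
      = ∑ i, (diff g f).eval (z' i) + ∑ i, f.eval (y' i) := by
  have hpow : ∀ j ≤ k, ∑ i, (diff g (X ^ j)).eval (z i) + ∑ i, (X ^ j : ℤ[X]).eval (y i)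
      = ∑ i, (diff g (X ^ j)).eval (z' i) + ∑ i, (X ^ j : ℤ[X]).eval (y' i) := by
    intro j hj
    rcases j with _ | j
    · obtain ⟨c, hc⟩ := exists_diff_one_eq_C g
      simp [hc]
    · have := congrFun h ⟨j, hj⟩
      simpa [tupleSum, powVec] using this
  have hlin : ∀ (a : Fin m → ℤ) (b : Fin s → ℤ),
      ∑ i, (diff g f).eval (a i) + ∑ i, f.eval (b i) = ∑ j ∈ range (k + 1), f.coeff j *
        (∑ i, (diff g (X ^ j)).eval (a i) + ∑ i, (X ^ j : ℤ[X]).eval (b i)) := by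
    intro a b
    have h1 : diff g f = ∑ j ∈ range (k + 1), f.coeff j • diff g (X ^ j) := by
      conv_lhs => rw [f.as_sum_range' (k + 1) (by omega)]
      rw [map_sum]
      refine sum_congr rfl fun j _ => ?_
      rw [← smul_X_eq_monomial, map_smul]
    have h2 : ∀ x, (diff g f).eval x
        = ∑ j ∈ range (k + 1), f.coeff j * (diff g (X ^ j)).eval x := by
      intro x
      rw [h1, eval_finsetSum]
      simp
    have h3 : ∀ x, f.eval x = ∑ j ∈ range (k + 1), f.coeff j * (X ^ j : ℤ[X]).eval x := by
      intro x
      rw [eval_eq_sum_range' (n := k + 1) (by omega)]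
      simp
    simp_rw [h2, h3, mul_add, sum_add_distrib, mul_sum]
    rw [sum_comm, sum_comm (s := (univ : Finset (Fin s)))]
  rw [hlin, hlin]
  exact sum_congr rfl fun j hj => by rw [hpow j (by rw [mem_range] at hj; omega)]

theorem sum_eval_eq_of_tupleSum_nil_eq {s k : ℕ} {y y' : Fin s → ℤ}
    (h : tupleSum (powVec k []) y = tupleSum (powVec k []) y') {f : ℤ[X]} (hf : f.natDegree ≤ k) :
    ∑ i, f.eval (y i) = ∑ i, f.eval (y' i) := by
  have := sum_eval_eq_of_tupleSum_eq (m := 0) (g := []) (z := Fin.elim0) (z' := Fin.elim0)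
    (y := y) (y' := y') (k := k) (by rw [h]) hf
  simpa using this

/-- The arithmetic progression `a, a + q, …, a + (n - 1) q`. -/
def progression (a q : ℤ) (n : ℕ) : Finset ℤ := (range n).image fun i : ℕ => a + q * i

/-- The number of solutions of Vinogradov's system of degree `k` with `s` variables on each side
taken from `Y`. -/
noncomputable def vinogradov (k s : ℕ) (Y : Finset ℤ) : ℕ :=
  pairCount (tuples s Y) (tupleSum (powVec k []))

/-- The number of solutions of the mixed system in which `k` variables on each side run over `I`
and enter through the differences of the powers with steps `g`, and `s` variables on each side
run over `Y`. -/
noncomputable def mixed (k : ℕ) (g : List ℤ) (I : Finset ℤ) (s : ℕ) (Y : Finset ℤ) : ℕ :=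
  mixedCount (tuples k I) (powVec k g) s Y (powVec k [])

theorem pairCount_le_of_map {τ τ' A A' : Type*} [DecidableEq A] [DecidableEq A'] {T : Finset τ}
    {T' : Finset τ'} {V : τ → A} {V' : τ' → A'} (φ : τ → τ') (hmaps : ∀ t ∈ T, φ t ∈ T')
    (hinj : Set.InjOn φ T) (h : ∀ t ∈ T, ∀ t' ∈ T, V t = V t' → V' (φ t) = V' (φ t')) :
    pairCount T V ≤ pairCount T' V' := by
  unfold pairCount
  refine card_le_card_of_injOn (fun t => (φ t.1, φ t.2)) ?_ ?_
  · intro t ht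
    simp only [coe_filter, mem_product, Set.mem_ofPred_eq] at ht ⊢
    exact ⟨⟨hmaps _ ht.1.1, hmaps _ ht.1.2⟩, h _ ht.1.1 _ ht.1.2 ht.2⟩
  · intro t ht t' ht' heq
    simp only [coe_filter, mem_product, Set.mem_ofPred_eq] at ht ht'
    rw [Prod.mk.injEq] at heq
    exact Prod.ext (hinj ht.1.1 ht'.1.1 heq.1) (hinj ht.1.2 ht'.1.2 heq.2)

theorem vinogradov_mono {k s : ℕ} {Y Y' : Finset ℤ} (h : Y ⊆ Y') :
    vinogradov k s Y ≤ vinogradov k s Y' :=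
  pairCount_mono (Fintype.piFinset_subset _ _ fun _ => h) _

theorem mixed_mono_right {k s : ℕ} {g : List ℤ} {I Y Y' : Finset ℤ} (h : Y ⊆ Y') :
    mixed k g I s Y ≤ mixed k g I s Y' := by
  unfold mixed mixedCount
  exact pairCount_mono (product_subset_product_right (Fintype.piFinset_subset _ _ fun _ => h)) _

theorem vinogradov_progression_le {k s : ℕ} {a q : ℤ} (hq : q ≠ 0) (n : ℕ) :
    vinogradov k s (progression a q n) ≤ vinogradov k s (progression 1 1 n) := by
  have hY : ∀ y ∈ tuples s (progression a q n), ∀ i, y i - a = q * ((y i - a) / q) := by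
    intro y hy i
    rw [Fintype.mem_piFinset] at hy
    obtain ⟨l, hl, h⟩ := mem_image.1 (hy i)
    rw [← h, add_sub_cancel_left, Int.mul_ediv_cancel_left _ hq]
  refine pairCount_le_of_map (fun y i => 1 + (y i - a) / q) ?_ ?_ ?_
  · intro y hy
    rw [Fintype.mem_piFinset] at hy ⊢
    intro i
    obtain ⟨l, hl, h⟩ := mem_image.1 (hy i)
    refine mem_image.2 ⟨l, hl, ?_⟩
    rw [← h, add_sub_cancel_left, Int.mul_ediv_cancel_left _ hq, one_mul]
  · intro y hy y' hy' heq
    funext i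
    have h1 := congrFun heq i
    dsimp only at h1
    have h2 := hY y hy i
    have h3 := hY y' hy' i
    rw [add_left_cancel h1, ← h3] at h2
    linarith
  · intro y hy y' hy' heq
    funext j
    have hj : ((X - C (a - q)) ^ ((j : ℕ) + 1) : ℤ[X]).natDegree ≤ k := by
      rw [natDegree_pow, natDegree_X_sub_C]; omega
    have h1 := sum_eval_eq_of_tupleSum_nil_eq heq hj
    have h2 : ∀ y ∈ tuples s (progression a q n),
        ∑ i, ((X - C (a - q)) ^ ((j : ℕ) + 1) : ℤ[X]).eval (y i)
        = q ^ ((j : ℕ) + 1) * tupleSum (powVec k []) (fun i => 1 + (y i - a) / q) j := by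
      intro y hy
      simp only [tupleSum, powVec, Finset.sum_apply, mul_sum, diff_nil, eval_pow, eval_X]
      refine sum_congr rfl fun i _ => ?_
      rw [← mul_pow, eval_sub, eval_X, eval_C, mul_add, ← hY y hy i]
      congr 1
      ring
    rw [h2 y hy, h2 y' hy'] at h1
    exact mul_left_cancel₀ (pow_ne_zero _ hq) h1

theorem progression_filter_subset {a q : ℤ} (hq : q ≠ 0) {n n' p : ℕ} (hn : n ≤ n' * p) (η : ℕ) :
    {y ∈ progression a q n | ((y - a) / q).toNat % p = η}
      ⊆ progression (a + q * η) (q * p) n' := by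
  intro y hy
  rw [mem_filter] at hy
  obtain ⟨l, hl, rfl⟩ := mem_image.1 hy.1
  have h := hy.2
  rw [add_sub_cancel_left, Int.mul_ediv_cancel_left _ hq, Int.toNat_natCast] at h
  rw [mem_range] at hl
  refine mem_image.2 ⟨l / p, ?_, ?_⟩
  · rw [mem_range]
    exact Nat.div_lt_of_lt_mul (by rw [mul_comm]; omega)
  · have h2 := Nat.mod_add_div l p
    have h3 : (l : ℤ) = η + p * (l / p : ℕ) := by rw [← h]; exact_mod_cast h2.symm
    conv_rhs => rw [h3]
    ring

theorem card_filter_dvd_le {Q : Finset ℕ} {x B : ℝ} {k : ℕ} (hx : 0 ≤ x)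
    (hQ : ∀ p ∈ Q, p.Prime ∧ x ≤ p) (hB : B < x ^ (k + 1)) {D : ℤ} (hD0 : D ≠ 0)
    (hD : |(D : ℝ)| ≤ B) : #(Q.filter fun p : ℕ => (p : ℤ) ∣ D) ≤ k := by
  by_contra hcon
  push Not at hcon
  obtain ⟨S, hS, hcard⟩ := exists_subset_card_eq (Nat.succ_le_of_lt hcon)
  have hmem : ∀ p ∈ S, (p.Prime ∧ x ≤ p) ∧ (p : ℤ) ∣ D := fun p hp => by
    have := hS hp
    rw [mem_filter] at this
    exact ⟨hQ p this.1, this.2⟩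
  have hdvd : ∏ p ∈ S, p ∣ D.natAbs :=
    prod_primes_dvd _ (fun p hp => (hmem p hp).1.1.prime)
      (fun p hp => Int.natCast_dvd.1 (hmem p hp).2)
  have hle := Nat.le_of_dvd (Int.natAbs_pos.2 hD0) hdvd
  have h1 : x ^ (k + 1) ≤ ∏ p ∈ S, (p : ℝ) := by
    rw [← Nat.succ_eq_add_one, ← hcard, ← prod_const]
    exact prod_le_prod (fun _ _ => hx) fun p hp => (hmem p hp).1.2
  have h2 : (∏ p ∈ S, (p : ℝ)) ≤ |(D : ℝ)| := by
    have : ((∏ p ∈ S, p : ℕ) : ℝ) ≤ (D.natAbs : ℝ) := by exact_mod_cast hle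
    rwa [Nat.cast_natAbs, Int.cast_abs, Nat.cast_prod] at this
  linarith

theorem sum_card_Ioi (k : ℕ) : 2 * ∑ i : Fin k, #(Ioi i) = k * (k - 1) := by
  simp only [Fin.card_Ioi]
  rw [Fin.sum_univ_eq_sum_range (fun i => k - 1 - i), sum_range_reflect (fun i => i), mul_comm,
    sum_range_id_mul_two]

/-- A large enough pool of primes contains one dividing no difference of two entries of either of
two injective tuples, and no step. -/
theorem exists_prime_not_dvd {Q : Finset ℕ} {x B : ℝ} {k : ℕ} (hx : 0 ≤ x)
    (hQ : ∀ p ∈ Q, p.Prime ∧ x ≤ p) (hcard : k ^ 3 ≤ #Q) (hB : B < x ^ (k + 1))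
    {I : Finset ℤ} (hI : ∀ z ∈ I, ∀ w ∈ I, (z : ℝ) - w ≤ B) {g : List ℤ} (hgk : g.length < k)
    (hg0 : ∀ h ∈ g, h ≠ 0) (hgB : ∀ h ∈ g, |(h : ℝ)| ≤ B)
    {z w : Fin k → ℤ} (hz : z ∈ tuples k I) (hw : w ∈ tuples k I)
    (hzi : Function.Injective z) (hwi : Function.Injective w) :
    ∃ p ∈ Q, (∀ h ∈ g, ¬ (p : ℤ) ∣ h) ∧ (∀ i j, i ≠ j → ¬ (p : ℤ) ∣ z i - z j)
      ∧ ∀ i j, i ≠ j → ¬ (p : ℤ) ∣ w i - w j := by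
  classical
  by_contra! hcon
  have hdiff : ∀ z ∈ tuples k I, Function.Injective z → ∀ i j, i ≠ j →
      #(Q.filter fun p : ℕ => (p : ℤ) ∣ z i - z j) ≤ k := by
    intro z hz hzi i j hij
    rw [Fintype.mem_piFinset] at hz
    refine card_filter_dvd_le hx hQ hB (sub_ne_zero.2 fun h => hij (hzi h)) ?_
    rw [Int.cast_sub, abs_sub_le_iff]
    exact ⟨hI _ (hz i) _ (hz j), hI _ (hz j) _ (hz i)⟩
  set bad : (Fin k → ℤ) → Finset ℕ := fun z =>
    univ.biUnion fun i => (Ioi i).biUnion fun j =>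
      (Q.filter fun p : ℕ => (p : ℤ) ∣ z i - z j) with hbad
  have hbadcard : ∀ z ∈ tuples k I, Function.Injective z →
      2 * #(bad z) ≤ k * (k - 1) * k := by
    intro z hz hzi
    rw [← sum_card_Ioi, mul_assoc, sum_mul]
    refine Nat.mul_le_mul_left _ (card_biUnion_le.trans (sum_le_sum fun i _ => ?_))
    refine card_biUnion_le_card_mul _ _ _ fun j hj => hdiff z hz hzi i j (mem_Ioi.1 hj).ne
  have hbadmem : ∀ z : Fin k → ℤ, ∀ p ∈ Q, p ∉ bad z → ∀ i j, i ≠ j → ¬ (p : ℤ) ∣ z i - z j := by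
    intro z p hp hpz i j hij hdvd
    simp only [hbad, mem_biUnion, mem_univ, true_and, mem_Ioi, mem_filter, not_exists,
      not_and] at hpz
    rcases lt_or_gt_of_ne hij with h | h
    · exact hpz i j h hp hdvd
    · exact hpz j i h hp (by rw [← neg_sub]; exact (dvd_neg).2 hdvd)
  set badg : Finset ℕ := g.toFinset.biUnion fun h => (Q.filter fun p : ℕ => (p : ℤ) ∣ h) with hbadg
  have hbadgcard : #badg ≤ g.length * k :=
    (card_biUnion_le_card_mul _ _ _ fun h hh => card_filter_dvd_le hx hQ hB
      (hg0 h (List.mem_toFinset.1 hh)) (hgB h (List.mem_toFinset.1 hh))).trans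
      (Nat.mul_le_mul_right _ g.toFinset_card_le)
  have hsub : Q ⊆ badg ∪ (bad z ∪ bad w) := by
    intro p hp
    by_contra hnot
    simp only [mem_union, not_or] at hnot
    obtain ⟨i, j, hij, hdvd⟩ := hcon p hp
      (fun h hh hdvd => hnot.1 (mem_biUnion.2
        ⟨h, List.mem_toFinset.2 hh, mem_filter.2 ⟨hp, hdvd⟩⟩))
      (hbadmem z p hp hnot.2.1)
    exact hbadmem w p hp hnot.2.2 i j hij hdvd
  have h1 := (card_le_card hsub).trans ((card_union_le _ _).trans
    (Nat.add_le_add_left (card_union_le _ _) _))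
  have h2 := hbadcard z hz hzi
  have h3 := hbadcard w hw hwi
  obtain ⟨k, rfl⟩ : ∃ k', k = k' + 1 := ⟨k - 1, by omega⟩
  have h4 : g.length * (k + 1) ≤ k * (k + 1) := Nat.mul_le_mul_right _ (by omega)
  rw [Nat.add_sub_cancel] at h2 h3
  have h5 : (k + 1) ^ 3 = (k + 1) * k * (k + 1) + k * (k + 1) + (k + 1) := by ring
  omega

/-- Restricting to tuples with entries distinct modulo a prime from a pool. -/
theorem mixed_le_of_pool {Q : Finset ℕ} {x B : ℝ} {k : ℕ} (hk : 2 ≤ k) (hx : 0 ≤ x)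
    (hQ : ∀ p ∈ Q, p.Prime ∧ x ≤ p) (hcard : #Q = k ^ 3) (hB : B < x ^ (k + 1))
    {I : Finset ℤ} (hI : ∀ z ∈ I, ∀ w ∈ I, (z : ℝ) - w ≤ B) {g : List ℤ} (hgk : g.length < k)
    (hg0 : ∀ h ∈ g, h ≠ 0) (hgB : ∀ h ∈ g, |(h : ℝ)| ≤ B) (s : ℕ) (Y : Finset ℤ) {U : ℝ}
    (hU0 : 0 ≤ U)
    (hU : ∀ p ∈ Q, (∀ h ∈ g, ¬ (p : ℤ) ∣ h) →
      (mixedCount {z ∈ tuples k I | ∀ i j, i ≠ j → ¬ (p : ℤ) ∣ z i - z j} (powVec k g) s Y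
        (powVec k []) : ℝ) ≤ U) :
    (mixed k g I s Y : ℝ) ≤ 2 * k ^ 3 * U + (4 * k ^ 2 * #I) ^ k * vinogradov k s Y := by
  classical
  refine (mixedCount_le_injective hk I _ s Y _).trans (add_le_add ?_ le_rfl)
  rw [mul_assoc]
  refine mul_le_mul_of_nonneg_left ?_ (by norm_num)
  set Q' := (Q.filter fun p : ℕ => ∀ h ∈ g, ¬ (p : ℤ) ∣ h) with hQ'
  have hcover : mixedCount {z ∈ tuples k I | Function.Injective z} (powVec k g) s Y (powVec k [])
      ≤ ∑ p ∈ Q', mixedCount {z ∈ tuples k I | ∀ i j, i ≠ j → ¬ (p : ℤ) ∣ z i - z j}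
          (powVec k g) s Y (powVec k []) := by
    refine pairCount_le_sum_of_cover _ _ Q' (fun p : ℕ =>
      {z ∈ tuples k I | ∀ i j, i ≠ j → ¬ (p : ℤ) ∣ z i - z j} ×ˢ tuples s Y) ?_
    intro t ht t' ht' _
    simp only [mem_product, mem_filter] at ht ht'
    obtain ⟨p, hp, h1, h2, h3⟩ := exists_prime_not_dvd hx hQ hcard.ge hB hI hgk hg0 hgB
      ht.1.1 ht'.1.1 ht.1.2 ht'.1.2
    refine ⟨p, mem_filter.2 ⟨hp, h1⟩, ?_, ?_⟩
    · exact mem_product.2 ⟨mem_filter.2 ⟨ht.1.1, h2⟩, ht.2⟩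
    · exact mem_product.2 ⟨mem_filter.2 ⟨ht'.1.1, h3⟩, ht'.2⟩
  calc (mixedCount {z ∈ tuples k I | Function.Injective z} (powVec k g) s Y (powVec k []) : ℝ)
      ≤ ∑ p ∈ Q', (mixedCount {z ∈ tuples k I | ∀ i j, i ≠ j → ¬ (p : ℤ) ∣ z i - z j}
          (powVec k g) s Y (powVec k []) : ℝ) := by exact_mod_cast hcover
    _ ≤ ∑ p ∈ Q', U := sum_le_sum fun p hp => hU p (mem_filter.1 hp).1 (mem_filter.1 hp).2
    _ = #Q' * U := by rw [sum_const, nsmul_eq_mul]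
    _ ≤ k ^ 3 * U := by
        refine mul_le_mul_of_nonneg_right ?_ hU0
        have := (card_filter_le Q fun p : ℕ => ∀ h ∈ g, ¬ (p : ℤ) ∣ h).trans hcard.le
        exact_mod_cast this

/-- Residues modulo `p ^ r` of the `z`-parts of solutions with a prescribed value of the mixed
system, when the remaining variables lie in one residue class modulo `p`. -/
theorem card_image_residue_mixed_le {k d r p : ℕ} (hk : 1 ≤ k) (hp : p.Prime) (hkp : k < p)
    (hr : 1 ≤ r) (g : List ℤ) (hd : g.length = d) (hdr : d ≤ r) (hdk : d ≤ k)
    (hg : ∀ h ∈ g, ¬ (p : ℤ) ∣ h) (Z : Finset (Fin k → ℤ))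
    (hZ : ∀ z ∈ Z, ∀ i j, i ≠ j → ¬ (p : ℤ) ∣ z i - z j) (s : ℕ) (Y : Finset ℤ) (a : ℤ)
    (hY : ∀ y ∈ Y, (p : ℤ) ∣ y - a) (t₀ : (Fin k → ℤ) × (Fin s → ℤ))
    (ht₀ : t₀ ∈ Z ×ˢ tuples s Y) :
    #(({t ∈ Z ×ˢ tuples s Y | tupleSum (powVec k g) t.1 + tupleSum (powVec k []) t.2
        = tupleSum (powVec k g) t₀.1 + tupleSum (powVec k []) t₀.2}).image
          fun t i => ((t.1 i : ℤ) : ZMod (p ^ r)))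
      ≤ k ^ k * p ^ (r * (r - 1) / 2 + d * (d + 1) / 2) := by
  obtain ⟨n, rfl⟩ : ∃ n, k = n + d := ⟨k - d, by omega⟩
  set T := {t ∈ Z ×ˢ tuples s Y | tupleSum (powVec (n + d) g) t.1 + tupleSum (powVec (n + d) []) t.2
        = tupleSum (powVec (n + d) g) t₀.1 + tupleSum (powVec (n + d) []) t₀.2} with hT
  have himage : (T.image fun t i => ((t.1 i : ℤ) : ZMod (p ^ r)))
      = (T.image Prod.fst).image fun z i => ((z i : ℤ) : ZMod (p ^ r)) := by
    rw [image_image]; rfl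
  rw [himage]
  have hYdvd : ∀ y ∈ tuples s Y, ∀ j, (p : ℤ) ^ j ∣ ∑ i, ((X - C a) ^ j : ℤ[X]).eval (y i) := by
    intro y hy j
    rw [Fintype.mem_piFinset] at hy
    refine dvd_sum fun i _ => ?_
    rw [eval_pow, eval_sub, eval_X, eval_C]
    exact pow_dvd_pow_of_dvd (hY _ (hy i)) j
  refine (card_image_residue_le (n := n) hp hr g hd hkp hdr hg a
    (fun j => ∑ i, (diff g ((X - C a) ^ j)).eval (t₀.1 i)) _ ?_ ?_).trans ?_
  · intro z hz
    obtain ⟨t, ht, rfl⟩ := mem_image.1 hz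
    rw [hT, mem_filter, mem_product] at ht
    exact hZ _ ht.1.1
  · intro z hz j hj1 hj2
    obtain ⟨t, ht, rfl⟩ := mem_image.1 hz
    rw [hT, mem_filter, mem_product] at ht
    have h1 := sum_eval_eq_of_tupleSum_eq ht.2 (f := (X - C a) ^ j)
      (by rw [natDegree_pow, natDegree_X_sub_C]; omega)
    have h2 := hYdvd _ ht.1.2 j
    have h3 := hYdvd _ (mem_product.1 ht₀).2 j
    refine (pow_dvd_pow _ (min_le_left j r)).trans ?_
    have h4 : ∑ i, (diff g ((X - C a) ^ j)).eval (t.1 i)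
          - ∑ i, (diff g ((X - C a) ^ j)).eval (t₀.1 i)
        = ∑ i, ((X - C a) ^ j : ℤ[X]).eval (t₀.2 i) - ∑ i, ((X - C a) ^ j : ℤ[X]).eval (t.2 i) := by
      linarith
    rw [h4]
    exact dvd_sub h3 h2
  · refine Nat.mul_le_mul_right _ ?_
    calc n ^ n ≤ (n + d) ^ n := Nat.pow_le_pow_left (by omega) _
      _ ≤ _ := Nat.pow_le_pow_right (by omega) (by omega)

theorem mixedCount_distinct_le {k d r p H n n' : ℕ} (hk : 1 ≤ k) (hp : p.Prime) (hkp : k < p)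
    (hr : 1 ≤ r) (g : List ℤ) (hd : g.length = d) (hdr : d ≤ r) (hdk : d ≤ k)
    (hg : ∀ h ∈ g, ¬ (p : ℤ) ∣ h) (I : Finset ℤ)
    (hH : ∀ z ∈ I, ∀ w ∈ I, z - w < (H + 1) * (p ^ r : ℕ)) {s : ℕ} (hs : 1 ≤ s) (a : ℤ) {q : ℤ}
    (hq : q ≠ 0) (hn : n ≤ n' * p) (N : ℝ)
    (hN : ∀ h ∈ Icc 1 H, ∀ η < p, (mixed k ((h : ℤ) * (p ^ r : ℕ) :: g)
      {z ∈ I | z + (h : ℤ) * (p ^ r : ℕ) ∈ I} s (progression (a + q * η) (q * p) n') : ℝ) ≤ N) :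
    (mixedCount {z ∈ tuples k I | ∀ i j, i ≠ j → ¬ (p : ℤ) ∣ z i - z j} (powVec k g) s
        (progression a q n) (powVec k []) : ℝ)
      ≤ (p : ℝ) ^ (2 * s) * ((k : ℝ) ^ k * (p : ℝ) ^ (r * (r - 1) / 2 + d * (d + 1) / 2)) *
        (2 ^ (k - 1) * ((#I : ℝ) ^ k * vinogradov k s (progression 1 1 n')
          + 2 ^ k * (H : ℝ) ^ k * √(N * vinogradov k s (progression 1 1 n')))) := by
  classical
  have : NeZero (p ^ r) := ⟨(pow_pos hp.pos r).ne'⟩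
  set J := vinogradov k s (progression 1 1 n') with hJ
  set Z := {z ∈ tuples k I | ∀ i j, i ≠ j → ¬ (p : ℤ) ∣ z i - z j} with hZ
  set e := r * (r - 1) / 2 + d * (d + 1) / 2 with he
  set f : ℤ → ℕ := fun y => ((y - a) / q).toNat % p with hf
  set W : ℝ := 2 ^ (k - 1) * ((#I : ℝ) ^ k * J + 2 ^ k * (H : ℝ) ^ k * √(N * J)) with hW
  have hqp : q * p ≠ 0 := mul_ne_zero hq (by exact_mod_cast hp.ne_zero)
  have hfib : ∀ η ∈ range p, (mixedCount Z (powVec k g) s {y ∈ progression a q n | f y = η}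
      (powVec k []) : ℝ) ≤ (k : ℝ) ^ k * (p : ℝ) ^ e * W := by
    intro η hη
    set Y := {y ∈ progression a q n | f y = η} with hY
    have hsub : Y ⊆ progression (a + q * η) (q * p) n' := progression_filter_subset hq hn η
    have hYJ : (pairCount (tuples s Y) (tupleSum (powVec k [])) : ℝ) ≤ J := by
      have h1 : vinogradov k s Y ≤ J :=
        (vinogradov_mono hsub).trans (vinogradov_progression_le hqp n')
      exact_mod_cast h1
    have hYp : ∀ y ∈ Y, (p : ℤ) ∣ y - (a + q * η) := by
      intro y hy
      obtain ⟨l, -, hl⟩ := mem_image.1 (hsub hy)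
      exact ⟨q * l, by rw [← hl]; ring⟩
    have h1 := pairCount_le_mul_sum (Z ×ˢ tuples s Y)
      (fun t => tupleSum (powVec k g) t.1 + tupleSum (powVec k []) t.2)
      (fun t i => ((t.1 i : ℤ) : ZMod (p ^ r))) (k ^ k * p ^ e)
      (fun t₀ ht₀ => card_image_residue_mixed_le hk hp hkp hr g hd hdr hdk hg Z
        (fun z hz => (mem_filter.1 hz).2) s Y _ hYp t₀ ht₀)
    have h2 : ∀ ρ : Fin k → ZMod (p ^ r),
        pairCount {t ∈ Z ×ˢ tuples s Y | (fun i => ((t.1 i : ℤ) : ZMod (p ^ r))) = ρ}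
          (fun t => tupleSum (powVec k g) t.1 + tupleSum (powVec k []) t.2)
        ≤ mixedCount {z ∈ tuples k I | ∀ i, ((z i : ℤ) : ZMod (p ^ r)) = ρ i} (powVec k g) s Y
          (powVec k []) := by
      intro ρ
      refine pairCount_mono ?_ _
      intro t ht
      rw [mem_filter, mem_product, hZ, mem_filter] at ht
      rw [mem_product, mem_filter]
      exact ⟨⟨ht.1.1.1, congrFun ht.2⟩, ht.1.2⟩
    have h3 := sum_mixedCount_residue_le hk (p ^ r) I (powVec k g) s Y (powVec k []) H hH
    have h4 : ∀ h ∈ Icc 1 H, √((mixedCount (tuples k {z ∈ I | z + (h : ℤ) * (p ^ r : ℕ) ∈ I})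
            (fun z => powVec k g (z + (h : ℤ) * (p ^ r : ℕ)) - powVec k g z) s Y (powVec k []) : ℝ)
              * pairCount (tuples s Y) (tupleSum (powVec k []))) ≤ √(N * J) := by
      intro h hh
      have h5 : (fun z => powVec k g (z + (h : ℤ) * (p ^ r : ℕ)) - powVec k g z)
          = powVec k ((h : ℤ) * (p ^ r : ℕ) :: g) := funext fun z => (powVec_cons _ _ _ _).symm
      rw [h5]
      have h6 : (mixed k ((h : ℤ) * (p ^ r : ℕ) :: g)
            {z ∈ I | z + (h : ℤ) * (p ^ r : ℕ) ∈ I} s Y : ℝ)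
          ≤ N := le_trans (by exact_mod_cast mixed_mono_right hsub) (hN h hh η (mem_range.1 hη))
      exact Real.sqrt_le_sqrt (mul_le_mul h6 hYJ (Nat.cast_nonneg _)
        ((Nat.cast_nonneg _).trans h6))
    have h5 := sum_le_sum h4
    rw [sum_const, nsmul_eq_mul, Nat.card_Icc, Nat.add_sub_cancel] at h5
    have h6 : (∑ ρ : Fin k → ZMod (p ^ r), (mixedCount {z ∈ tuples k I | ∀ i,
        ((z i : ℤ) : ZMod (p ^ r)) = ρ i} (powVec k g) s Y (powVec k []) : ℝ)) ≤ W := by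
      refine h3.trans (mul_le_mul_of_nonneg_left (add_le_add
        (mul_le_mul_of_nonneg_left hYJ (by positivity)) ?_) (by positivity))
      calc 2 ^ k * (H : ℝ) ^ (k - 1) * _ ≤ 2 ^ k * (H : ℝ) ^ (k - 1) * (H * √(N * J)) :=
            mul_le_mul_of_nonneg_left h5 (by positivity)
        _ = 2 ^ k * (H : ℝ) ^ k * √(N * J) := by
            obtain ⟨k, rfl⟩ : ∃ k', k = k' + 1 := ⟨k - 1, by omega⟩
            rw [Nat.add_sub_cancel]; ring
    calc (mixedCount Z (powVec k g) s Y (powVec k []) : ℝ)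
        ≤ ((k ^ k * p ^ e : ℕ) : ℝ) * ∑ ρ : Fin k → ZMod (p ^ r), (mixedCount {z ∈ tuples k I | ∀ i,
          ((z i : ℤ) : ZMod (p ^ r)) = ρ i} (powVec k g) s Y (powVec k []) : ℝ) := by
          exact_mod_cast h1.trans (Nat.mul_le_mul_left _ (sum_le_sum fun ρ _ => h2 ρ))
      _ ≤ ((k ^ k * p ^ e : ℕ) : ℝ) * W := mul_le_mul_of_nonneg_left h6 (Nat.cast_nonneg _)
      _ = (k : ℝ) ^ k * (p : ℝ) ^ e * W := by push_cast; ring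
  have h1 := mixedCount_le_sum_fiber Z (powVec k g) s hs (progression a q n) (powVec k []) p f
    (fun y _ => Nat.mod_lt _ hp.pos)
  refine h1.trans ?_
  calc (p : ℝ) ^ (2 * s - 1) * _
      ≤ (p : ℝ) ^ (2 * s - 1) * ∑ η ∈ range p, (k : ℝ) ^ k * (p : ℝ) ^ e * W :=
        mul_le_mul_of_nonneg_left (sum_le_sum hfib) (by positivity)
    _ = (p : ℝ) ^ (2 * s) * ((k : ℝ) ^ k * (p : ℝ) ^ e) * W := by
        rw [sum_const, card_range, nsmul_eq_mul]
        obtain ⟨m, hm⟩ : ∃ m, 2 * s = m + 1 := ⟨2 * s - 1, by omega⟩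
        rw [hm, Nat.add_sub_cancel, pow_succ]; ring

end PowerSums

namespace PowerSums

open Finset

theorem level_contribution_le {k r s J : ℕ} {R C Q μ p x E δ φ Θ e' c j H N : ℝ} {m : ℕ}
    (hk : 1 ≤ k) (hR : 1 ≤ R) (hC : 0 ≤ C) (hQ : 0 < Q) (hx : x = R ^ φ) (hxp : x ≤ p)
    (hpx : p ≤ 2 * x) (hE0 : 0 ≤ E) (hErk : E ≤ r * k) (hφ : φ * (2 * r * k - E) = k)
    (hδ0 : 0 ≤ δ) (hδ : δ ≤ J ^ 2) (hΘ : 0 ≤ Θ) (hEδ : E + δ = 2 * s + m - μ)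
    (hc0 : 0 ≤ c) (hc : c ≤ 3 * R) (hj0 : 0 ≤ j) (hj : j ≤ C * (Q / p) ^ μ)
    (hH0 : 0 ≤ H) (hH : H ≤ 3 * R / p ^ r)
    (hN : N = Θ * R ^ (φ * E + e') * R ^ k * (C * (Q / p) ^ μ)) :
    2 * k ^ 3 * (p ^ (2 * s) * ((k : ℝ) ^ k * p ^ m) *
      (2 ^ (k - 1) * (c ^ k * j + 2 ^ k * H ^ k * √(N * j))))
    ≤ k ^ (k + 3) * 12 ^ k * (2 ^ E * 2 ^ (J ^ 2) * R ^ (φ * E + φ * δ)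
        + 2 ^ (J ^ 2) * √Θ * R ^ (φ * E + φ * δ + e' / 2)) * R ^ k * (C * Q ^ μ) := by
  have hR0 : 0 < R := by linarith
  have hx0 : 0 < x := by rw [hx]; positivity
  have hp0 : 0 < p := by linarith
  set W := C * (Q / p) ^ μ with hW
  have hW0 : 0 ≤ W := by positivity
  have hWp : W * p ^ (2 * s) * p ^ m = C * Q ^ μ * p ^ (E + δ) := by
    rw [hW, Real.div_rpow hQ.le hp0.le, hEδ, Real.rpow_sub hp0, Real.rpow_add hp0,
      show (2 * (s : ℝ)) = ((2 * s : ℕ) : ℝ) by push_cast; ring, Real.rpow_natCast,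
      Real.rpow_natCast]
    field_simp
  have hsqrt : √(N * j) ≤ W * (√Θ * R ^ ((φ * E + e' + k) / 2)) := by
    refine Real.sqrt_le_iff.2 ⟨by positivity, ?_⟩
    have h1 : (R ^ ((φ * E + e' + k) / 2)) ^ 2 = R ^ (φ * E + e') * R ^ k := by
      rw [← Real.rpow_natCast, ← Real.rpow_mul hR0.le, ← Real.rpow_natCast R k,
        ← Real.rpow_add hR0]
      congr 1; push_cast; ring
    calc N * j ≤ N * W := mul_le_mul_of_nonneg_left hj (by rw [hN]; positivity)
      _ = W ^ 2 * (Θ * (R ^ (φ * E + e') * R ^ k)) := by rw [hN]; ring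
      _ = (W * (√Θ * R ^ ((φ * E + e' + k) / 2))) ^ 2 := by
        rw [mul_pow W, mul_pow (√Θ), Real.sq_sqrt hΘ, h1]
  have hpE : p ^ (E + δ) ≤ 2 ^ E * 2 ^ (J ^ 2) * R ^ (φ * E + φ * δ) := by
    calc p ^ (E + δ) ≤ (2 * x) ^ (E + δ) := Real.rpow_le_rpow hp0.le hpx (by linarith)
      _ = 2 ^ E * 2 ^ δ * R ^ (φ * E + φ * δ) := by
        rw [Real.mul_rpow (by norm_num) hx0.le, hx, ← Real.rpow_mul hR0.le,
          Real.rpow_add (by norm_num), mul_add]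
      _ ≤ _ := by
        refine mul_le_mul_of_nonneg_right (mul_le_mul_of_nonneg_left ?_ (by positivity))
          (by positivity)
        rw [← Real.rpow_natCast 2]
        exact Real.rpow_le_rpow_of_exponent_le (by norm_num) (by exact_mod_cast hδ)
  have hpErk : p ^ (E + δ) / p ^ (r * k) * R ^ ((φ * E + e' + k) / 2)
      ≤ 2 ^ (J ^ 2) * R ^ (φ * E + φ * δ + e' / 2) := by
    have h1 : p ^ (E + δ) / p ^ (r * k) = p ^ (E - r * k) * p ^ δ := by
      rw [← Real.rpow_natCast p (r * k), ← Real.rpow_sub hp0, ← Real.rpow_add hp0]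
      congr 1; push_cast; ring
    have h2 : p ^ (E - r * k) ≤ R ^ (φ * (E - r * k)) := by
      rw [Real.rpow_mul hR0.le, ← hx]
      exact Real.rpow_le_rpow_of_nonpos hx0 hxp (by linarith)
    have h3 : p ^ δ ≤ 2 ^ (J ^ 2) * R ^ (φ * δ) := by
      calc p ^ δ ≤ (2 * x) ^ δ := Real.rpow_le_rpow hp0.le hpx hδ0
        _ = 2 ^ δ * R ^ (φ * δ) := by
          rw [Real.mul_rpow (by norm_num) hx0.le, hx, ← Real.rpow_mul hR0.le]
        _ ≤ _ := by
          refine mul_le_mul_of_nonneg_right ?_ (by positivity)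
          rw [← Real.rpow_natCast 2]
          exact Real.rpow_le_rpow_of_exponent_le (by norm_num) (by exact_mod_cast hδ)
    calc p ^ (E + δ) / p ^ (r * k) * R ^ ((φ * E + e' + k) / 2)
        ≤ R ^ (φ * (E - r * k)) * (2 ^ (J ^ 2) * R ^ (φ * δ)) * R ^ ((φ * E + e' + k) / 2) := by
          rw [h1]; gcongr
      _ = 2 ^ (J ^ 2) * (R ^ (φ * (E - r * k)) * R ^ (φ * δ) * R ^ ((φ * E + e' + k) / 2)) := by
          ring
      _ = _ := by
          rw [← Real.rpow_add hR0, ← Real.rpow_add hR0]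
          congr 2
          linear_combination (-1 / 2) * hφ
  have hpk : (p ^ r) ^ k = p ^ (r * k) := (pow_mul _ _ _).symm
  calc 2 * k ^ 3 * (p ^ (2 * s) * ((k : ℝ) ^ k * p ^ m) *
      (2 ^ (k - 1) * (c ^ k * j + 2 ^ k * H ^ k * √(N * j))))
      ≤ 2 * k ^ 3 * (p ^ (2 * s) * ((k : ℝ) ^ k * p ^ m) *
        (2 ^ (k - 1) * ((3 * R) ^ k * W + 2 ^ k * (3 * R / p ^ r) ^ k *
          (W * (√Θ * R ^ ((φ * E + e' + k) / 2)))))) := by gcongr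
    _ = k ^ (k + 3) * 6 ^ k * R ^ k * ((W * p ^ (2 * s) * p ^ m) + 2 ^ k * √Θ *
          ((W * p ^ (2 * s) * p ^ m) / p ^ (r * k) * R ^ ((φ * E + e' + k) / 2))) := by
        obtain ⟨l, rfl⟩ : ∃ l, k = l + 1 := ⟨k - 1, by omega⟩
        rw [Nat.add_sub_cancel, div_pow, hpk, mul_pow,
          show (6 : ℝ) ^ (l + 1) = 2 * 2 ^ l * 3 ^ (l + 1) by
            rw [← pow_succ', ← mul_pow]; norm_num]
        field_simp
        ring
    _ = k ^ (k + 3) * 6 ^ k * R ^ k * (C * Q ^ μ) * (p ^ (E + δ) + 2 ^ k * √Θ *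
          (p ^ (E + δ) / p ^ (r * k) * R ^ ((φ * E + e' + k) / 2))) := by
        rw [hWp]; ring
    _ ≤ k ^ (k + 3) * 6 ^ k * R ^ k * (C * Q ^ μ) *
          (2 ^ k * (2 ^ E * 2 ^ (J ^ 2) * R ^ (φ * E + φ * δ)) + 2 ^ k * √Θ *
          (2 ^ (J ^ 2) * R ^ (φ * E + φ * δ + e' / 2))) := by
        have h2k : (1 : ℝ) ≤ 2 ^ k := one_le_pow₀ (by norm_num)
        have : p ^ (E + δ) ≤ 2 ^ k * (2 ^ E * 2 ^ (J ^ 2) * R ^ (φ * E + φ * δ)) :=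
          hpE.trans (le_mul_of_one_le_left (by positivity) h2k)
        gcongr
    _ = _ := by
        rw [show (12 : ℝ) ^ k = 6 ^ k * 2 ^ k by rw [← mul_pow]; norm_num]
        ring

/-- The loss constant of one differencing step. -/
noncomputable def stepConst (k J : ℕ) (E : ℝ) : ℝ :=
  9 * ((k : ℝ) ^ (k + 3) * 12 ^ k) ^ 2 * 2 ^ E * 4 ^ (J ^ 2)

theorem add_le_stepConst {k J : ℕ} {E : ℝ} (hk : 1 ≤ k) (hE : 0 ≤ E) :
    (12 * (k : ℝ) ^ 2) ^ k + k ^ (k + 3) * 12 ^ k * (2 ^ E * 2 ^ (J ^ 2)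
        + 2 ^ (J ^ 2) * √(stepConst k J E)) ≤ stepConst k J E := by
  set c := (k : ℝ) ^ (k + 3) * 12 ^ k with hc
  have hk1 : (1 : ℝ) ≤ k := by exact_mod_cast hk
  have hc1 : 1 ≤ c := one_le_mul_of_one_le_of_one_le (one_le_pow₀ hk1) (one_le_pow₀ (by norm_num))
  set b : ℝ := 2 ^ (E / 2) with hb
  have hb1 : 1 ≤ b := Real.one_le_rpow (by norm_num) (by linarith)
  have hbE : (2 : ℝ) ^ E = b ^ 2 := by
    rw [hb, ← Real.rpow_natCast, ← Real.rpow_mul (by norm_num)]; congr 1; push_cast; ring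
  set t : ℝ := 2 ^ (J ^ 2) with ht
  have ht1 : 1 ≤ t := one_le_pow₀ (by norm_num)
  have hS : stepConst k J E = (3 * c * b * t) ^ 2 := by
    rw [stepConst, ← hc, hbE, show (4 : ℝ) ^ (J ^ 2) = t ^ 2 by
      rw [ht, ← pow_mul, mul_comm, pow_mul]; norm_num]
    ring
  have hsq : √(stepConst k J E) = 3 * c * b * t := by
    rw [hS, Real.sqrt_sq (by positivity)]
  have hfirst : (12 * (k : ℝ) ^ 2) ^ k ≤ c ^ 2 := by
    rw [hc, mul_pow, mul_pow, ← pow_mul, ← pow_mul, ← pow_mul, mul_comm]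
    refine mul_le_mul (pow_le_pow_right₀ hk1 (by nlinarith)) ?_ (by positivity) (by positivity)
    exact pow_le_pow_right₀ (by norm_num) (by omega)
  rw [hsq, hS, hbE]
  have h1 : c ^ 2 ≤ (c * b * t) ^ 2 := by
    refine pow_le_pow_left₀ (by positivity) ?_ 2
    have := one_le_mul_of_one_le_of_one_le hb1 ht1
    nlinarith
  have h2 : c * (b ^ 2 * t) ≤ (c * b * t) ^ 2 := by
    have : (c * b * t) ^ 2 = c * (b ^ 2 * t) * (c * t) := by ring
    rw [this]
    exact le_mul_of_one_le_right (by positivity) (one_le_mul_of_one_le_of_one_le hc1 ht1)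
  have h3 : c * (t * (3 * c * b * t)) ≤ 3 * (c * b * t) ^ 2 := by
    have : 3 * (c * b * t) ^ 2 = c * (t * (3 * c * b * t)) * b := by ring
    rw [this]
    exact le_mul_of_one_le_right (by positivity) hb1
  nlinarith

theorem nine_pow_le_stepConst {k J : ℕ} {E : ℝ} (hk : 1 ≤ k) (hE : 0 ≤ E) :
    (9 : ℝ) ^ k ≤ stepConst k J E := by
  have hk1 : (1 : ℝ) ≤ k := by exact_mod_cast hk
  refine le_trans ?_ (add_le_stepConst hk hE)
  have h1 : (9 : ℝ) ^ k ≤ (12 * (k : ℝ) ^ 2) ^ k := pow_le_pow_left₀ (by norm_num) (by nlinarith) k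
  refine h1.trans (le_add_of_nonneg_right ?_)
  positivity

theorem mixed_le_card_pow (k : ℕ) (g : List ℤ) (I : Finset ℤ) (s : ℕ) (Y : Finset ℤ) :
    mixed k g I s Y ≤ #I ^ k * ((#I + 1) ^ k * vinogradov k s Y) := by
  classical
  have h := pairCount_le_mul_sum (tuples k I ×ˢ tuples s Y)
    (fun t => tupleSum (powVec k g) t.1 + tupleSum (powVec k []) t.2)
    (fun t i => if h : t.1 i ∈ I then some (⟨t.1 i, h⟩ : I) else none) (#I ^ k) ?_
  · refine h.trans (Nat.mul_le_mul_left _ ?_)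
    refine (sum_le_sum (g := fun _ => vinogradov k s Y) fun ρ _ => ?_).trans (by simp)
    have hfst : ∀ t ∈ {t ∈ tuples k I ×ˢ tuples s Y | (fun i => if h : t.1 i ∈ I then
        some (⟨t.1 i, h⟩ : I) else none) = ρ}, ∀ i, ρ i = (some (t.1 i) : Option ℤ).elim none
          (fun z => if h : z ∈ I then some (⟨z, h⟩ : I) else none) ∧ t.1 i ∈ I := by
      intro t ht i
      rw [mem_filter, mem_product, Fintype.mem_piFinset] at ht
      exact ⟨(congrFun ht.2 i).symm, ht.1.1 i⟩
    have heq : ∀ t ∈ {t ∈ tuples k I ×ˢ tuples s Y | (fun i => if h : t.1 i ∈ I then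
        some (⟨t.1 i, h⟩ : I) else none) = ρ}, ∀ t' ∈ {t ∈ tuples k I ×ˢ tuples s Y |
        (fun i => if h : t.1 i ∈ I then some (⟨t.1 i, h⟩ : I) else none) = ρ}, t.1 = t'.1 := by
      intro t ht t' ht'
      funext i
      obtain ⟨h1, h2⟩ := hfst t ht i
      obtain ⟨h3, h4⟩ := hfst t' ht' i
      rw [h1] at h3
      simpa [h2, h4] using h3
    refine pairCount_le_of_map Prod.snd ?_ ?_ ?_
    · intro t ht
      exact (mem_product.1 (mem_filter.1 ht).1).2
    · intro t ht t' ht' h2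
      exact Prod.ext (heq t ht t' ht') h2
    · intro t ht t' ht' h2
      rw [heq t ht t' ht'] at h2
      exact add_left_cancel h2
  · intro t₀ _
    have hsub : (({t ∈ tuples k I ×ˢ tuples s Y | tupleSum (powVec k g) t.1
        + tupleSum (powVec k []) t.2 = tupleSum (powVec k g) t₀.1
        + tupleSum (powVec k []) t₀.2}).image fun t i => if h : t.1 i ∈ I then
          some (⟨t.1 i, h⟩ : I) else none) ⊆ (tuples k I).image fun z i =>
            if h : z i ∈ I then some (⟨z i, h⟩ : I) else none := by
      intro ρ hρ
      obtain ⟨t, ht, rfl⟩ := mem_image.1 hρ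
      exact mem_image.2 ⟨t.1, (mem_product.1 (mem_filter.1 ht).1).1, rfl⟩
    refine (card_le_card hsub).trans (card_image_le.trans ?_)
    simp [Fintype.card_piFinset]

theorem differencing_total_le {k J : ℕ} (hk : 1 ≤ k) {E R F f c v V : ℝ} (hE0 : 0 ≤ E) (hR : 1 ≤ R)
    (hF0 : 0 ≤ F) (hf : f ≤ F) (hc0 : 0 ≤ c) (hc : c ≤ 3 * R) (hv0 : 0 ≤ v) (hv : v ≤ V) :
    k ^ (k + 3) * 12 ^ k * (2 ^ E * 2 ^ (J ^ 2) * R ^ f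
        + 2 ^ (J ^ 2) * √(stepConst k J E) * R ^ F) * R ^ k * V + (4 * (k : ℝ) ^ 2 * c) ^ k * v
      ≤ stepConst k J E * R ^ F * R ^ k * V := by
  have hV0 : 0 ≤ V := hv0.trans hv
  have hR0 : 0 < R := by linarith
  set A : ℝ := k ^ (k + 3) * 12 ^ k with hA
  have hA0 : 0 ≤ A := by positivity
  set B : ℝ := 2 ^ E * 2 ^ (J ^ 2) with hB
  have hB0 : 0 ≤ B := by positivity
  set D : ℝ := 2 ^ (J ^ 2) * √(stepConst k J E) with hD
  have hfF : R ^ f ≤ R ^ F := Real.rpow_le_rpow_of_exponent_le hR hf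
  have h1F : 1 ≤ R ^ F := Real.one_le_rpow hR hF0
  have hadd : (12 * (k : ℝ) ^ 2) ^ k + A * (B + D) ≤ stepConst k J E := add_le_stepConst hk hE0
  have hlast : (4 * (k : ℝ) ^ 2 * c) ^ k * v ≤ (12 * (k : ℝ) ^ 2) ^ k * R ^ F * (R ^ k * V) := by
    calc (4 * (k : ℝ) ^ 2 * c) ^ k * v ≤ (4 * (k : ℝ) ^ 2 * (3 * R)) ^ k * V := by gcongr
      _ = (12 * (k : ℝ) ^ 2) ^ k * 1 * (R ^ k * V) := by
        rw [show 4 * (k : ℝ) ^ 2 * (3 * R) = 12 * k ^ 2 * R by ring, mul_pow _ R]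
        ring
      _ ≤ _ := by gcongr
  have hmain : A * (B * R ^ f + D * R ^ F) * (R ^ k * V) ≤ A * (B + D) * R ^ F * (R ^ k * V) := by
    refine mul_le_mul_of_nonneg_right ?_ (by positivity)
    have := mul_le_mul_of_nonneg_left hfF (mul_nonneg hA0 hB0)
    linarith
  have hfin := mul_le_mul_of_nonneg_right hadd (by positivity : 0 ≤ R ^ F * (R ^ k * V))
  linarith

set_option maxHeartbeats 1000000 in
theorem mixed_le_of_vinogradov_le {k s r J : ℕ} (hk : 2 ≤ k) (hs : 1 ≤ s) (hr : 1 ≤ r)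
    (hJr : J ≤ r) (hJk : J ≤ k) {C μ E φ R x : ℝ} (hC : 0 ≤ C)
    (hE : E = 2 * s + (r * (r - 1) / 2 : ℕ) - μ) (hE0 : 0 ≤ E) (hErk : E ≤ r * k)
    (hφ : φ * (2 * r * k - E) = k) (hR : 1 ≤ R) (hx : x = R ^ φ) (hRx : R + 2 < x ^ (k + 1))
    {Q : Finset ℕ} (hQ : ∀ p ∈ Q, p.Prime ∧ k < p ∧ x ≤ p ∧ p ≤ 2 * x) (hQk : #Q = k ^ 3)
    (hV : ∀ X : ℝ, 1 ≤ X → ∀ n : ℕ, n ≤ X + 2 →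
      (vinogradov k s (progression 1 1 n) : ℝ) ≤ C * X ^ μ)
    (m : ℕ) : ∀ d, d + m = J → ∀ g : List ℤ, g.length = d →
      (∀ h ∈ g, 1 ≤ h ∧ (h : ℝ) ≤ R + 2) → ∀ I : Finset ℤ, (#I : ℝ) ≤ 3 * R →
      (∀ z ∈ I, ∀ w ∈ I, (z : ℝ) - w ≤ R + 2) → ∀ (a q : ℤ), q ≠ 0 → ∀ X : ℝ,
      (2 * x) ^ m ≤ X → ∀ n : ℕ, n ≤ X + 2 →
      (mixed k g I s (progression a q n) : ℝ) ≤ stepConst k J E *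
        R ^ (φ * E + (φ * (d ^ 2 + 3 * d + 4) + k / 2 ^ m)) * R ^ k * (C * X ^ μ) := by
  have hR0 : 0 < R := by linarith
  have hk0 : (0 : ℝ) < k := by exact_mod_cast (by omega : 0 < k)
  have hr0 : (1 : ℝ) ≤ r := by exact_mod_cast hr
  have hφ0 : 0 ≤ φ := by
    by_contra hneg
    push Not at hneg
    have : 0 < r * (k : ℝ) := by positivity
    nlinarith
  have hx1 : 1 ≤ x := by rw [hx]; exact Real.one_le_rpow hR hφ0
  have hΘ0 : 0 ≤ stepConst k J E := (by positivity : (0 : ℝ) ≤ 9 ^ k).trans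
    (nine_pow_le_stepConst (by omega) hE0)
  have hfirst : (12 * (k : ℝ) ^ 2) ^ k ≤ stepConst k J E :=
    le_trans (le_add_of_nonneg_right (by positivity)) (add_le_stepConst (by omega) hE0)
  have hVp : ∀ X : ℝ, 1 ≤ X → ∀ n : ℕ, n ≤ X + 2 → ∀ a q : ℤ, q ≠ 0 →
      (vinogradov k s (progression a q n) : ℝ) ≤ C * X ^ μ := fun X hX n hn a q hq =>
    le_trans (by exact_mod_cast vinogradov_progression_le hq n) (hV X hX n hn)
  induction m with
  | zero =>
    intro d hd g hg hgR I hIc hI a q hq X hX n hn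
    have hX1 : 1 ≤ X := by simpa using hX
    have h1 := hVp X hX1 n hn a q hq
    calc (mixed k g I s (progression a q n) : ℝ)
        ≤ #I ^ k * ((#I + 1) ^ k * vinogradov k s (progression a q n)) := by
          exact_mod_cast mixed_le_card_pow k g I s (progression a q n)
      _ ≤ (3 * R) ^ k * ((4 * R) ^ k * (C * X ^ μ)) := by
          gcongr
          linarith
      _ = 12 ^ k * R ^ k * R ^ k * (C * X ^ μ) := by
          rw [mul_pow, mul_pow, show (12 : ℝ) ^ k = 3 ^ k * 4 ^ k by rw [← mul_pow]; norm_num]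
          ring
      _ ≤ _ := by
          have h12 : (12 : ℝ) ^ k ≤ stepConst k J E :=
            le_trans (pow_le_pow_left₀ (by norm_num) (by
              have : (1 : ℝ) ≤ k := by exact_mod_cast (by omega : 1 ≤ k)
              nlinarith) k) hfirst
          have hRk : R ^ k ≤ R ^ (φ * E + (φ * (d ^ 2 + 3 * d + 4) + k / 2 ^ 0)) := by
            rw [← Real.rpow_natCast R k]
            refine Real.rpow_le_rpow_of_exponent_le hR ?_
            have : 0 ≤ φ * E + φ * ((d : ℝ) ^ 2 + 3 * d + 4) := by positivity
            simp only [pow_zero, div_one]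
            linarith
          gcongr
  | succ m ih =>
    intro d hd g hg hgR I hIc hI a q hq X hX n hn
    have hX1 : 1 ≤ X := le_trans (one_le_pow₀ (by linarith)) hX
    have hX0 : 0 < X := by linarith
    set Θ := stepConst k J E with hΘ
    set e' : ℝ := φ * (((d + 1 : ℕ) : ℝ) ^ 2 + 3 * ((d + 1 : ℕ) : ℝ) + 4) + k / 2 ^ m with he'
    set δ : ℝ := ((d * (d + 1) / 2 : ℕ) : ℝ) with hδ
    have hδeq : δ = d * (d + 1) / 2 := by
      rw [hδ, Nat.cast_div (Nat.even_mul_succ_self d).two_dvd (by norm_num)]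
      push_cast; ring
    set D : ℝ := k ^ (k + 3) * 12 ^ k * (2 ^ E * 2 ^ (J ^ 2) * R ^ (φ * E + φ * δ)
        + 2 ^ (J ^ 2) * √Θ * R ^ (φ * E + φ * δ + e' / 2)) * R ^ k * (C * X ^ μ) with hD
    have hD0 : 0 ≤ D := by positivity
    have hpool := mixed_le_of_pool (Q := Q) (x := x) (B := R + 2) hk (by linarith)
      (fun p hp => ⟨(hQ p hp).1, (hQ p hp).2.2.1⟩) hQk hRx hI (g := g) (by omega)
      (fun h hh => by have := (hgR h hh).1; omega)
      (fun h hh => by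
        have h1 : (1 : ℝ) ≤ h := by exact_mod_cast (hgR h hh).1
        rw [abs_of_nonneg (by linarith)]
        exact (hgR h hh).2)
      s (progression a q n) (U := D / (2 * k ^ 3)) (by positivity) ?_
    · refine hpool.trans ?_
      rw [mul_div_cancel₀ _ (by positivity)]
      set F := φ * E + (φ * ((d : ℝ) ^ 2 + 3 * d + 4) + k / 2 ^ (m + 1)) with hF
      have hF0 : 0 ≤ F := by positivity
      have hF1 : φ * E + φ * δ ≤ F := by
        have h1 : φ * δ ≤ φ * ((d : ℝ) ^ 2 + 3 * d + 4) := by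
          refine mul_le_mul_of_nonneg_left ?_ hφ0
          rw [hδeq]; nlinarith [(Nat.cast_nonneg d : (0 : ℝ) ≤ d)]
        have h2 : 0 ≤ (k : ℝ) / 2 ^ (m + 1) := by positivity
        rw [hF]; linarith
      have hF2 : φ * E + φ * δ + e' / 2 = F := by
        rw [hF, he', hδeq, pow_succ]; push_cast; field_simp; ring
      have hv := hVp X hX1 n hn a q hq
      rw [hD, hF2]
      exact differencing_total_le (by omega) hE0 hR hF0 hF1 (by positivity) hIc
        (by positivity) hv
    · intro p hpQ hpg
      obtain ⟨hp, hkp, hxp, hpx⟩ := hQ p hpQ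
      have hp0 : (0 : ℝ) < p := by exact_mod_cast hp.pos
      have hp2 : (2 : ℝ) ≤ p := by exact_mod_cast hp.two_le
      rw [le_div_iff₀ (by positivity), mul_comm]
      have hpr : (0 : ℝ) < (p : ℝ) ^ r := by positivity
      set H := ⌊(R + 2) / (p : ℝ) ^ r⌋₊ with hH
      have hHle : (H : ℝ) * p ^ r ≤ R + 2 := by
        rw [← le_div_iff₀ hpr]
        exact Nat.floor_le (by positivity)
      have hHlt : R + 2 < (H + 1) * (p : ℝ) ^ r := by
        rw [← div_lt_iff₀ hpr]
        exact Nat.lt_floor_add_one _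
      set n' := ⌈(n : ℝ) / p⌉₊ with hn'
      have hnn' : n ≤ n' * p := by
        have : (n : ℝ) ≤ n' * p := by
          rw [← div_le_iff₀ hp0]
          exact Nat.le_ceil _
        exact_mod_cast this
      have hXp : (2 * x) ^ m ≤ X / p := by
        rw [le_div_iff₀ hp0]
        calc (2 * x) ^ m * p ≤ (2 * x) ^ m * (2 * x) := by gcongr
          _ ≤ X := by rw [← pow_succ]; exact hX
      have hXp1 : 1 ≤ X / p := le_trans (one_le_pow₀ (by linarith)) hXp
      have hn'X : (n' : ℝ) ≤ X / p + 2 := by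
        have h1 : (n' : ℝ) < n / p + 1 := Nat.ceil_lt_add_one (by positivity)
        have h2 : (n : ℝ) / p ≤ X / p + 1 := by
          rw [div_add_one hp0.ne']
          gcongr
          linarith
        linarith
      set N := Θ * R ^ (φ * E + e') * R ^ k * (C * (X / p) ^ μ) with hN
      have hlev := mixedCount_distinct_le (k := k) (d := d) (r := r) (p := p) (H := H) (n := n)
        (n' := n') (by omega) hp hkp hr g hg (by omega) (by omega) hpg I
        (by
          intro z hz w hw
          have h1 := (hI z hz w hw).trans_lt hHlt
          exact_mod_cast h1)
        hs a hq hnn' N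
        (by
          intro h hh η hη
          rw [mem_Icc] at hh
          refine ih (d + 1) (by omega) _ (by simp [hg]) ?_ _ ?_ ?_ _ _
            (mul_ne_zero hq (by exact_mod_cast hp.ne_zero)) (X / p) hXp n' hn'X
          · intro b hb
            rw [List.mem_cons] at hb
            rcases hb with rfl | hb
            · constructor
              · have h1 : (1 : ℤ) ≤ h := by exact_mod_cast hh.1
                have h2 : (1 : ℤ) ≤ (p ^ r : ℕ) := by exact_mod_cast pow_pos hp.pos r
                nlinarith
              · push_cast
                refine le_trans ?_ hHle
                gcongr
                exact hh.2
            · exact hgR b hb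
          · refine le_trans ?_ hIc
            exact_mod_cast card_filter_le _ _
          · intro z hz w hw
            exact hI z (mem_filter.1 hz).1 w (mem_filter.1 hw).1)
      refine (mul_le_mul_of_nonneg_left hlev (by positivity)).trans ?_
      refine level_contribution_le (by omega) hR hC hX0 hx hxp hpx hE0 hErk hφ (by positivity)
        ?_ hΘ0 ?_ (by positivity) hIc (by positivity) (hV _ hXp1 _ hn'X) (by positivity) ?_ rfl
      · rw [hδeq]
        have h1 : (d : ℝ) + 1 ≤ J := by exact_mod_cast (by omega : d + 1 ≤ J)
        nlinarith [(Nat.cast_nonneg d : (0 : ℝ) ≤ d)]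
      · rw [hE]; push_cast; ring
      · rw [le_div_iff₀ hpr]
        linarith

end PowerSums

section PrimesInDyadicInterval

open Finset

theorem centralBinom_le_pow_card_primes {n : ℕ} (hn : 2 < n) :
    n.centralBinom ≤ (2 * n) ^ (Nat.sqrt (2 * n) + #{p ∈ Ioc n (2 * n) | p.Prime}) *
      4 ^ (2 * n / 3) := by
  set f : ℕ → ℕ := fun p => p ^ n.centralBinom.factorization p with hf
  have hprod : ∏ p ∈ range (2 * n + 1) with p.Prime, f p = n.centralBinom := by
    rw [← n.prod_pow_factorization_centralBinom]
    refine prod_filter_of_ne fun p _ h => ?_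
    contrapose h
    dsimp only [f]
    rw [Nat.factorization_eq_zero_of_not_prime n.centralBinom h, pow_zero]
  rw [← hprod, ← prod_filter_mul_prod_filter_not {p ∈ range (2 * n + 1) | p.Prime}
    (fun p => p ≤ Nat.sqrt (2 * n) ∨ n < p)]
  refine Nat.mul_le_mul ?_ ?_
  · refine (prod_le_prod' fun p _ => (Nat.pow_factorization_choose_le (by omega) :
      f p ≤ 2 * n)).trans ?_
    rw [prod_const]
    refine Nat.pow_le_pow_right (by omega) ?_
    have hsub : {p ∈ {p ∈ range (2 * n + 1) | p.Prime} | p ≤ Nat.sqrt (2 * n) ∨ n < p} ⊆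
        Icc 1 (Nat.sqrt (2 * n)) ∪ {p ∈ Ioc n (2 * n) | p.Prime} := by
      intro p hp
      simp only [mem_filter, mem_range] at hp
      obtain ⟨⟨hp1, hp2⟩, hp3 | hp3⟩ := hp
      · exact mem_union_left _ (mem_Icc.2 ⟨hp2.one_lt.le, hp3⟩)
      · exact mem_union_right _ (mem_filter.2 ⟨mem_Ioc.2 ⟨hp3, by omega⟩, hp2⟩)
    refine (card_le_card hsub).trans ((card_union_le _ _).trans ?_)
    simp
  · refine le_trans ?_ (primorial_le_four_pow (2 * n / 3))
    rw [primorial_eq_prod_primesLE]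
    have h1 : ∏ p ∈ {p ∈ range (2 * n + 1) | p.Prime} with ¬(p ≤ Nat.sqrt (2 * n) ∨ n < p), f p
        ≤ ∏ p ∈ {p ∈ range (2 * n + 1) | p.Prime} with ¬(p ≤ Nat.sqrt (2 * n) ∨ n < p),
          if p ∈ Nat.primesLE (2 * n / 3) then p else 1 := by
      refine prod_le_prod' fun p hp => ?_
      simp only [mem_filter, mem_range, not_or, not_le, not_lt] at hp
      obtain ⟨⟨hp1, hp2⟩, hp3, hp4⟩ := hp
      split_ifs with h
      · exact (Nat.pow_le_pow_right hp2.pos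
          (Nat.factorization_choose_le_one (Nat.sqrt_lt'.1 hp3))).trans (pow_one p).le
      · rw [Nat.mem_primesLE] at h
        have h3 : 2 * n < 3 * p := by
          have : ¬ p ≤ 2 * n / 3 := fun h' => h ⟨h', hp2⟩
          omega
        dsimp only [f]
        rw [Nat.factorization_centralBinom_of_two_mul_self_lt_three_mul hn hp4 h3, pow_zero]
    refine h1.trans ?_
    rw [prod_ite, prod_const_one, mul_one]
    refine prod_le_prod_of_subset_of_one_le' ?_ ?_
    · intro p hp
      exact (mem_filter.1 hp).2
    · intro p hp _
      exact (Nat.mem_primesLE.1 hp).2.one_lt.le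

theorem log_four_mul_lt {n : ℕ} (hn : 4 ≤ n) :
    (n : ℝ) / 3 * Real.log 4 ≤
      (Nat.sqrt (2 * n) + #{p ∈ Ioc n (2 * n) | p.Prime} + 1) * Real.log (2 * n) := by
  have h1 := (Nat.four_pow_lt_mul_centralBinom n hn).le.trans
    (Nat.mul_le_mul_left n (centralBinom_le_pow_card_primes (by omega : 2 < n)))
  set M := Nat.sqrt (2 * n) + #{p ∈ Ioc n (2 * n) | p.Prime} with hM
  have hn0 : (0 : ℝ) < n := by exact_mod_cast (by omega : 0 < n)
  have h2 : (4 : ℝ) ^ n ≤ n * ((2 * n) ^ M * 4 ^ (2 * n / 3)) := by exact_mod_cast h1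
  have h3 := Real.log_le_log (by positivity) h2
  rw [Real.log_mul hn0.ne' (by positivity), Real.log_mul (by positivity) (by positivity),
    Real.log_pow, Real.log_pow, Real.log_pow] at h3
  have h4 : Real.log n ≤ Real.log (2 * n) := Real.log_le_log hn0 (by linarith)
  have h5 : ((2 * n / 3 : ℕ) : ℝ) ≤ 2 * n / 3 := by
    refine Nat.cast_div_le.trans ?_
    push_cast; rfl
  have h6 : 0 ≤ Real.log 4 := Real.log_nonneg (by norm_num)
  have h7 := mul_le_mul_of_nonneg_right h5 h6
  have h8 : ((Nat.sqrt (2 * n) : ℝ) + #{p ∈ Ioc n (2 * n) | p.Prime}) = (M : ℝ) := by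
    rw [hM]; push_cast; rfl
  rw [h8]
  linarith

theorem exists_primes_dyadic {k : ℕ} (hk : 1000 ≤ k) {x : ℝ} (hx : (k : ℝ) ^ (3.65 : ℝ) ≤ x) :
    ∃ Q : Finset ℕ, (∀ p ∈ Q, p.Prime ∧ k < p ∧ x ≤ p ∧ p ≤ 2 * x) ∧ #Q = k ^ 3 := by
  have hkR : (1000 : ℝ) ≤ k := by exact_mod_cast hk
  have hx0 : 0 < x := lt_of_lt_of_le (by positivity) hx
  have hkx : (k : ℝ) * 1000 ≤ x := by
    refine le_trans ?_ hx
    calc (k : ℝ) * 1000 ≤ k ^ (2 : ℝ) := by rw [Real.rpow_two]; nlinarith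
      _ ≤ _ := Real.rpow_le_rpow_of_exponent_le (by linarith) (by norm_num)
  set w := x ^ (13 / 73 : ℝ) with hw
  have hw0 : 0 < w := by positivity
  have hw80 : 80 ≤ w := by
    calc (80 : ℝ) ≤ (1000 : ℝ) ^ (13 / 20 : ℝ) := by
          refine le_of_pow_le_pow_left₀ (n := 20) (by norm_num) (by positivity) ?_
          rw [← Real.rpow_natCast, ← Real.rpow_natCast, ← Real.rpow_mul (by norm_num)]
          norm_num
      _ ≤ (k : ℝ) ^ (13 / 20 : ℝ) := Real.rpow_le_rpow (by norm_num) hkR (by norm_num)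
      _ = ((k : ℝ) ^ (3.65 : ℝ)) ^ (13 / 73 : ℝ) := by
          rw [← Real.rpow_mul (by linarith)]; norm_num
      _ ≤ w := Real.rpow_le_rpow (by positivity) hx (by norm_num)
  have hk3 : (k : ℝ) ^ 3 * w ≤ x := by
    have h1 : (k : ℝ) ^ 3 ≤ x ^ (60 / 73 : ℝ) := by
      calc (k : ℝ) ^ 3 = ((k : ℝ) ^ (3.65 : ℝ)) ^ (60 / 73 : ℝ) := by
            rw [← Real.rpow_mul (by linarith), ← Real.rpow_natCast]; norm_num
        _ ≤ _ := Real.rpow_le_rpow (by positivity) hx (by norm_num)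
    calc (k : ℝ) ^ 3 * w ≤ x ^ (60 / 73 : ℝ) * w := by gcongr
      _ = x := by rw [hw, ← Real.rpow_add hx0]; norm_num
  have hsq : w ^ 2 ≤ √x := by
    rw [Real.sqrt_eq_rpow, hw, ← Real.rpow_natCast, ← Real.rpow_mul hx0.le]
    refine Real.rpow_le_rpow_of_exponent_le (by linarith) (by norm_num)
  set n := ⌊x⌋₊ with hn
  have hnx : (n : ℝ) ≤ x := Nat.floor_le hx0.le
  have hxn : x < n + 1 := Nat.lt_floor_add_one x
  have hn4 : 1000 * k ≤ n := Nat.le_floor (by push_cast; linarith)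
  have hn1 : (1000 : ℝ) * 1000 ≤ n := by
    exact_mod_cast (by omega : 1000 * 1000 ≤ n)
  have hmain := log_four_mul_lt (by omega : 4 ≤ n)
  have hcard : k ^ 3 ≤ #{p ∈ Ioc n (2 * n) | p.Prime} := by
    by_contra hlt
    push Not at hlt
    have hltR : (#{p ∈ Ioc n (2 * n) | p.Prime} : ℝ) + 1 ≤ k ^ 3 := by exact_mod_cast hlt
    have hsqrt : (Nat.sqrt (2 * n) : ℝ) ≤ 2 * √x := by
      refine Real.nat_sqrt_le_real_sqrt.trans ?_
      rw [Real.sqrt_le_left (by positivity), mul_pow, Real.sq_sqrt hx0.le]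
      push_cast
      linarith
    have hsx : √x * w ^ 2 ≤ x := by
      calc √x * w ^ 2 ≤ √x * √x := by gcongr
        _ = x := Real.mul_self_sqrt hx0.le
    have hcount : ((Nat.sqrt (2 * n) : ℝ) + #{p ∈ Ioc n (2 * n) | p.Prime} + 1) * w
        ≤ 1.04 * x := by
      have h1 : 80 * (√x * w) ≤ x := by
        calc 80 * (√x * w) ≤ w * (√x * w) := by gcongr
          _ = √x * w ^ 2 := by ring
          _ ≤ x := hsx
      have h2 : (Nat.sqrt (2 * n) : ℝ) * w ≤ 2 * √x * w := by gcongr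
      have h3 := mul_le_mul_of_nonneg_right hltR hw0.le
      nlinarith
    have hlog : Real.log (2 * n) ≤ 0.36 * w := by
      have h1 : Real.log (2 * n) ≤ Real.log 2 + Real.log x := by
        rw [← Real.log_mul (by norm_num) hx0.ne']
        exact Real.log_le_log (by positivity) (by linarith)
      have h2 : Real.log x = 73 / 13 * Real.log w := by
        rw [hw, Real.log_rpow hx0]; ring
      have h3 : Real.log w ≤ Real.log 128 + (w / 128 - 1) := by
        have := Real.log_le_sub_one_of_pos (by positivity : 0 < w / 128)
        rw [Real.log_div hw0.ne' (by norm_num)] at this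
        linarith
      have h4 : Real.log 128 = 7 * Real.log 2 := by
        rw [show (128 : ℝ) = 2 ^ 7 by norm_num, Real.log_pow]; norm_num
      have := Real.log_two_lt_d9
      linarith
    have hl4 : Real.log 4 = 2 * Real.log 2 := by
      rw [show (4 : ℝ) = 2 ^ 2 by norm_num, Real.log_pow]; norm_num
    have hl2 := Real.log_two_gt_d9
    have hfin : ((Nat.sqrt (2 * n) : ℝ) + #{p ∈ Ioc n (2 * n) | p.Prime} + 1) *
        Real.log (2 * n) ≤ 0.36 * (1.04 * x) := by
      refine (mul_le_mul_of_nonneg_left hlog (by positivity)).trans ?_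
      linarith
    have : (n : ℝ) / 3 * 1.386 ≤ n / 3 * Real.log 4 := by
      refine mul_le_mul_of_nonneg_left ?_ (by positivity)
      linarith
    linarith
  obtain ⟨Q, hQ, hQc⟩ := exists_subset_card_eq hcard
  refine ⟨Q, fun p hp => ?_, hQc⟩
  obtain ⟨hp1, hp2⟩ := mem_filter.1 (hQ hp)
  rw [mem_Ioc] at hp1
  have h1 : (n : ℝ) + 1 ≤ p := by exact_mod_cast hp1.1
  have h2 : (p : ℝ) ≤ 2 * n := by exact_mod_cast hp1.2
  exact ⟨hp2, by omega, by linarith, by linarith⟩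

end PrimesInDyadicInterval

namespace PowerSums

open Finset

theorem vinogradov_le_card_pow (k s : ℕ) (Y : Finset ℤ) : vinogradov k s Y ≤ #Y ^ (2 * s) := by
  refine (card_filter_le _ _).trans ?_
  rw [card_product, Fintype.card_piFinset, prod_const, card_univ, Fintype.card_fin, ← pow_add,
    two_mul]

theorem vinogradov_add_le_mixed (k s : ℕ) (Y : Finset ℤ) :
    vinogradov k (s + k) Y ≤ mixed k [] Y s Y := by
  unfold vinogradov mixed mixedCount
  refine pairCount_le_of_map (fun y => (fun i => y (Fin.natAdd s i), fun i => y (Fin.castAdd k i)))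
    ?_ ?_ ?_
  · intro y hy
    rw [Fintype.mem_piFinset] at hy
    exact mem_product.2 ⟨Fintype.mem_piFinset.2 fun i => hy _, Fintype.mem_piFinset.2 fun i => hy _⟩
  · intro y _ y' _ h
    rw [Prod.mk.injEq] at h
    funext i
    refine Fin.addCases (fun i => ?_) (fun i => ?_) i
    · exact congrFun h.2 i
    · exact congrFun h.1 i
  · intro y _ y' _ h
    unfold tupleSum at h ⊢
    rw [Fin.sum_univ_add, Fin.sum_univ_add] at h
    rw [add_comm, h, add_comm]

theorem card_progression_le (a q : ℤ) (n : ℕ) : #(progression a q n) ≤ n :=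
  card_image_le.trans (by simp)

/-- The mean value bound with constant `C` and exponent excess `Δ`. The range `n ≤ X + 2` leaves
room for rounding. -/
def MeanValueBound (k s : ℕ) (C Δ : ℝ) : Prop :=
  ∀ X : ℝ, 1 ≤ X → ∀ n : ℕ, n ≤ X + 2 →
    (vinogradov k s (progression 1 1 n) : ℝ) ≤ C * X ^ (2 * (s : ℝ) - k * (k + 1) / 2 + Δ)

theorem card_pow_le {X : ℝ} (hX : 1 ≤ X) {n : ℕ} (hn : n ≤ X + 2) (k s : ℕ) :
    (vinogradov k s (progression 1 1 n) : ℝ) ≤ 3 ^ (2 * s) * X ^ (2 * (s : ℝ)) := by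
  have h1 : vinogradov k s (progression 1 1 n) ≤ n ^ (2 * s) :=
    (vinogradov_le_card_pow k s _).trans (Nat.pow_le_pow_left (card_progression_le 1 1 n) _)
  calc (vinogradov k s (progression 1 1 n) : ℝ) ≤ n ^ (2 * s) := by exact_mod_cast h1
    _ ≤ (3 * X) ^ (2 * s) := by gcongr; linarith
    _ = _ := by
      rw [mul_pow, ← Real.rpow_natCast X]; push_cast; rfl

theorem meanValueBound_trivial (k s : ℕ) :
    MeanValueBound k s (3 ^ (2 * s)) (k * (k + 1) / 2) := by
  intro X hX n hn
  refine (card_pow_le hX hn k s).trans (le_of_eq ?_)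
  congr 2; ring

theorem stepConst_mono {k J : ℕ} {E E' : ℝ} (h : E ≤ E') : stepConst k J E ≤ stepConst k J E' := by
  unfold stepConst
  have : (2 : ℝ) ^ E ≤ 2 ^ E' := Real.rpow_le_rpow_of_exponent_le (by norm_num) h
  gcongr

set_option maxHeartbeats 1000000 in
theorem MeanValueBound.step {k s m J : ℕ} (hk : 1000 ≤ k) (hs : 1 ≤ s) (hmk : m < k)
    (hJ : 1 ≤ J) (hJm : J ≤ k - m) {C Δ N φ : ℝ} (hC : 0 ≤ C) (h : MeanValueBound k s C Δ)
    (hN : N = Δ - ((m : ℝ) ^ 2 + m) / 2) (hN0 : 0 ≤ N) (hNle : N ≤ (k : ℝ) ^ 2 - k * m)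
    (hNm : N ≤ k * m) (hφ : φ * ((k : ℝ) ^ 2 - k * m + N) = k) (hφJ : J * φ ≤ 1 / 2) :
    MeanValueBound k (s + k)
      (max (3 ^ (2 * (s + k)) * (k : ℝ) ^ (3.65 * k * (k * (k + 1) / 2) : ℝ))
        (stepConst k J ((k : ℝ) ^ 2) * C))
      (Δ - φ * (2 * N - 4) + k / 2 ^ J) := by
  have hkR : (1000 : ℝ) ≤ k := by exact_mod_cast hk
  have hmR : (m : ℝ) + 1 ≤ k := by exact_mod_cast hmk
  have hm0 : (0 : ℝ) ≤ m := Nat.cast_nonneg m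
  have hJ1 : (1 : ℝ) ≤ J := by exact_mod_cast hJ
  have hden : 0 < (k : ℝ) ^ 2 - k * m + N := by nlinarith
  have hφ0 : 0 < φ := by
    by_contra hneg
    push Not at hneg
    nlinarith
  have hφk : 1 ≤ φ * k := by
    have h1 : (k : ℝ) ^ 2 - k * m + N ≤ k ^ 2 := by linarith
    have h2 := mul_le_mul_of_nonneg_left h1 hφ0.le
    rw [hφ] at h2
    nlinarith
  have hφ2 : φ ≤ 1 / 2 := by nlinarith
  intro X hX n hn
  have hX0 : 0 < X := by linarith
  set Δ' := Δ - φ * (2 * N - 4) + k / 2 ^ J with hΔ'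
  have hΔ'0 : 0 ≤ Δ' := by
    have : 0 ≤ (k : ℝ) / 2 ^ J := by positivity
    nlinarith
  set R₀ : ℝ := (k : ℝ) ^ (3.65 * k : ℝ) with hR₀
  rcases lt_or_ge X R₀ with hXR | hXR
  · have h1 := card_pow_le hX hn k (s + k)
    calc (vinogradov k (s + k) (progression 1 1 n) : ℝ)
        ≤ 3 ^ (2 * (s + k)) * X ^ (2 * ((s + k : ℕ) : ℝ)) := h1
      _ = 3 ^ (2 * (s + k)) * X ^ ((k : ℝ) * (k + 1) / 2 - Δ') *
            X ^ (2 * ((s + k : ℕ) : ℝ) - k * (k + 1) / 2 + Δ') := by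
          rw [mul_assoc, ← Real.rpow_add hX0]; congr 2; ring
      _ ≤ 3 ^ (2 * (s + k)) * (k : ℝ) ^ (3.65 * k * (k * (k + 1) / 2) : ℝ) *
            X ^ (2 * ((s + k : ℕ) : ℝ) - k * (k + 1) / 2 + Δ') := by
          have h2 : X ^ ((k : ℝ) * (k + 1) / 2 - Δ') ≤
              (k : ℝ) ^ (3.65 * k * (k * (k + 1) / 2) : ℝ) := by
            calc X ^ ((k : ℝ) * (k + 1) / 2 - Δ') ≤ X ^ ((k : ℝ) * (k + 1) / 2) :=
                  Real.rpow_le_rpow_of_exponent_le hX (by linarith)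
              _ ≤ R₀ ^ ((k : ℝ) * (k + 1) / 2) := Real.rpow_le_rpow hX0.le hXR.le (by positivity)
              _ = _ := by rw [hR₀, ← Real.rpow_mul (by linarith)]
          gcongr
      _ ≤ _ := by
          refine mul_le_mul_of_nonneg_right (le_max_left _ _) (by positivity)
  · obtain ⟨r, hr⟩ : ∃ r, r = k - m := ⟨_, rfl⟩
    have hrR : (r : ℝ) = k - m := by rw [hr, Nat.cast_sub hmk.le]
    set E := (k : ℝ) ^ 2 - k * m - N with hE
    set x := X ^ φ with hx
    have hx1 : (k : ℝ) ^ (3.65 : ℝ) ≤ x := by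
      calc (k : ℝ) ^ (3.65 : ℝ) ≤ (k : ℝ) ^ (3.65 * k * φ : ℝ) := by
            refine Real.rpow_le_rpow_of_exponent_le (by linarith) ?_
            nlinarith
        _ = R₀ ^ φ := by rw [hR₀, ← Real.rpow_mul (by linarith)]
        _ ≤ x := Real.rpow_le_rpow (by positivity) hXR hφ0.le
    obtain ⟨Q, hQ, hQk⟩ := exists_primes_dyadic hk hx1
    have hkx : (k : ℝ) ≤ x := by
      refine le_trans ?_ hx1
      calc (k : ℝ) = k ^ (1 : ℝ) := (Real.rpow_one _).symm
        _ ≤ _ := Real.rpow_le_rpow_of_exponent_le (by linarith) (by norm_num)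
    have hXx : X + 2 < x ^ (k + 1) := by
      have h1 : X ≤ x ^ k := by
        rw [hx, ← Real.rpow_natCast, ← Real.rpow_mul hX0.le]
        calc X = X ^ (1 : ℝ) := (Real.rpow_one _).symm
          _ ≤ _ := Real.rpow_le_rpow_of_exponent_le hX hφk
      rw [pow_succ]
      nlinarith
    have hXJ : (2 * x) ^ J ≤ X := by
      have h1 : x ^ J ≤ X ^ (1 / 2 : ℝ) := by
        rw [hx, ← Real.rpow_natCast, ← Real.rpow_mul hX0.le]
        exact Real.rpow_le_rpow_of_exponent_le hX (by linarith)
      have h2 : (2 : ℝ) ^ J ≤ X ^ (1 / 2 : ℝ) := by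
        calc (2 : ℝ) ^ J ≤ (k : ℝ) ^ J := by gcongr; linarith
          _ ≤ (k : ℝ) ^ k := pow_le_pow_right₀ (by linarith) (by omega)
          _ ≤ R₀ ^ (1 / 2 : ℝ) := by
            rw [hR₀, ← Real.rpow_mul (by linarith), ← Real.rpow_natCast]
            exact Real.rpow_le_rpow_of_exponent_le (by linarith) (by linarith)
          _ ≤ _ := Real.rpow_le_rpow (by positivity) hXR (by norm_num)
      calc (2 * x) ^ J = 2 ^ J * x ^ J := mul_pow _ _ _
        _ ≤ X ^ (1 / 2 : ℝ) * X ^ (1 / 2 : ℝ) := by gcongr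
        _ = X := by rw [← Real.rpow_add hX0]; norm_num
    have hcard : (#(progression 1 1 n) : ℝ) ≤ 3 * X := by
      have : (#(progression 1 1 n) : ℝ) ≤ n := by exact_mod_cast card_progression_le 1 1 n
      linarith
    have hdiff : ∀ z ∈ progression 1 1 n, ∀ w ∈ progression 1 1 n, (z : ℝ) - w ≤ X + 2 := by
      intro z hz w hw
      obtain ⟨i, hi, rfl⟩ := mem_image.1 hz
      obtain ⟨j, hj, rfl⟩ := mem_image.1 hw
      have hi' : (i : ℝ) ≤ n := by exact_mod_cast (mem_range.1 hi).le
      have hj' : (0 : ℝ) ≤ j := Nat.cast_nonneg j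
      push_cast
      linarith
    have hrr : ((r * (r - 1) / 2 : ℕ) : ℝ) = (r : ℝ) * (r - 1) / 2 := by
      rw [Nat.cast_div (Nat.even_mul_pred_self r).two_dvd (by norm_num), Nat.cast_mul,
        Nat.cast_pred (by omega)]
      norm_num
    have hfinal := mixed_le_of_vinogradov_le (k := k) (s := s) (r := r) (J := J) (by omega) hs
      (by omega) (by omega) (by omega) (C := C)
      (μ := 2 * (s : ℝ) - k * (k + 1) / 2 + Δ) (E := E) (φ := φ) (R := X) (x := x) hC
      (by rw [hrr, hrR, hE, hN]; ring) (by rw [hE]; linarith)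
      (by rw [hrR, hE]; nlinarith) (by rw [hrR, hE]; linear_combination hφ) hX hx hXx hQ hQk h J 0
      (by omega) [] rfl (by simp) (progression 1 1 n) hcard hdiff 1 1 one_ne_zero X hXJ n hn
    have hΘ : 0 ≤ stepConst k J E := by unfold stepConst; positivity
    calc (vinogradov k (s + k) (progression 1 1 n) : ℝ)
        ≤ mixed k [] (progression 1 1 n) s (progression 1 1 n) := by
          exact_mod_cast vinogradov_add_le_mixed k s (progression 1 1 n)
      _ ≤ _ := hfinal
      _ = stepConst k J E * C * X ^ (2 * ((s + k : ℕ) : ℝ) - k * (k + 1) / 2 + Δ') := by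
          have h1 : 2 * ((s + k : ℕ) : ℝ) - k * (k + 1) / 2 + Δ' =
              (φ * E + (φ * (((0 : ℕ) : ℝ) ^ 2 + 3 * ((0 : ℕ) : ℝ) + 4) + k / 2 ^ J)) + k +
                (2 * (s : ℝ) - k * (k + 1) / 2 + Δ) := by
            rw [hΔ', hE]; push_cast
            linear_combination -hφ
          rw [h1, Real.rpow_add hX0 _ (2 * (s : ℝ) - k * (k + 1) / 2 + Δ),
            Real.rpow_add hX0 _ (k : ℝ), Real.rpow_natCast]
          ring
      _ ≤ _ := by
          refine mul_le_mul_of_nonneg_right (le_trans ?_ (le_max_right _ _)) (by positivity)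
          refine mul_le_mul_of_nonneg_right (stepConst_mono ?_) hC
          rw [hE]; nlinarith

end PowerSums

namespace PowerSums

theorem decrement_poly_nonneg {ε y : ℝ} (hε : 0 < ε) (hε' : ε ≤ 1 / 1000) (hy : 0 ≤ y)
    (hy' : y ≤ 0.8) :
    0 ≤ (1 - 0.98 * y ^ 2) * (ε * (y * (1 - y)) / 2 - 1.5 * ε * y + ε ^ 2 * (1.96 - 5 * y)) +
      (0.02 * y ^ 2 + ε * (1 + 1.5 * y)) * (y * (1 - y) * (1 - ε / 2)) - ε * y ^ 2 := by
  have key : (1 - 0.98 * y ^ 2) * (ε * (y * (1 - y)) / 2 - 1.5 * ε * y + ε ^ 2 * (1.96 - 5 * y)) +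
      (0.02 * y ^ 2 + ε * (1 + 1.5 * y)) * (y * (1 - y) * (1 - ε / 2)) - ε * y ^ 2 =
      y ^ 2 * (0.02 * (y * (1 - y)) * (1 - ε / 2) - ε * (1 + 0.52 * y - 0.49 * y ^ 2)) +
      ε ^ 2 * ((1 - 0.98 * y ^ 2) * (1.96 - 5 * y) - (1 + 1.5 * y) * (y * (1 - y)) / 2) := by ring
  rw [key]
  rcases le_or_gt y 0.1 with h | h
  · have h1 : 1.35 ≤ (1 - 0.98 * y ^ 2) * (1.96 - 5 * y) - (1 + 1.5 * y) * (y * (1 - y)) / 2 := by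
      nlinarith [mul_nonneg hy hy, mul_nonneg hy (mul_nonneg hy hy)]
    have h2 : 0.0178 * y ≤ 0.02 * (y * (1 - y)) * (1 - ε / 2) := by
      have : 0.9 * y ≤ y * (1 - y) := by nlinarith
      nlinarith
    have h3 : ε * (1 + 0.52 * y - 0.49 * y ^ 2) ≤ 1.052 * ε := by nlinarith [mul_nonneg hy hy]
    have h4 := mul_le_mul_of_nonneg_left h1 (sq_nonneg ε)
    have h5 : y ^ 2 * (0.0178 * y - 1.052 * ε) ≤
        y ^ 2 * (0.02 * (y * (1 - y)) * (1 - ε / 2) - ε * (1 + 0.52 * y - 0.49 * y ^ 2)) := by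
      refine mul_le_mul_of_nonneg_left ?_ (sq_nonneg y)
      linarith
    have h6 : 0 ≤ (y - 39.5 * ε) ^ 2 * (y + 39.5 * ε / 2) := by positivity
    have h7 : ε ^ 3 ≤ ε ^ 2 / 1000 := by nlinarith [sq_nonneg ε]
    have h8 : 0 ≤ ε * y ^ 2 := by positivity
    nlinarith
  · have h1 : -2 ≤ (1 - 0.98 * y ^ 2) * (1.96 - 5 * y) - (1 + 1.5 * y) * (y * (1 - y)) / 2 := by
      nlinarith [mul_nonneg hy hy, mul_nonneg hy (mul_nonneg hy hy)]
    have h2 : 0.0017 ≤ 0.02 * (y * (1 - y)) * (1 - ε / 2) := by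
      have : 0.09 ≤ y * (1 - y) := by nlinarith
      nlinarith
    have h3 : ε * (1 + 0.52 * y - 0.49 * y ^ 2) ≤ 0.0012 := by
      have : 1 + 0.52 * y - 0.49 * y ^ 2 ≤ 1.2 := by nlinarith [sq_nonneg (y - 0.5)]
      have h0 : 0 ≤ 1 + 0.52 * y - 0.49 * y ^ 2 := by nlinarith
      nlinarith
    have h4 : ε ^ 2 ≤ 1 / 1000000 := by nlinarith
    have h5 : 0.01 ≤ y ^ 2 := by nlinarith
    nlinarith [mul_le_mul_of_nonneg_left h1 (sq_nonneg ε)]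

/-- The comparison at the largest admissible rounding. -/
theorem decrement_rounding_extreme {ε y A D h : ℝ} (hε : 0 < ε) (hε' : ε ≤ 1 / 1000) (hy : 0 ≤ y)
    (hy' : y ≤ 0.8)
    (hA : y * (1 - y) - 1.5 * ε * y + ε ^ 2 * (1.992 - 5 * y) ≤ A)
    (hD : D ≤ 1 - y ^ 2 - ε * (1 + 1.5 * y))
    (hh : h * (1 - 0.98 * y ^ 2) = 2 * y * (1 - ε / 2)) :
    (h * (1 - y) + ε * h ^ 2 / 2 + ε ^ 2 / 16) * D ≤ 2 * A := by
  set σ := 1 - 0.98 * y ^ 2 with hσ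
  have hσ0 : 0.3 ≤ σ := by nlinarith
  have hσp : 0 < σ := by linarith
  have hhv : h = 2 * y * (1 - ε / 2) / σ := by rw [eq_div_iff hσp.ne', hh]
  have hh0 : 0 ≤ h := by
    rw [hhv]
    have : 0 ≤ 1 - ε / 2 := by linarith
    positivity
  have hhy : h * σ ≤ 2 * y := by rw [hh]; nlinarith
  set D₂ := 1 - y ^ 2 - ε * (1 + 1.5 * y) with hD₂
  have hD₂σ : D₂ ≤ σ := by rw [hD₂, hσ]; nlinarith
  have hD₂1 : D₂ ≤ 1 := by nlinarith
  have hpoly := decrement_poly_nonneg hε hε' hy hy'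
  have h1y : 0 ≤ 1 - y := by linarith
  have hstep : (h * (1 - y) + ε * h ^ 2 / 2 + ε ^ 2 / 16) * D ≤
      h * (1 - y) * D₂ + ε * h ^ 2 / 2 * σ + ε ^ 2 / 16 := by
    have h1 : h * (1 - y) * D ≤ h * (1 - y) * D₂ := by gcongr
    have h2 : ε * h ^ 2 / 2 * D ≤ ε * h ^ 2 / 2 * σ := by gcongr; linarith
    have h3 : ε ^ 2 / 16 * D ≤ ε ^ 2 / 16 * 1 := by gcongr; linarith
    linarith
  refine hstep.trans ?_
  refine le_of_mul_le_mul_right ?_ hσp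
  have e1 : h * (1 - y) * D₂ * σ = 2 * y * (1 - ε / 2) * ((1 - y) * D₂) := by
    rw [← hh]; ring
  have e2 : ε * h ^ 2 / 2 * σ * σ ≤ 2 * ε * y ^ 2 := by
    have : (h * σ) ^ 2 ≤ (2 * y) ^ 2 := pow_le_pow_left₀ (by positivity) hhy 2
    calc ε * h ^ 2 / 2 * σ * σ = ε / 2 * (h * σ) ^ 2 := by ring
      _ ≤ ε / 2 * (2 * y) ^ 2 := by gcongr
      _ = _ := by ring
  have e3 : 2 * (y * (1 - y) - 1.5 * ε * y + ε ^ 2 * (1.992 - 5 * y)) * σ ≤ 2 * A * σ := by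
    gcongr
  have hDσ : D₂ = σ - (0.02 * y ^ 2 + ε * (1 + 1.5 * y)) := by rw [hD₂, hσ]; ring
  have e4 : 0 ≤ ε ^ 2 * σ := by positivity
  have e5 : 2 * y * (1 - ε / 2) * ((1 - y) * D₂) = 2 * (y * (1 - y) * (1 - ε / 2)) * σ -
      2 * ((0.02 * y ^ 2 + ε * (1 + 1.5 * y)) * (y * (1 - y) * (1 - ε / 2))) := by
    rw [hDσ]; ring
  have e6 : 2 * (y * (1 - y) * (1 - ε / 2)) * σ + 2 * ε * y ^ 2 + ε ^ 2 / 16 * σ -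
      2 * ((0.02 * y ^ 2 + ε * (1 + 1.5 * y)) * (y * (1 - y) * (1 - ε / 2))) ≤
      2 * (y * (1 - y) - 1.5 * ε * y + ε ^ 2 * (1.992 - 5 * y)) * σ := by
    rw [← hσ] at hpoly
    linarith
  linarith

theorem extreme_numerator_bounds {ε y N : ℝ} (hε : 0 < ε) (hε' : ε ≤ 1 / 1000) (hy : 0 ≤ y)
    (hN : N = y * (1 - y) + 5 * ε ^ 2 - ε * (y * (1 + 5 * ε) + y / 2)
      - ε ^ 2 * ((1 + 5 * ε) ^ 2 + (1 + 5 * ε)) / 2) :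
    y * (1 - y) - 1.5 * ε * y + ε ^ 2 * (1.992 - 5 * y) ≤ N - 2 * ε ^ 2 ∧
      N - 2 * ε ^ 2 ≤ y * (1 - y) - 1.5 * ε * y + 2 * ε ^ 2 := by
  have h2 : 0 < ε ^ 2 := by positivity
  have h3 : ε ^ 3 ≤ ε ^ 2 / 1000 := by nlinarith
  have h3' : 0 ≤ ε ^ 3 := by positivity
  have h4 : ε ^ 4 ≤ ε ^ 3 / 1000 := by nlinarith
  have h4' : 0 ≤ ε ^ 4 := by positivity
  have h5 : 0 ≤ ε ^ 2 * y := by positivity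
  rw [hN]
  constructor <;> linarith

theorem rounding_comparison {ε y Q M D : ℝ} (hε : 0 < ε) (hε' : ε ≤ 1 / 1000)
    (hy' : y ≤ 0.8) (hQ : y + ε ≤ Q) (hM : M ≤ y * (1 - y) - 1.5 * ε * y + 2 * ε ^ 2)
    (hD : D = 1 - y - ε - 3 * ε ^ 2) : M ≤ Q * D := by
  have hε2' : 0 < ε ^ 2 := by positivity
  have hε2 : ε ^ 2 ≤ ε / 1000 := by nlinarith
  have hD0 : 0 ≤ D := by rw [hD]; linarith
  refine le_trans ?_ (mul_le_mul_of_nonneg_right hQ hD0)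
  have h1 : ε ^ 3 ≤ ε ^ 2 / 1000 := by nlinarith
  have h2 : ε * y ≤ 0.8 * ε := by nlinarith
  have h3 : ε ^ 2 * y ≤ ε ^ 2 := by nlinarith
  rw [hD]
  linarith

theorem numerator_bounds {ε y τ N : ℝ} (hε : 0 < ε) (hε' : ε ≤ 1 / 1000) (hy : 0 ≤ y)
    (hy' : y ≤ 0.8) (hτ : 5 * ε ≤ τ) (hτ' : τ ≤ 1 + 5 * ε)
    (hN : N = y * (1 - y) + 5 * ε ^ 2 - ε * (y * τ + y / 2) - ε ^ 2 * (τ ^ 2 + τ) / 2) :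
    N ≤ 1 - y - ε * τ ∧ N ≤ y + ε * τ := by
  have hτ0 : 0 < τ := by linarith
  have h0 : ε * τ ≤ 1 / 1000 * 1.005 := mul_le_mul hε' (by linarith) hτ0.le (by norm_num)
  have h0' : ε * (5 * ε) ≤ ε * τ := mul_le_mul_of_nonneg_left hτ hε.le
  have h1 : 0 ≤ ε * (y * τ + y / 2) := by positivity
  have h2 : 0 ≤ ε ^ 2 * (τ ^ 2 + τ) / 2 := by positivity
  have h3 : 0.2 ^ 2 ≤ (1 - y) ^ 2 := pow_le_pow_left₀ (by norm_num) (by linarith) 2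
  have h4 : 0 ≤ y ^ 2 := by positivity
  have h5 : ε ^ 2 ≤ (1 / 1000) ^ 2 := pow_le_pow_left₀ hε.le hε' 2
  rw [hN]
  constructor <;> linarith

theorem decrement_rounding {ε y τ N D h : ℝ} (hε : 0 < ε) (hε' : ε ≤ 1 / 1000) (hy : 0 ≤ y)
    (hy' : y ≤ 0.8) (hτ : 5 * ε ≤ τ) (hτ' : τ ≤ 1 + 5 * ε)
    (hN : N = y * (1 - y) + 5 * ε ^ 2 - ε * (y * τ + y / 2) - ε ^ 2 * (τ ^ 2 + τ) / 2)
    (hD : D = 1 - y - ε * τ + N) (hh : h * (1 - 0.98 * y ^ 2) = 2 * y * (1 - ε / 2)) :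
    0.34 ≤ D ∧ 0 ≤ N ∧ N ≤ 1 - y - ε * τ ∧ N ≤ y + ε * τ ∧
      (h * (1 - y) + ε * h ^ 2 / 2 + ε ^ 2 / 16) * D ≤ 2 * N - 4 * ε ^ 2 := by
  have hε2 : ε ^ 2 ≤ ε / 1000 := by nlinarith
  have hε2' : 0 < ε ^ 2 := by positivity
  have hτ0 : 0 < τ := by linarith
  have hτ2 : τ ≤ 1.005 := by linarith
  have hεy : 0 ≤ ε * y := by positivity
  obtain ⟨N₁, hN₁⟩ : ∃ N₁ : ℝ, N₁ = y * (1 - y) + 5 * ε ^ 2 - ε * (y * (1 + 5 * ε) + y / 2)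
    - ε ^ 2 * ((1 + 5 * ε) ^ 2 + (1 + 5 * ε)) / 2 := ⟨_, rfl⟩
  obtain ⟨Q, hQ⟩ : ∃ Q : ℝ, Q = y + ε * (1 + τ + (1 + 5 * ε)) / 2 := ⟨_, rfl⟩
  have hNN₁ : N = N₁ + ε * (1 + 5 * ε - τ) * Q := by rw [hN, hN₁, hQ]; ring
  have hQ0 : y + ε ≤ Q := by rw [hQ]; nlinarith
  have hdev : 0 ≤ ε * (1 + 5 * ε - τ) := mul_nonneg hε.le (by linarith)
  obtain ⟨hA, hA1⟩ := extreme_numerator_bounds hε hε' hy hN₁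
  have hyy : y ^ 2 ≤ 0.8 * y := by nlinarith
  have hεy1 : ε * y ≤ 0.001 * y := by nlinarith
  have hεy2 : ε * y ≤ 0.8 * ε := by nlinarith
  have hεy3 : ε ^ 2 * y ≤ 0.001 * (ε * y) := by nlinarith
  have hεy4 : 0 ≤ ε ^ 2 * y := by positivity
  have hA0 : 0 ≤ N₁ - 2 * ε ^ 2 := by
    refine le_trans ?_ hA
    linarith
  have hNle : N₁ ≤ N := by
    rw [hNN₁]
    have : 0 ≤ ε * (1 + 5 * ε - τ) * Q := mul_nonneg hdev (by linarith)
    linarith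
  have hN0 : 0 ≤ N := by linarith
  obtain ⟨D₁, hD₁⟩ : ∃ D₁ : ℝ, D₁ = 1 - y - ε * (1 + 5 * ε) + N₁ := ⟨_, rfl⟩
  have hDD₁ : D = D₁ + ε * (1 + 5 * ε - τ) * (1 + Q) := by rw [hD, hD₁, hNN₁]; ring
  have hD₁low : 0.34 ≤ D₁ := by
    rw [hD₁]
    linarith
  have hDle : D₁ ≤ D := by
    rw [hDD₁]
    have : 0 ≤ ε * (1 + 5 * ε - τ) * (1 + Q) := mul_nonneg hdev (by linarith)
    linarith
  have hD₁up : D₁ ≤ 1 - y ^ 2 - ε * (1 + 1.5 * y) := by rw [hD₁]; linarith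
  have hext := decrement_rounding_extreme hε hε' hy hy' hA hD₁up hh
  have hmono : (N₁ - 2 * ε ^ 2) * D ≤ (N - 2 * ε ^ 2) * D₁ := by
    have h1 : N₁ - 2 * ε ^ 2 ≤ Q * (D₁ - (N₁ - 2 * ε ^ 2)) := by
      exact rounding_comparison hε hε' hy' hQ0 hA1 (by rw [hD₁]; ring)
    have h3 : 0 ≤ ε * (1 + 5 * ε - τ) * (Q * (D₁ - (N₁ - 2 * ε ^ 2)) - (N₁ - 2 * ε ^ 2)) :=
      mul_nonneg hdev (by linarith)
    rw [hNN₁, hDD₁]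
    linarith
  obtain ⟨hb, hb'⟩ := numerator_bounds hε hε' hy hy' hτ hτ' hN
  refine ⟨by linarith, hN0, hb, hb', ?_⟩
  · refine le_of_mul_le_mul_right ?_ (by linarith : 0 < D₁)
    have := mul_le_mul_of_nonneg_right hext (by linarith : 0 ≤ D)
    linarith

theorem exists_depth {k : ℕ} (hk : 1000 ≤ k) :
    ∃ J : ℕ, 1 ≤ J ∧ 16 * k ^ 2 ≤ 2 ^ J ∧ 100 * J ≤ 3 * k := by
  refine ⟨Nat.clog 2 (16 * k ^ 2), Nat.clog_pos one_lt_two (by nlinarith),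
    Nat.le_pow_clog one_lt_two _, ?_⟩
  by_contra hlt
  push Not at hlt
  set J := Nat.clog 2 (16 * k ^ 2) with hJ
  have h1 : 2 ^ (J - 1) < 16 * k ^ 2 := Nat.pow_pred_clog_lt_self one_lt_two (by nlinarith)
  have h2 : ∀ i : ℕ, 18000 * (i + 31) ^ 2 ≤ 2 ^ (i + 30) := by
    intro i
    induction i with
    | zero => norm_num
    | succ i ih =>
      calc 18000 * (i + 1 + 31) ^ 2 ≤ 2 * (18000 * (i + 31) ^ 2) := by
            nlinarith [Nat.zero_le i, Nat.zero_le (i ^ 2)]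
        _ ≤ 2 * 2 ^ (i + 30) := Nat.mul_le_mul_left 2 ih
        _ = 2 ^ (i + 1 + 30) := by rw [← pow_succ']
  obtain ⟨i, hi⟩ : ∃ i, J = i + 31 := ⟨J - 31, by omega⟩
  have h3 := h2 i
  rw [hi] at h1 hlt
  rw [show i + 31 - 1 = i + 30 by omega] at h1
  nlinarith

theorem MeanValueBound.mono {k s : ℕ} {C C' Δ Δ' : ℝ} (h : MeanValueBound k s C Δ) (hC : C ≤ C')
    (hC' : 0 ≤ C') (hΔ : Δ ≤ Δ') : MeanValueBound k s C' Δ' := by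
  intro X hX n hn
  refine (h X hX n hn).trans (mul_le_mul hC ?_ (by positivity) hC')
  exact Real.rpow_le_rpow_of_exponent_le hX (by linarith)

/-- The bound after `n` differencing steps, with the accumulated constant. -/
def StepBound (k s J n : ℕ) (Δ : ℝ) : Prop :=
  MeanValueBound k (s + n * k) (3 ^ (2 * (s + n * k)) *
    (k : ℝ) ^ (3.65 * k * (k * (k + 1) / 2) : ℝ) * stepConst k J ((k : ℝ) ^ 2) ^ n) Δ

theorem stepConst_nonneg (k J : ℕ) (E : ℝ) : 0 ≤ stepConst k J E := by
  unfold stepConst; positivity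

theorem StepBound.mono {k s J n : ℕ} {Δ Δ' : ℝ} (h : StepBound k s J n Δ) (hΔ : Δ ≤ Δ') :
    StepBound k s J n Δ' :=
  MeanValueBound.mono h le_rfl
    (mul_nonneg (by positivity) (pow_nonneg (stepConst_nonneg k J _) n)) hΔ

theorem stepBound_zero {k : ℕ} (hk : 1 ≤ k) (s J : ℕ) :
    StepBound k s J 0 (k * (k + 1) / 2) := by
  have hk1 : (1 : ℝ) ≤ k := by exact_mod_cast hk
  unfold StepBound
  rw [zero_mul, add_zero, pow_zero, mul_one]
  refine (meanValueBound_trivial k s).mono ?_ (by positivity) le_rfl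
  exact le_mul_of_one_le_right (by positivity) (Real.one_le_rpow hk1 (by positivity))

theorem StepBound.succ {k s m J n : ℕ} (hk : 1000 ≤ k) (hs : 1 ≤ s) (hmk : m < k)
    (hJ : 1 ≤ J) (hJm : J ≤ k - m) (hJ2 : 16 * k ^ 2 ≤ 2 ^ J) (hJk : 100 * J ≤ 3 * k)
    {Δ Δ' N D : ℝ} (h : StepBound k s J n Δ)
    (hN : N = Δ - ((m : ℝ) ^ 2 + m) / 2) (hN0 : 0 ≤ N) (hNle : N ≤ (k : ℝ) ^ 2 - k * m)
    (hNm : N ≤ k * m) (hD : D = (k : ℝ) ^ 2 - k * m + N) (hDk : 0.3 * (k : ℝ) ^ 2 ≤ D)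
    (hΔ' : Δ - k / D * (2 * N - 4) + 1 / (16 * k) ≤ Δ') :
    StepBound k s J (n + 1) Δ' := by
  have hkR : (1000 : ℝ) ≤ k := by exact_mod_cast hk
  have hD0 : 0 < D := lt_of_lt_of_le (by positivity) hDk
  have hΘ := stepConst_nonneg k J ((k : ℝ) ^ 2)
  have hφJ : J * (k / D) ≤ 1 / 2 := by
    have h1 : (J : ℝ) ≤ 0.03 * k := by
      have : (100 : ℝ) * J ≤ 3 * k := by exact_mod_cast hJk
      linarith
    rw [mul_div_assoc', div_le_iff₀ hD0]
    nlinarith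
  have hmain := MeanValueBound.step hk (by omega : 1 ≤ s + n * k) hmk hJ hJm
    (C := 3 ^ (2 * (s + n * k)) *
      (k : ℝ) ^ (3.65 * k * (k * (k + 1) / 2) : ℝ) * stepConst k J ((k : ℝ) ^ 2) ^ n)
    (mul_nonneg (by positivity) (pow_nonneg hΘ n)) h hN hN0 hNle hNm
    (φ := k / D) (by rw [← hD, div_mul_cancel₀ _ hD0.ne']) hφJ
  rw [show s + n * k + k = s + (n + 1) * k by rw [add_mul, one_mul, add_assoc]] at hmain
  have hΘ1 : 1 ≤ stepConst k J ((k : ℝ) ^ 2) :=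
    (one_le_pow₀ (by norm_num)).trans (nine_pow_le_stepConst (by omega) (by positivity))
  refine MeanValueBound.mono hmain (max_le ?_ ?_)
    (mul_nonneg (by positivity) (pow_nonneg hΘ _)) (le_trans ?_ hΔ')
  · exact le_mul_of_one_le_right (by positivity) (one_le_pow₀ hΘ1)
  · rw [pow_succ _ n]
    have h3 : (3 : ℝ) ^ (2 * (s + n * k)) ≤ 3 ^ (2 * (s + (n + 1) * k)) :=
      pow_le_pow_right₀ (by norm_num) (by rw [add_mul]; omega)
    calc stepConst k J ((k : ℝ) ^ 2) * (3 ^ (2 * (s + n * k)) *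
          (k : ℝ) ^ (3.65 * k * (k * (k + 1) / 2) : ℝ) * stepConst k J ((k : ℝ) ^ 2) ^ n)
        = 3 ^ (2 * (s + n * k)) * ((k : ℝ) ^ (3.65 * k * (k * (k + 1) / 2) : ℝ) *
          (stepConst k J ((k : ℝ) ^ 2) ^ n * stepConst k J ((k : ℝ) ^ 2))) := by
          rw [mul_comm, mul_assoc, mul_assoc]
      _ ≤ 3 ^ (2 * (s + (n + 1) * k)) * ((k : ℝ) ^ (3.65 * k * (k * (k + 1) / 2) : ℝ) *
          (stepConst k J ((k : ℝ) ^ 2) ^ n * stepConst k J ((k : ℝ) ^ 2))) := by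
          refine mul_le_mul_of_nonneg_right h3 ?_
          exact mul_nonneg (by positivity) (mul_nonneg (pow_nonneg hΘ _) hΘ)
      _ = _ := (mul_assoc _ _ _).symm
  · have h1 : (k : ℝ) / 2 ^ J ≤ 1 / (16 * k) := by
      have h2 : 16 * (k : ℝ) ^ 2 ≤ 2 ^ J := by exact_mod_cast hJ2
      rw [div_le_div_iff₀ (by positivity) (by positivity)]
      nlinarith
    linarith

theorem initial_decrement {k m Δ : ℝ} (hk : 1000 ≤ k) (hm : 0.8 * k - 0.8 ≤ m)
    (hm' : m ≤ 0.8 * k) (hΔ : 0.48 * k ^ 2 ≤ Δ) (hΔ' : Δ ≤ k ^ 2 / 2 + k / 2) {N D : ℝ}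
    (hN : N = Δ - (m ^ 2 + m) / 2) (hD : D = k ^ 2 - k * m + N) :
    0 ≤ N ∧ N ≤ k ^ 2 - k * m ∧ N ≤ k * m ∧ 0.3 * k ^ 2 ≤ D ∧
      Δ - k / D * (2 * N - 4) + 1 / (16 * k) ≤ Δ - 0.88 * k := by
  have hkk : 1000 * k ≤ k ^ 2 := by nlinarith
  have hm2 : m ^ 2 ≤ 0.64 * k ^ 2 := by nlinarith
  have hm2' : 0.64 * k ^ 2 - 1.28 * k + 0.64 ≤ m ^ 2 := by nlinarith
  have hkm : k * m ≤ 0.8 * k ^ 2 := by nlinarith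
  have hkm' : 0.8 * k ^ 2 - 0.8 * k ≤ k * m := by nlinarith
  have hDl : 0.3 * k ^ 2 ≤ D := by linarith
  have hD0 : 0 < D := by linarith
  refine ⟨by linarith, by linarith, by linarith, hDl, ?_⟩
  have h1 : 0.8801 * D ≤ 2 * N - 4 := by linarith
  have h2 : k * 0.8801 ≤ k / D * (2 * N - 4) := by
    rw [div_mul_eq_mul_div, le_div_iff₀ hD0, mul_assoc]
    exact mul_le_mul_of_nonneg_left h1 (by linarith)
  have h3 : 1 / (16 * k) ≤ 0.0001 * k := by
    rw [div_le_iff₀ (by linarith)]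
    nlinarith
  linarith

theorem stepBound_initial {k s J : ℕ} (hk : 1000 ≤ k) (hs : 1 ≤ s) (hJ : 1 ≤ J)
    (hJ2 : 16 * k ^ 2 ≤ 2 ^ J) (hJk : 100 * J ≤ 3 * k) (n : ℕ) :
    StepBound k s J n (max ((k : ℝ) ^ 2 / 2 + k / 2 - 0.88 * k * n) (0.48 * (k : ℝ) ^ 2)) := by
  have hkR : (1000 : ℝ) ≤ k := by exact_mod_cast hk
  induction n with
  | zero =>
    refine (stepBound_zero (by omega) s J).mono (le_trans (le_of_eq ?_) (le_max_left _ _))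
    push_cast
    ring
  | succ n ih =>
    set Δ := max ((k : ℝ) ^ 2 / 2 + k / 2 - 0.88 * k * n) (0.48 * (k : ℝ) ^ 2) with hΔ
    have hm5 : 5 * (4 * k / 5) ≤ 4 * k := Nat.mul_div_le _ _
    have hm5' : 4 * k ≤ 5 * (4 * k / 5) + 4 := by omega
    have hmk : 4 * k / 5 < k := by omega
    have hJm : J ≤ k - 4 * k / 5 := by omega
    generalize 4 * k / 5 = m at *
    have hm : 0.8 * (k : ℝ) - 0.8 ≤ m := by
      have : (4 : ℝ) * k ≤ 5 * m + 4 := by exact_mod_cast hm5'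
      linarith
    have hm' : (m : ℝ) ≤ 0.8 * k := by
      have : (5 : ℝ) * m ≤ 4 * k := by exact_mod_cast hm5
      linarith
    have hΔu : Δ ≤ (k : ℝ) ^ 2 / 2 + k / 2 := by
      refine max_le ?_ (by nlinarith)
      have : 0 ≤ 0.88 * (k : ℝ) * n := by positivity
      linarith
    obtain ⟨h1, h2, h3, h4, h5⟩ :=
      initial_decrement hkR hm hm' (le_max_right _ _) hΔu rfl rfl
    refine StepBound.succ hk hs hmk hJ hJm hJ2 hJk ih rfl h1 h2 h3 rfl h4 (h5.trans ?_)
    rw [sub_le_iff_le_add]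
    refine max_le ?_ ?_
    · rw [← sub_le_iff_le_add]
      refine le_trans (le_of_eq ?_) (le_max_left _ _)
      push_cast
      ring
    · rw [← sub_le_iff_le_add]
      refine le_trans ?_ (le_max_right _ _)
      linarith

/-- The decrease of the parameter `Y` in one step, when the exponent excess is
`k * Y - Y ^ 2 / 2 + 5`. -/
noncomputable def drop (k Y : ℝ) : ℝ := (2 * k - 1) * Y / (k ^ 2 - 0.98 * Y ^ 2)

theorem drop_denom_pos {k Y : ℝ} (hk : 1000 ≤ k) (hY : 0 ≤ Y) (hY' : Y ≤ 0.8 * k) :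
    0 < k ^ 2 - 0.98 * Y ^ 2 := by
  nlinarith

theorem drop_nonneg {k Y : ℝ} (hk : 1000 ≤ k) (hY : 0 ≤ Y) (hY' : Y ≤ 0.8 * k) :
    0 ≤ drop k Y :=
  div_nonneg (mul_nonneg (by linarith) hY) (drop_denom_pos hk hY hY').le

theorem decrement_drop {k m Y : ℝ} (hk : 1000 ≤ k) (hY : 0 ≤ Y) (hY' : Y ≤ 0.8 * k)
    (hm : Y + 5 / k ≤ m) (hm' : m ≤ Y + 5 / k + 1) {N D : ℝ}
    (hN : N = k * Y - Y ^ 2 / 2 + 5 - (m ^ 2 + m) / 2) (hD : D = k ^ 2 - k * m + N) :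
    0 ≤ N ∧ N ≤ k ^ 2 - k * m ∧ N ≤ k * m ∧ 0.3 * k ^ 2 ≤ D ∧
      k * Y - Y ^ 2 / 2 + 5 - k / D * (2 * N - 4) + 1 / (16 * k) ≤
        k * (Y - drop k Y) - (Y - drop k Y) ^ 2 / 2 + 5 := by
  have hk0 : 0 < k := by linarith
  have hne := (drop_denom_pos hk hY hY').ne'
  set h := drop k Y with hh
  have hheq : h * (k ^ 2 - 0.98 * Y ^ 2) = (2 * k - 1) * Y := by
    rw [hh, drop, div_mul_cancel₀ _ hne]
  obtain ⟨h1, h2, h3, h4, h5⟩ := decrement_rounding (ε := 1 / k) (y := Y / k) (τ := m - Y)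
    (N := N / k ^ 2) (D := D / k ^ 2) (h := h) (by positivity)
    (by rw [div_le_div_iff₀ hk0 (by norm_num)]; linarith) (by positivity)
    (by rw [div_le_iff₀ hk0]; exact hY')
    (by rw [mul_one_div]; linarith) (by rw [mul_one_div]; linarith)
    (by rw [hN]; field_simp; ring)
    (by rw [hD]; field_simp; ring)
    (by
      have : h * (1 - 0.98 * (Y / k) ^ 2) = h * (k ^ 2 - 0.98 * Y ^ 2) / k ^ 2 := by field_simp
      rw [this, hheq]; field_simp)
  have hkk : 0 < k ^ 2 := by positivity
  have e1 : 1 - Y / k - 1 / k * (m - Y) = (k ^ 2 - k * m) / k ^ 2 := by field_simp; ring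
  have e2 : Y / k + 1 / k * (m - Y) = k * m / k ^ 2 := by field_simp; ring
  rw [e1, div_le_div_iff_of_pos_right hkk] at h3
  rw [e2, div_le_div_iff_of_pos_right hkk] at h4
  rw [le_div_iff₀ hkk] at h1 h2
  have hD0 : 0 < D := by nlinarith
  refine ⟨by linarith, h3, h4, by linarith, ?_⟩
  have e3 : (h * (1 - Y / k) + 1 / k * h ^ 2 / 2 + (1 / k) ^ 2 / 16) * (D / k ^ 2) * k ^ 2
      = (h * (k - Y) + h ^ 2 / 2 + 1 / (16 * k)) / k * D := by field_simp
  have e4 : (2 * (N / k ^ 2) - 4 * (1 / k) ^ 2) * k ^ 2 = 2 * N - 4 := by field_simp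
  have h6 := mul_le_mul_of_nonneg_right h5 hkk.le
  rw [e3, e4, div_mul_eq_mul_div, div_le_iff₀ hk0] at h6
  have h7 : h * (k - Y) + h ^ 2 / 2 + 1 / (16 * k) ≤ k / D * (2 * N - 4) := by
    rw [div_mul_eq_mul_div, le_div_iff₀ hD0]
    linarith
  linarith

theorem log_one_sub_le {u : ℝ} (hu : 0 ≤ u) (hu' : u < 1) :
    Real.log (1 - u) ≤ -u - u ^ 2 / 2 := by
  have h := Real.hasSum_pow_div_log_of_abs_lt_one (x := u) (by rwa [abs_of_nonneg hu])
  have h2 := sum_le_hasSum (Finset.range 2) (fun i _ => by positivity) h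
  norm_num [Finset.sum_range_succ] at h2
  linarith

theorem log_drop_le {k Y : ℝ} (hk : 1000 ≤ k) (hY : 0 < Y) (hY' : Y ≤ 0.8 * k)
    (hlt : 0 < Y - drop k Y) :
    Real.log ((Y - drop k Y) / k) - 0.49 * ((Y - drop k Y) / k) ^ 2 ≤
      Real.log (Y / k) - 0.49 * (Y / k) ^ 2 - 2 / k := by
  have hk0 : 0 < k := by linarith
  have hden := drop_denom_pos hk hY.le hY'
  set u := (2 * k - 1) / (k ^ 2 - 0.98 * Y ^ 2) with hu
  have hdrop : drop k Y = Y * u := by rw [drop, hu]; ring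
  have hu0 : 0 ≤ u := div_nonneg (by linarith) hden.le
  have hu1 : u < 1 := by
    rw [hdrop] at hlt
    by_contra hcon
    nlinarith
  have hueq : u * (1 - 0.98 * (Y / k) ^ 2) = 2 / k - (1 / k) ^ 2 := by
    have : u * (k ^ 2 - 0.98 * Y ^ 2) = 2 * k - 1 := by rw [hu, div_mul_cancel₀ _ hden.ne']
    have h2 : u * (1 - 0.98 * (Y / k) ^ 2) = u * (k ^ 2 - 0.98 * Y ^ 2) / k ^ 2 := by field_simp
    rw [h2, this]
    field_simp
  have hε : 1 / k ≤ 1 / 1000 := one_div_le_one_div_of_le (by norm_num) hk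
  have hε0 : 0 < 1 / k := by positivity
  have hul : 1.5 * (1 / k) ≤ u := by
    have h1 : u * (1 - 0.98 * (Y / k) ^ 2) ≤ u :=
      mul_le_of_le_one_right hu0 (by nlinarith [sq_nonneg (Y / k)])
    have h2 : 2 / k = 2 * (1 / k) := by ring
    nlinarith
  have hsq : 2 * (1 / k) ^ 2 ≤ u ^ 2 := by nlinarith
  have hlog : Real.log ((Y - drop k Y) / k) = Real.log (Y / k) + Real.log (1 - u) := by
    rw [← Real.log_mul (by positivity) (by linarith), hdrop]
    congr 1
    ring
  have hl := log_one_sub_le hu0 hu1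
  have e : ((Y - drop k Y) / k) ^ 2 = (Y / k) ^ 2 * (1 - u) ^ 2 := by rw [hdrop]; ring
  rw [hlog, e]
  have hyu : 0 ≤ (Y / k) ^ 2 * u ^ 2 := by positivity
  nlinarith

theorem stepBound_iterate {k s J n₀ : ℕ} (hk : 1000 ≤ k) (hs : 1 ≤ s) (hJ : 1 ≤ J)
    (hJ2 : 16 * k ^ 2 ≤ 2 ^ J) (hJk : 100 * J ≤ 3 * k)
    (h₀ : StepBound k s J n₀ (0.48 * (k : ℝ) ^ 2)) (n : ℕ) :
    ∃ Y : ℝ, 0.99 ≤ Y ∧ Y ≤ 0.8 * k ∧ StepBound k s J (n₀ + n) (k * Y - Y ^ 2 / 2 + 5) ∧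
      (Y = 0.99 ∨ Real.log (Y / k) - 0.49 * (Y / k) ^ 2 ≤
        Real.log 0.8 - 0.49 * 0.8 ^ 2 - 2 * n / k) := by
  have hkR : (1000 : ℝ) ≤ k := by exact_mod_cast hk
  induction n with
  | zero =>
    refine ⟨0.8 * k, by linarith, le_rfl, h₀.mono (by nlinarith), Or.inr ?_⟩
    rw [mul_div_cancel_right₀ _ (by linarith : (k : ℝ) ≠ 0)]
    simp
  | succ n ih =>
    obtain ⟨Y, hY, hY', hb, hcase⟩ := ih
    set m := ⌈Y + 5 / k⌉₊ with hm
    have hpos : 0 ≤ Y + 5 / (k : ℝ) := by positivity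
    have hml : Y + 5 / (k : ℝ) ≤ m := Nat.le_ceil _
    have hmu : (m : ℝ) ≤ Y + 5 / k + 1 := (Nat.ceil_lt_add_one hpos).le
    have h5 : 5 / (k : ℝ) ≤ 0.005 := by
      rw [div_le_iff₀ (by linarith)]; linarith
    have hJR : (100 : ℝ) * J ≤ 3 * k := by exact_mod_cast hJk
    have hmk : m < k := by
      have : (m : ℝ) < k := by linarith
      exact_mod_cast this
    have hJm : J ≤ k - m := by
      have : (J : ℝ) + m ≤ k := by linarith
      have : J + m ≤ k := by exact_mod_cast this
      omega
    obtain ⟨h1, h2, h3, h4, h6⟩ := decrement_drop hkR (by linarith) hY' hml hmu rfl rfl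
    have hstep := StepBound.succ hk hs hmk hJ hJm hJ2 hJk hb rfl h1 h2 h3 rfl h4 h6
    have hd := drop_nonneg hkR (by linarith : 0 ≤ Y) hY'
    rw [add_assoc] at hstep
    rcases le_or_gt (Y - drop k Y) 0.99 with hle | hgt
    · refine ⟨0.99, le_rfl, by linarith, hstep.mono ?_, Or.inl rfl⟩
      nlinarith
    · refine ⟨Y - drop k Y, hgt.le, by linarith, hstep, Or.inr ?_⟩
      rcases hcase with rfl | hcase
      · linarith
      · have hl := log_drop_le hkR (by linarith) hY' (by linarith)
        have e : 2 * ((n + 1 : ℕ) : ℝ) / k = 2 * n / k + 2 / k := by push_cast; ring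
        rw [e]
        linarith

theorem le_excess {k s : ℝ} (hk : 1000 ≤ k)
    (hs : s ≤ k ^ 2 / 2 * (1 / 2 + Real.log (3 * k / 8))) :
    k ≤ 3 / 8 * k ^ 2 * Real.exp (1 / 2 - 2 * s / k ^ 2 + 1.7 / k) := by
  have hk0 : 0 < k := by linarith
  have h1 : 2 * s / k ^ 2 ≤ 1 / 2 + Real.log (3 * k / 8) := by
    rw [div_le_iff₀ (by positivity)]
    linarith
  have h2 : 0 ≤ 1.7 / k := by positivity
  have h3 : Real.exp (-Real.log (3 * k / 8)) ≤ Real.exp (1 / 2 - 2 * s / k ^ 2 + 1.7 / k) :=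
    Real.exp_le_exp.mpr (by linarith)
  rw [Real.exp_neg, Real.exp_log (by positivity)] at h3
  calc k = 3 / 8 * k ^ 2 * (3 * k / 8)⁻¹ := by field_simp
    _ ≤ _ := mul_le_mul_of_nonneg_left h3 (by positivity)

theorem ratio_le_exp : (0.8 : ℝ) ≤ 3 / 8 * Real.exp 0.7586 := by
  have h1 := Real.sum_le_exp_of_nonneg (by norm_num : (0 : ℝ) ≤ 0.7586 / 4) 4
  have h2 : Real.exp 0.7586 = Real.exp (0.7586 / 4) ^ 4 := by
    rw [← Real.exp_nat_mul]; norm_num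
  have h3 : (1.2087 : ℝ) ≤ Real.exp (0.7586 / 4) := by
    refine le_trans ?_ h1
    norm_num [Finset.sum_range_succ, Nat.factorial]
  have h4 : (1.2087 : ℝ) ^ 4 ≤ Real.exp (0.7586 / 4) ^ 4 := pow_le_pow_left₀ (by norm_num) h3 4
  rw [h2]
  norm_num at h4 ⊢
  linarith

theorem final_excess_le {k s Y n : ℝ} (hk : 1000 ≤ k)
    (hs : s ≤ k ^ 2 / 2 * (1 / 2 + Real.log (3 * k / 8))) (hY : 0 < Y) (hY' : Y ≤ 0.8 * k)
    (hn : s / k - 0.022728 * k - 2.5682 ≤ n)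
    (hlog : Real.log (Y / k) - 0.49 * (Y / k) ^ 2 ≤ Real.log 0.8 - 0.49 * 0.8 ^ 2 - 2 * n / k) :
    k * Y - Y ^ 2 / 2 + 5 ≤ 3 / 8 * k ^ 2 * Real.exp (1 / 2 - 2 * s / k ^ 2 + 1.7 / k) := by
  have hk0 : 0 < k := by linarith
  set A := 3 / 8 * k ^ 2 * Real.exp (1 / 2 - 2 * s / k ^ 2 + 1.7 / k) with hA
  have hkA : k ≤ A := le_excess hk hs
  set y := Y / k with hy
  have hy0 : 0 < y := by positivity
  have hy8 : y ≤ 0.8 := by rw [hy, div_le_iff₀ hk0]; exact hY'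
  set sl := 0.009544 - 3.4364 / k with hsl
  have hsl0 : 0.006 ≤ sl := by
    have : 3.4364 / k ≤ 0.0034364 := by rw [div_le_iff₀ hk0]; linarith
    linarith
  have hsl1 : sl ≤ 0.01 := by
    have : 0 ≤ 3.4364 / k := by positivity
    linarith
  have hksl : 5.1 ≤ k * sl := by
    have : k * sl = 0.009544 * k - 3.4364 := by rw [hsl]; field_simp
    linarith
  have hnk : 2 * s / k ^ 2 - 0.045456 - 5.1364 / k ≤ 2 * n / k := by
    have := mul_le_mul_of_nonneg_left hn (by positivity : 0 ≤ 2 / k)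
    have e : 2 / k * (s / k - 0.022728 * k - 2.5682) = 2 * s / k ^ 2 - 0.045456 - 5.1364 / k := by
      field_simp; norm_num; ring
    rw [e] at this
    linarith [show 2 / k * n = 2 * n / k by ring]
  have h1 : y ≤ 0.8 * Real.exp (0.49 * y ^ 2 - 0.49 * 0.8 ^ 2 - 2 * n / k) := by
    rw [← Real.exp_log hy0]
    nth_rewrite 1 [← Real.exp_log (by norm_num : (0 : ℝ) < 0.8)]
    rw [← Real.exp_add, Real.exp_le_exp, Real.exp_log hy0]
    linarith
  have h2 : 1 - y / 2 ≤ Real.exp (-(0.49 * y ^ 2)) := by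
    refine le_trans ?_ (Real.add_one_le_exp _)
    nlinarith
  have h3 : y * (1 - y / 2) ≤ 0.8 * Real.exp (- 0.49 * 0.8 ^ 2 - 2 * n / k) := by
    calc y * (1 - y / 2) ≤ 0.8 * Real.exp (0.49 * y ^ 2 - 0.49 * 0.8 ^ 2 - 2 * n / k) *
          Real.exp (-(0.49 * y ^ 2)) := mul_le_mul h1 h2 (by linarith) (by positivity)
      _ = _ := by
        rw [mul_assoc, ← Real.exp_add]
        congr 2
        ring
  have h4 : 0.8 * Real.exp (- 0.49 * 0.8 ^ 2 - 2 * n / k) ≤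
      3 / 8 * Real.exp (1 / 2 - 2 * s / k ^ 2 + 1.7 / k - sl) := by
    calc 0.8 * Real.exp (- 0.49 * 0.8 ^ 2 - 2 * n / k)
        ≤ 3 / 8 * Real.exp 0.7586 * Real.exp (- 0.49 * 0.8 ^ 2 - 2 * n / k) :=
          mul_le_mul_of_nonneg_right ratio_le_exp (by positivity)
      _ = 3 / 8 * Real.exp (0.7586 + (- 0.49 * 0.8 ^ 2 - 2 * n / k)) := by
          rw [Real.exp_add, mul_assoc]
      _ ≤ _ := by
          refine mul_le_mul_of_nonneg_left (Real.exp_le_exp.mpr ?_) (by norm_num)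
          have e : 5.1364 / k = 1.7 / k + 3.4364 / k := by rw [← add_div]; norm_num
          rw [hsl]
          linarith
  have h5 : k * Y - Y ^ 2 / 2 ≤ A * Real.exp (-sl) := by
    calc k * Y - Y ^ 2 / 2 = k ^ 2 * (y * (1 - y / 2)) := by rw [hy]; field_simp
      _ ≤ k ^ 2 * (3 / 8 * Real.exp (1 / 2 - 2 * s / k ^ 2 + 1.7 / k - sl)) :=
          mul_le_mul_of_nonneg_left (h3.trans h4) (by positivity)
      _ = _ := by
          rw [sub_eq_add_neg _ sl, Real.exp_add, hA]
          ring
  have h6 : Real.exp (-sl) * (1 + sl) ≤ 1 := by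
    rw [Real.exp_neg, inv_mul_le_iff₀ (Real.exp_pos _), mul_one]
    linarith [Real.add_one_le_exp sl]
  have h7 : A * Real.exp (-sl) * (1 + sl) ≤ A := by
    rw [mul_assoc]
    exact mul_le_of_le_one_right (by linarith) h6
  have h8 : k * sl ≤ A * sl := mul_le_mul_of_nonneg_right hkA (by linarith)
  have h9 : (A * Real.exp (-sl) + 5) * (1 + sl) ≤ A * (1 + sl) := by linarith
  linarith [le_of_mul_le_mul_right h9 (by linarith : 0 < 1 + sl)]

theorem stepBound_final {k s J : ℕ} (hk : 1000 ≤ k) (hs₁ : 2 * k ^ 2 ≤ s)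
    (hs₂ : (s : ℝ) ≤ (k : ℝ) ^ 2 / 2 * (1 / 2 + Real.log (3 * k / 8))) (hJ : 1 ≤ J)
    (hJ2 : 16 * k ^ 2 ≤ 2 ^ J) (hJk : 100 * J ≤ 3 * k) :
    StepBound k (s - (s - 1) / k * k) J ((s - 1) / k)
      (3 / 8 * (k : ℝ) ^ 2 * Real.exp (1 / 2 - 2 * s / (k : ℝ) ^ 2 + 1.7 / k)) := by
  have hkR : (1000 : ℝ) ≤ k := by exact_mod_cast hk
  have hk0 : (0 : ℝ) < k := by linarith
  have hkk : 1000 * k ≤ k ^ 2 := by nlinarith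
  have hdiv := Nat.div_add_mod (s - 1) k
  have hmod := Nat.mod_lt (s - 1) (by omega : 0 < k)
  rw [mul_comm] at hdiv
  have hs0 : 1 ≤ s - (s - 1) / k * k := by omega
  have hsq : s ≤ (s - 1) / k * k + k := by omega
  generalize (s - 1) / k = q at *
  set n₀ := ⌈(0.02 * (k : ℝ) + 0.5) / 0.88⌉₊ with hn₀
  have hn₀l : (0.02 * (k : ℝ) + 0.5) / 0.88 ≤ n₀ := Nat.le_ceil _
  have hn₀u : (n₀ : ℝ) ≤ (0.02 * (k : ℝ) + 0.5) / 0.88 + 1 :=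
    (Nat.ceil_lt_add_one (by positivity)).le
  have hqR : (s : ℝ) / k - 1 ≤ q := by
    have : (s : ℝ) ≤ q * k + k := by exact_mod_cast hsq
    rw [sub_le_iff_le_add, div_le_iff₀ hk0]
    linarith
  have hsk : 2 * (k : ℝ) ≤ s / k := by
    have : (2 : ℝ) * k ^ 2 ≤ s := by exact_mod_cast hs₁
    rw [le_div_iff₀ hk0]
    linarith
  have hn₀q : n₀ ≤ q := by
    have : (n₀ : ℝ) ≤ q := by
      norm_num at hn₀u
      linarith
    exact_mod_cast this
  obtain ⟨n, rfl⟩ := Nat.exists_eq_add_of_le hn₀q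
  have hstart : StepBound k (s - (n₀ + n) * k) J n₀ (0.48 * (k : ℝ) ^ 2) := by
    refine (stepBound_initial hk hs0 hJ hJ2 hJk n₀).mono (max_le ?_ le_rfl)
    rw [div_le_iff₀ (by norm_num)] at hn₀l
    nlinarith
  obtain ⟨Y, hY, hY', hb, hcase⟩ := stepBound_iterate hk hs0 hJ hJ2 hJk hstart n
  refine hb.mono ?_
  rcases hcase with rfl | hcase
  · refine le_trans ?_ (le_excess hkR hs₂)
    linarith
  · refine final_excess_le hkR hs₂ (by linarith) hY' ?_ hcase
    push_cast at hqR
    norm_num at hn₀u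
    linarith

theorem log_ge_of_thousand_le {k : ℝ} (hk : 1000 ≤ k) : 6.9 ≤ Real.log k := by
  have h1 : Real.log 1000 ≤ Real.log k := Real.log_le_log (by norm_num) hk
  have h2 : Real.log 1000 = 10 * Real.log 2 - Real.log 1.024 := by
    have : (1000 : ℝ) = 2 ^ 10 / 1.024 := by norm_num
    rw [this, Real.log_div (by norm_num) (by norm_num), Real.log_pow]
    norm_num
  have h3 : Real.log 1.024 ≤ 1.024 - 1 := Real.log_le_sub_one_of_pos (by norm_num)
  linarith [Real.log_two_gt_d9]

theorem log_three_le : Real.log 3 ≤ 1.6 * Real.log 2 := by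
  have h : Real.log (3 ^ 5) ≤ Real.log (2 ^ 8) := Real.log_le_log (by norm_num) (by norm_num)
  rw [Real.log_pow, Real.log_pow] at h
  push_cast at h
  linarith

theorem log_one_point_zero_six_ge : 0.0581 ≤ Real.log 1.06 := by
  rw [Real.le_log_iff_exp_le (by norm_num)]
  have h1 : Real.exp (-0.0581) = Real.exp (-0.0581 / 16) ^ 16 := by
    rw [← Real.exp_nat_mul]; norm_num
  have h2 : (1 - 0.0581 / 16 : ℝ) ^ 16 ≤ Real.exp (-0.0581 / 16) ^ 16 := by
    refine pow_le_pow_left₀ (by norm_num) ?_ 16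
    have := Real.add_one_le_exp (-0.0581 / 16 : ℝ)
    linarith
  have h3 : 1 / 1.06 ≤ Real.exp (-0.0581) := by
    rw [h1]
    refine le_trans ?_ h2
    norm_num
  rw [Real.exp_neg, one_div, inv_le_inv₀ (by norm_num) (Real.exp_pos _)] at h3
  exact h3

theorem log_stepConst {k J : ℕ} (hk : 1 ≤ k) (E : ℝ) :
    Real.log (stepConst k J E) = 2 * Real.log 3 + 2 * ((k + 3) * Real.log k +
      k * (2 * Real.log 2 + Real.log 3)) + E * Real.log 2 + 2 * (J : ℝ) ^ 2 * Real.log 2 := by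
  have hk0 : (0 : ℝ) < k := by exact_mod_cast hk
  have h9 : Real.log 9 = 2 * Real.log 3 := by
    rw [show (9 : ℝ) = 3 ^ 2 by norm_num, Real.log_pow]; norm_num
  have h4 : Real.log 4 = 2 * Real.log 2 := by
    rw [show (4 : ℝ) = 2 ^ 2 by norm_num, Real.log_pow]; norm_num
  have h12 : Real.log 12 = 2 * Real.log 2 + Real.log 3 := by
    rw [show (12 : ℝ) = 4 * 3 by norm_num, Real.log_mul (by norm_num) (by norm_num), h4]
  unfold stepConst
  rw [Real.log_mul (by positivity) (by positivity), Real.log_mul (by positivity) (by positivity),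
    Real.log_mul (by positivity) (by positivity), Real.log_pow, Real.log_pow,
    Real.log_mul (by positivity) (by positivity), Real.log_pow, Real.log_pow,
    Real.log_rpow (by norm_num), h9, h4, h12]
  push_cast
  ring

theorem constant_exponent_le {k σ L l2 l3 j2 : ℝ} (hk : 1000 ≤ k) (hσ : 2 ≤ σ) (hL : 6.9 ≤ L)
    (hl2 : 0 ≤ l2) (hl2' : l2 ≤ 0.6932) (hl3 : l3 ≤ 1.6 * l2) (hj2 : j2 ≤ 0.0009 * k ^ 2) :
    2 * (σ * k ^ 2) * l3 + 3.65 * k * (k * (k + 1) / 2) * L + σ * k * (2 * l3 +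
      2 * ((k + 3) * L + k * (2 * l2 + l3)) + k ^ 2 * l2 + 2 * j2 * l2) ≤
    (2.055 * k ^ 3 - 5.91 * k ^ 2 + 3 * (σ * k ^ 2)) * L +
      (σ + 2 * σ ^ 2 - 9.7278) * k ^ 3 * 0.0581 := by
  have hk0 : 0 < k := by linarith
  have hσk : 0 ≤ σ * k := by positivity
  have hl3' : l3 ≤ 1.1092 := by linarith
  have hj : j2 * l2 ≤ 0.000624 * k ^ 2 := by nlinarith
  have h1 : 2 * l3 + 2 * (k * (2 * l2 + l3)) + k ^ 2 * l2 + 2 * j2 * l2 + 2 * k * l3 ≤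
      2.2184 + 7.2096 * k + 0.69445 * k ^ 2 := by nlinarith
  have h1' := mul_le_mul_of_nonneg_left h1 hσk
  have h2 : 6.9 * (0.23 * k ^ 2 - 7.735 * k + σ * (k - 6)) ≤
      L * (0.23 * k ^ 2 - 7.735 * k + σ * (k - 6)) := by
    refine mul_le_mul_of_nonneg_right hL ?_
    have : 0 ≤ σ * (k - 6) := mul_nonneg (by linarith) (by linarith)
    nlinarith
  have h2' := mul_le_mul_of_nonneg_left h2 hk0.le
  have h3 : σ * (2.2184 + 7.2096 * k + 0.69445 * k ^ 2) ≤
      6.9 * (0.23 * k ^ 2 - 7.735 * k + σ * (k - 6)) +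
        (σ + 2 * σ ^ 2 - 9.7278) * k ^ 2 * 0.0581 := by
    have h4 : 0 ≤ 0.1162 * σ ^ 2 - 0.6368 * σ + 0.9684 := by
      nlinarith [sq_nonneg (σ - 2.74)]
    have h5 : 2.2184 + 7.2096 * k - 6.9 * (k - 6) ≤ 0.00036 * k ^ 2 := by nlinarith
    have h5' := mul_le_mul_of_nonneg_left h5 (by linarith : 0 ≤ σ)
    have h4' := mul_nonneg h4 (sq_nonneg k)
    have h6 : 1000 * k ≤ k ^ 2 := by nlinarith
    linarith
  have h3' := mul_le_mul_of_nonneg_left h3 hk0.le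
  linarith

theorem constant_le {k s J q : ℕ} (hk : 1000 ≤ k) (hs₁ : 2 * k ^ 2 ≤ s) (hJk : 100 * J ≤ 3 * k)
    (hq : q * k ≤ s) :
    3 ^ (2 * s) * (k : ℝ) ^ (3.65 * k * (k * (k + 1) / 2) : ℝ) * stepConst k J ((k : ℝ) ^ 2) ^ q ≤
      (k : ℝ) ^ (2.055 * (k : ℝ) ^ 3 - 5.91 * (k : ℝ) ^ 2 + 3 * s) *
        (1.06 : ℝ) ^ ((s : ℝ) * k + 2 * (s : ℝ) ^ 2 / k - 9.7278 * (k : ℝ) ^ 3) := by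
  have hkR : (1000 : ℝ) ≤ k := by exact_mod_cast hk
  have hk0 : (0 : ℝ) < k := by linarith
  have hΘ1 : 1 ≤ stepConst k J ((k : ℝ) ^ 2) :=
    (one_le_pow₀ (by norm_num)).trans (nine_pow_le_stepConst (by omega) (by positivity))
  have hΘ : 0 < stepConst k J ((k : ℝ) ^ 2) := by linarith
  set σ := (s : ℝ) / k ^ 2 with hσ
  have hs : (s : ℝ) = σ * k ^ 2 := by rw [hσ]; field_simp
  have hσ2 : 2 ≤ σ := by
    rw [hσ, le_div_iff₀ (by positivity)]
    exact_mod_cast hs₁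
  have hqR : (q : ℝ) ≤ σ * k := by
    have : (q : ℝ) * k ≤ s := by exact_mod_cast hq
    rw [hs] at this
    nlinarith
  have hJR : (J : ℝ) ^ 2 ≤ 0.0009 * k ^ 2 := by
    have : (J : ℝ) ≤ 0.03 * k := by
      have : (100 : ℝ) * J ≤ 3 * k := by exact_mod_cast hJk
      linarith
    have := pow_le_pow_left₀ (Nat.cast_nonneg J) this 2
    linarith
  have hl2 := Real.log_two_lt_d9
  have hmain := constant_exponent_le hkR hσ2 (log_ge_of_thousand_le hkR)
    (Real.log_nonneg one_le_two) (by linarith) log_three_le hJR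
  rw [← log_stepConst (by omega : 1 ≤ k)] at hmain
  refine (Real.log_le_log_iff (by positivity) (by positivity)).mp ?_
  rw [Real.log_mul (by positivity) (by positivity), Real.log_mul (by positivity) (by positivity),
    Real.log_mul (by positivity) (by positivity), Real.log_pow, Real.log_pow,
    Real.log_rpow hk0, Real.log_rpow hk0, Real.log_rpow (by norm_num)]
  have e : (s : ℝ) * k + 2 * (s : ℝ) ^ 2 / k - 9.7278 * (k : ℝ) ^ 3 =
      (σ + 2 * σ ^ 2 - 9.7278) * k ^ 3 := by
    rw [hs]; field_simp
  have h1 : (q : ℝ) * Real.log (stepConst k J ((k : ℝ) ^ 2)) ≤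
      σ * k * Real.log (stepConst k J ((k : ℝ) ^ 2)) :=
    mul_le_mul_of_nonneg_right hqR (Real.log_nonneg hΘ1)
  have h2 : (σ + 2 * σ ^ 2 - 9.7278) * (k : ℝ) ^ 3 * 0.0581 ≤
      (σ + 2 * σ ^ 2 - 9.7278) * (k : ℝ) ^ 3 * Real.log 1.06 :=
    mul_le_mul_of_nonneg_left log_one_point_zero_six_ge
      (mul_nonneg (by nlinarith) (by positivity))
  rw [e]
  push_cast
  rw [hs]
  linarith

open Finset

theorem Jv_le_vinogradov (s k : ℕ) (P : ℝ) :
    Jv s k P ≤ vinogradov k s (progression 1 1 ⌊P⌋₊) := by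
  classical
  have hmem : ∀ x : ℤ, 1 ≤ x → (x : ℝ) ≤ P → x ∈ progression 1 1 ⌊P⌋₊ := by
    intro x hx hxP
    obtain ⟨n, rfl⟩ : ∃ n : ℕ, x = 1 + n := ⟨(x - 1).toNat, by omega⟩
    refine mem_image.mpr ⟨n, mem_range.mpr ?_, by ring⟩
    rw [← Nat.succ_le_iff]
    refine Nat.le_floor ?_
    push_cast at hxP ⊢
    linarith
  unfold Jv vinogradov pairCount
  rw [← Nat.card_eq_finsetCard]
  refine Nat.card_le_card_of_injective (fun xy => ⟨xy.1, ?_⟩) ?_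
  · obtain ⟨⟨x, y⟩, hxy, hsum⟩ := xy
    refine mem_filter.mpr ⟨mem_product.mpr ⟨?_, ?_⟩, ?_⟩
    · exact Fintype.mem_piFinset.mpr fun i => hmem _ (hxy i).1 (hxy i).2.1
    · exact Fintype.mem_piFinset.mpr fun i => hmem _ (hxy i).2.2.1 (hxy i).2.2.2
    · funext j
      have h := hsum (j + 1) (by omega) j.2
      rw [sum_sub_distrib, sub_eq_zero] at h
      simpa [tupleSum, powVec, diff] using h
  · intro a b hab
    exact Subtype.ext (Subtype.mk.inj hab)

end PowerSums

/-- **Theorem 3 (first part), Ford**: for integers `k ≥ 1000` and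
`2k² ≤ s ≤ (k²/2)(1/2 + log(3k/8))`, and every real `P ≥ 1`,
`J_{s,k}(P) ≤ k^{2.055k³−5.91k²+3s} · 1.06^{sk+2s²/k−9.7278k³} · P^{2s−k(k+1)/2+Δ_s}`
where `Δ_s = (3/8)k² exp(1/2 − 2s/k² + 1.7/k)`. -/
theorem vinogradov_integral_bound (k s : ℕ) (hk : 1000 ≤ k) (hs₁ : 2 * k ^ 2 ≤ s)
    (hs₂ : (s : ℝ) ≤ (k : ℝ) ^ 2 / 2 * (1/2 + Real.log (3 * k / 8)))
    (P : ℝ) (hP : 1 ≤ P) :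
    (Jv s k P : ℝ) ≤
      (k : ℝ) ^ (2.055 * (k : ℝ) ^ 3 - 5.91 * (k : ℝ) ^ 2 + 3 * s) *
        (1.06 : ℝ) ^ ((s : ℝ) * k + 2 * (s : ℝ) ^ 2 / k - 9.7278 * (k : ℝ) ^ 3) *
        P ^ (2 * (s : ℝ) - (k : ℝ) * (k + 1) / 2 +
          3/8 * (k : ℝ) ^ 2 * Real.exp (1/2 - 2 * s / (k : ℝ) ^ 2 + 1.7 / k)) := by
  obtain ⟨J, hJ, hJ2, hJk⟩ := PowerSums.exists_depth hk
  have hfin := PowerSums.stepBound_final hk hs₁ hs₂ hJ hJ2 hJk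
  have hqs : (s - 1) / k * k ≤ s := (Nat.div_mul_le_self _ _).trans (Nat.sub_le _ _)
  have hfloor : (⌊P⌋₊ : ℝ) ≤ P + 2 := by
    linarith [Nat.floor_le (by linarith : 0 ≤ P)]
  have hbound := hfin P hP ⌊P⌋₊ hfloor
  rw [Nat.sub_add_cancel hqs] at hbound
  have hle : (Jv s k P : ℝ) ≤ PowerSums.vinogradov k s (PowerSums.progression 1 1 ⌊P⌋₊) := by
    exact_mod_cast PowerSums.Jv_le_vinogradov s k P
  exact (hle.trans hbound).trans
    (mul_le_mul_of_nonneg_right (PowerSums.constant_le hk hs₁ hJk hqs) (by positivity))
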